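/- Let (m, M) be a valid pair of positive integers. Then the limit inferior, as x → ∞, of the ratio #{negative fundamental discriminants Δ with −x < Δ < 0, Δ ≡ m (mod M), and 3 ∤ h(Δ)} / #{negative fundamental discriminants Δ with −x < Δ < 0} is at least 1/(2·Φ(M)) · ∏_{p ∣ M} q(p)/(p+1), where Φ is Euler's totient function, the product runs over the prime divisors p of M, q(2) = 4 and q(p) = p for odd primes p. -/

import Mathlib

open IntermediateField Filter

/-- A pair `(m, M)` of positive integers is *valid* if every odd prime `ℓ` dividing
`gcd(m, M)` satisfies `ℓ² ∣ M` and `ℓ² ∤ m`, and if `M` is even then either `4 ∣ M` and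
`m ≡ 1 (mod 4)`, or `16 ∣ M` and `m ≡ 8, 12 (mod 16)`. -/
def ValidPair (m M : ℕ) : Prop :=
  (∀ ℓ : ℕ, ℓ.Prime → ℓ ≠ 2 → ℓ ∣ Nat.gcd m M → (ℓ ^ 2 ∣ M ∧ ¬ ℓ ^ 2 ∣ m)) ∧
  (2 ∣ M → ((4 ∣ M ∧ m % 4 = 1) ∨ (16 ∣ M ∧ (m % 16 = 8 ∨ m % 16 = 12))))

/-- A fundamental discriminant: `Δ ≠ 1` and either `Δ ≡ 1 (mod 4)` and `Δ` squarefree,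
or `Δ ≡ 0 (mod 4)`, `Δ/4` squarefree and `Δ/4 ≡ 2, 3 (mod 4)`. -/
def IsFundamentalDiscriminant (Δ : ℤ) : Prop :=
  Δ ≠ 1 ∧ ((Δ % 4 = 1 ∧ Squarefree Δ) ∨
    (Δ % 4 = 0 ∧ Squarefree (Δ / 4) ∧ ((Δ / 4) % 4 = 2 ∨ (Δ / 4) % 4 = 3)))

/-- The quadratic field ℚ(√Δ), realized inside ℂ. -/
noncomputable def quadField (Δ : ℤ) : IntermediateField ℚ ℂ :=
  ℚ⟮(Δ : ℂ) ^ ((1 : ℂ) / 2)⟯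

/-- The class number `h(Δ)` of ℚ(√Δ): the cardinality of the ideal class group of its
ring of integers. -/
noncomputable def classNum (Δ : ℤ) : ℕ :=
  Nat.card (ClassGroup (integralClosure ℤ (quadField Δ)))


/-- A family of integral binary cubic forms `a x³ + 3 b x² y + 3 c x y² + d y³` of negative Hessian
discriminant that is stable under `GL₂(ℤ)` contains a form with reduced Hessian. -/
theorem exists_reduced_of_stable {Δ : ℤ} {S : ℤ → ℤ → ℤ → ℤ → Prop}
    (hne : ∃ a b c d, S a b c d)
    (hshift : ∀ a b c d k, S a b c d →
      S a (b + k * a) (c + 2 * k * b + k ^ 2 * a) (d + 3 * k * c + 3 * k ^ 2 * b + k ^ 3 * a))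
    (hswap : ∀ a b c d, S a b c d → S d c b a)
    (hflip : ∀ a b c d, S a b c d → S a (-b) c (-d))
    (hlead : ∀ a b c d, S a b c d → a ≠ 0)
    (hpos : ∀ a b c d, S a b c d → 0 < b ^ 2 - a * c)
    (hdisc : ∀ a b c d, S a b c d →
      (b * c - a * d) ^ 2 - 4 * (b ^ 2 - a * c) * (c ^ 2 - b * d) = Δ) :
    ∃ a b c d : ℤ, 0 < a ∧ 0 ≤ b * c - a * d ∧ b * c - a * d ≤ b ^ 2 - a * c ∧
      b ^ 2 - a * c ≤ c ^ 2 - b * d ∧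
      (b * c - a * d) ^ 2 - 4 * (b ^ 2 - a * c) * (c ^ 2 - b * d) = Δ := by
  classical
  have hex : ∃ n : ℕ, ∃ a b c d, S a b c d ∧ b ^ 2 - a * c = n := by
    obtain ⟨a, b, c, d, h⟩ := hne
    exact ⟨(b ^ 2 - a * c).toNat, a, b, c, d, h, (Int.toNat_of_nonneg (hpos _ _ _ _ h).le).symm⟩
  obtain ⟨a, b, c, d, h, hA⟩ := Nat.find_spec hex
  have hmin : ∀ a' b' c' d', S a' b' c' d' → b ^ 2 - a * c ≤ b' ^ 2 - a' * c' := by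
    intro a' b' c' d' h'
    have h1 := Nat.find_min' hex ⟨a', b', c', d', h',
      (Int.toNat_of_nonneg (hpos _ _ _ _ h').le).symm⟩
    have h2 := hpos _ _ _ _ h'
    rw [hA]
    omega
  have hA0 := hpos _ _ _ _ h
  -- translate so that the middle coefficient of the Hessian becomes small
  obtain ⟨b₁, c₁, d₁, h₁, hA₁, hB₁⟩ : ∃ b₁ c₁ d₁, S a b₁ c₁ d₁ ∧ b₁ ^ 2 - a * c₁ = b ^ 2 - a * c ∧
      |b₁ * c₁ - a * d₁| ≤ b ^ 2 - a * c := by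
    set A := b ^ 2 - a * c with hAdef
    set B := b * c - a * d with hBdef
    let k : ℤ := -((B + A) / (2 * A))
    refine ⟨_, _, _, hshift a b c d k h, by ring, ?_⟩
    have h1 : (b + k * a) * (c + 2 * k * b + k ^ 2 * a) -
        a * (d + 3 * k * c + 3 * k ^ 2 * b + k ^ 3 * a) = B + 2 * k * A := by
      simp only [hAdef, hBdef]; ring
    rw [h1]
    have h2 := Int.emod_add_mul_ediv (B + A) (2 * A)
    have h3 := Int.emod_nonneg (B + A) (by omega : 2 * A ≠ 0)
    have h4 := Int.emod_lt_of_pos (B + A) (by omega : 0 < 2 * A)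
    have h5 : B + 2 * k * A = (B + A) % (2 * A) - A := by
      simp only [k]; linear_combination -h2
    rw [h5, abs_le]
    constructor <;> omega
  have hC : b₁ ^ 2 - a * c₁ ≤ c₁ ^ 2 - b₁ * d₁ := by
    have := hmin _ _ _ _ (hswap _ _ _ _ h₁)
    rw [hA₁]
    linarith [mul_comm d₁ b₁]
  rw [← hA₁, abs_le] at hB₁
  have key : ∀ b c d, S a b c d → 0 ≤ b * c - a * d → b * c - a * d ≤ b ^ 2 - a * c →
      b ^ 2 - a * c ≤ c ^ 2 - b * d → ∃ a b c d : ℤ, 0 < a ∧ 0 ≤ b * c - a * d ∧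
      b * c - a * d ≤ b ^ 2 - a * c ∧ b ^ 2 - a * c ≤ c ^ 2 - b * d ∧
      (b * c - a * d) ^ 2 - 4 * (b ^ 2 - a * c) * (c ^ 2 - b * d) = Δ := by
    intro b c d hS h1 h2 h3
    rcases (hlead _ _ _ _ hS).lt_or_gt with ha | ha
    · refine ⟨-a, -b, -c, -d, by omega, ?_, ?_, ?_, ?_⟩
      · linarith
      · linarith
      · linarith
      · linarith [hdisc _ _ _ _ hS]
    · exact ⟨a, b, c, d, ha, h1, h2, h3, hdisc _ _ _ _ hS⟩
  rcases le_total 0 (b₁ * c₁ - a * d₁) with hB | hB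
  · exact key _ _ _ h₁ hB hB₁.2 hC
  · exact key _ _ _ (hflip _ _ _ _ h₁) (by linarith) (by linarith [hB₁.1]) (by linarith)

/-- The Hessian of the cubic form attached to a basis `α, β` of an ideal with cube `(δ)`. -/
theorem hessian_identity {α β α' β' δ δ' s n g₀ g₁ g₂ g₃ g₀' g₁' g₂' g₃' f₀ f₁ f₂ f₃ : ℂ}
    (hδ : δ * δ' = n ^ 3) (hw : (α * β' - α' * β) ^ 2 = n ^ 2 * s ^ 2) (hn : n ≠ 0) (hs : s ≠ 0)
    (h₀ : α ^ 3 = δ * g₀) (h₁ : α ^ 2 * β = δ * g₁) (h₂ : α * β ^ 2 = δ * g₂) (h₃ : β ^ 3 = δ * g₃)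
    (h₀' : α' ^ 3 = δ' * g₀') (h₁' : α' ^ 2 * β' = δ' * g₁') (h₂' : α' * β' ^ 2 = δ' * g₂')
    (h₃' : β' ^ 3 = δ' * g₃')
    (hf₀ : g₀ - g₀' = f₀ * s) (hf₁ : g₁ - g₁' = f₁ * s) (hf₂ : g₂ - g₂' = f₂ * s)
    (hf₃ : g₃ - g₃' = f₃ * s) :
    n * (f₁ ^ 2 - f₀ * f₂) = α * α' ∧ n * (f₁ * f₂ - f₀ * f₃) = α * β' + α' * β ∧
      n * (f₂ ^ 2 - f₁ * f₃) = β * β' := by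
  have hδ0 : δ ≠ 0 := by rintro rfl; exact pow_ne_zero 3 hn (by simpa using hδ.symm)
  have hδ0' : δ' ≠ 0 := by rintro rfl; exact pow_ne_zero 3 hn (by simpa using hδ.symm)
  have c0 : g₀ = α ^ 3 / δ := by rw [h₀]; field_simp
  have c1 : g₁ = α ^ 2 * β / δ := by rw [h₁]; field_simp
  have c2 : g₂ = α * β ^ 2 / δ := by rw [h₂]; field_simp
  have c3 : g₃ = β ^ 3 / δ := by rw [h₃]; field_simp
  have c0' : g₀' = α' ^ 3 / δ' := by rw [h₀']; field_simp
  have c1' : g₁' = α' ^ 2 * β' / δ' := by rw [h₁']; field_simp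
  have c2' : g₂' = α' * β' ^ 2 / δ' := by rw [h₂']; field_simp
  have c3' : g₃' = β' ^ 3 / δ' := by rw [h₃']; field_simp
  have hns : n ^ 2 * s ^ 2 ≠ 0 := by positivity
  have hf0 : f₀ = (g₀ - g₀') / s := by rw [hf₀]; field_simp
  have hf1 : f₁ = (g₁ - g₁') / s := by rw [hf₁]; field_simp
  have hf2 : f₂ = (g₂ - g₂') / s := by rw [hf₂]; field_simp
  have hf3 : f₃ = (g₃ - g₃') / s := by rw [hf₃]; field_simp
  have hnn : n ^ 3 ≠ 0 := by positivity
  refine ⟨?_, ?_, ?_⟩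
  · have : f₁ ^ 2 - f₀ * f₂ = α * α' * (α * β' - α' * β) ^ 2 / (δ * δ' * s ^ 2) := by
      rw [hf0, hf1, hf2, c0, c1, c2, c0', c1', c2']; field_simp; ring
    rw [this, hw, hδ]; field_simp
  · have : f₁ * f₂ - f₀ * f₃ = (α * β' + α' * β) * (α * β' - α' * β) ^ 2 / (δ * δ' * s ^ 2) := by
      rw [hf0, hf1, hf2, hf3, c0, c1, c2, c3, c0', c1', c2', c3']; field_simp; ring
    rw [this, hw, hδ]; field_simp
  · have : f₂ ^ 2 - f₁ * f₃ = β * β' * (α * β' - α' * β) ^ 2 / (δ * δ' * s ^ 2) := by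
      rw [hf1, hf2, hf3, c1, c2, c3, c1', c2', c3']; field_simp; ring
    rw [this, hw, hδ]; field_simp

open scoped ComplexConjugate nonZeroDivisors in
/-- If the order `O = ℤ ⊕ ℤ (Δ + √Δ)/2` is a Dedekind domain with a class of order three, then
there is a reduced integral binary cubic form of Hessian discriminant `Δ`. -/
theorem exists_reduced_cubic {O : Type*} [CommRing O] [IsDedekindDomain O] [Module.Free ℤ O]
    [Module.Finite ℤ O] {Δ : ℤ} (hΔ : Δ < 0) {s : ℂ} (hs : s ^ 2 = Δ) (hs' : conj s = -s)
    (ι : O →+* ℂ) (hι : Function.Injective ι) (e : Module.Basis (Fin 2) ℤ O)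
    (he₀ : ι (e 0) = 1) (he₁ : ι (e 1) = (Δ + s) / 2)
    (κ : ClassGroup O) (hκ : κ ≠ 1) (hκ3 : κ ^ 3 = 1) :
    ∃ a b c d : ℤ, 0 < a ∧ 0 ≤ b * c - a * d ∧ b * c - a * d ≤ b ^ 2 - a * c ∧
      b ^ 2 - a * c ≤ c ^ 2 - b * d ∧
      (b * c - a * d) ^ 2 - 4 * (b ^ 2 - a * c) * (c ^ 2 - b * d) = Δ := by
  have hs0 : s ≠ 0 := by
    rintro rfl
    have h1 : (Δ : ℂ) = 0 := by simpa using hs.symm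
    have h2 : Δ = 0 := by exact_mod_cast h1
    omega
  have hcoord : ∀ z : O, ι z = (e.repr z 0 : ℂ) + (e.repr z 1 : ℂ) * ((Δ + s) / 2) := by
    intro z
    conv_lhs => rw [← e.sum_repr z]
    simp [Fin.sum_univ_two, he₀, he₁]
  have hcoord' : ∀ z : O, conj (ι z) = (e.repr z 0 : ℂ) + (e.repr z 1 : ℂ) * ((Δ - s) / 2) := by
    intro z
    rw [hcoord z]
    simp [hs', sub_eq_add_neg, Complex.conj_ofNat]
  have hdiff : ∀ z : O, ι z - conj (ι z) = (e.repr z 1 : ℂ) * s := by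
    intro z
    rw [hcoord' z, hcoord z]; ring
  have hwedge : ∀ u v : O, ι u * conj (ι v) - conj (ι u) * ι v = -(e.det ![u, v] : ℂ) * s := by
    intro u v
    rw [hcoord' u, hcoord u, hcoord' v, hcoord v, Module.Basis.det_apply, Matrix.det_fin_two]
    simp [Module.Basis.toMatrix_apply]
    ring
  have hcov : ∀ (J : Ideal O) (bJ : Module.Basis (Fin 2) ℤ J),
      (ι (bJ 0) * conj (ι (bJ 1)) - conj (ι (bJ 0)) * ι (bJ 1)) ^ 2
        = (Ideal.absNorm J : ℂ) ^ 2 * s ^ 2 := by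
    intro J bJ
    rw [hwedge, ← Ideal.natAbs_det_basis_change e J bJ]
    have : (Subtype.val ∘ bJ : Fin 2 → O) = ![(bJ 0 : O), (bJ 1 : O)] := by
      ext i; fin_cases i <;> rfl
    rw [this]
    have h2 : ((e.det ![(bJ 0 : O), (bJ 1 : O)]).natAbs : ℂ) ^ 2
        = (e.det ![(bJ 0 : O), (bJ 1 : O)] : ℂ) ^ 2 := by
      have h (x : ℤ) : (x.natAbs : ℂ) ^ 2 = (x : ℂ) ^ 2 := by
        have := congrArg (Int.cast : ℤ → ℂ) (Int.natAbs_sq x)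
        push_cast at this
        simpa using this
      exact h _
    rw [h2]; ring
  have hnormsq : ∀ z : O, z ≠ 0 → ι z * conj (ι z) = (Ideal.absNorm (Ideal.span {z}) : ℂ) := by
    intro z hz
    have h1 := hcov (Ideal.span {z}) (Ideal.basisSpanSingleton e hz)
    have h2 : ι z * ι (e 0) * conj (ι z * ι (e 1)) - conj (ι z * ι (e 0)) * (ι z * ι (e 1))
        = -(ι z * conj (ι z)) * s := by
      rw [he₀, he₁]
      simp [hs', Complex.conj_ofNat]
      ring
    simp only [Ideal.basisSpanSingleton_apply, map_mul ι] at h1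
    rw [h2] at h1
    have h3 : (ι z * conj (ι z)) ^ 2 = (Ideal.absNorm (Ideal.span {z}) : ℂ) ^ 2 := by
      have : s ^ 2 ≠ 0 := pow_ne_zero 2 hs0
      apply mul_right_cancel₀ this
      rw [← h1]; ring
    rw [Complex.mul_conj] at h3 ⊢
    have h4 : (Complex.normSq (ι z)) ^ 2 = ((Ideal.absNorm (Ideal.span {z}) : ℕ) : ℝ) ^ 2 := by
      exact_mod_cast h3
    have h5 := (pow_left_inj₀ (Complex.normSq_nonneg _) (Nat.cast_nonneg _) two_ne_zero).1 h4
    rw [h5]; rfl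
  obtain ⟨⟨I, hI⟩, rfl⟩ := ClassGroup.mk0_surjective κ
  have hI0 : I ≠ ⊥ := nonZeroDivisors.ne_zero hI
  have hI3 : Submodule.IsPrincipal (I ^ 3) := by
    rw [← map_pow] at hκ3
    exact (ClassGroup.mk0_eq_one_iff (pow_mem hI 3)).1 hκ3
  have hIp : ∀ k z : O, k ≠ 0 → z ≠ 0 → Ideal.span {k} * I ≠ Ideal.span {z} := by
    intro k z hk hz h
    apply hκ
    rw [← map_one ClassGroup.mk0, ClassGroup.mk0_eq_mk0_iff]
    exact ⟨k, z, hk, hz, by simpa using h⟩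
  obtain ⟨δ, hδ⟩ := hI3
  rw [Ideal.submodule_span_eq] at hδ
  have hδ0 : δ ≠ 0 := by
    rintro rfl
    have : I ^ 3 = 0 := by rw [hδ]; simp
    exact hI0 ((pow_eq_zero_iff three_ne_zero).1 this)
  set n := Ideal.absNorm I with hn
  have hn0 : (n : ℂ) ≠ 0 := by
    have : n ≠ 0 := by rw [hn, Ne, Ideal.absNorm_eq_zero_iff]; exact hI0
    exact_mod_cast this
  have hnδ : ι δ * conj (ι δ) = (n : ℂ) ^ 3 := by
    rw [hnormsq δ hδ0, ← hδ, map_pow]; push_cast; rfl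
  let S : ℤ → ℤ → ℤ → ℤ → Prop := fun f₀ f₁ f₂ f₃ => ∃ α β g₀ g₁ g₂ g₃ : O,
    α ∈ I ∧ β ∈ I ∧
    (ι α * conj (ι β) - conj (ι α) * ι β) ^ 2 = (n : ℂ) ^ 2 * s ^ 2 ∧
    (α ^ 3 = δ * g₀ ∧ α ^ 2 * β = δ * g₁ ∧ α * β ^ 2 = δ * g₂ ∧ β ^ 3 = δ * g₃) ∧
    (e.repr g₀ 1 = f₀ ∧ e.repr g₁ 1 = f₁ ∧ e.repr g₂ 1 = f₂ ∧ e.repr g₃ 1 = f₃)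
  have hess : ∀ a b c d, S a b c d → ∃ α β : O,
      (ι α * conj (ι β) - conj (ι α) * ι β) ^ 2 = (n : ℂ) ^ 2 * s ^ 2 ∧
      (n : ℂ) * ((b ^ 2 - a * c : ℤ) : ℂ) = ι α * conj (ι α) ∧
      (n : ℂ) * ((b * c - a * d : ℤ) : ℂ) = ι α * conj (ι β) + conj (ι α) * ι β ∧
      (n : ℂ) * ((c ^ 2 - b * d : ℤ) : ℂ) = ι β * conj (ι β) := by
    rintro a b c d ⟨α, β, g₀, g₁, g₂, g₃, -, -, hw, ⟨h0, h1, h2, h3⟩, rfl, rfl, rfl, rfl⟩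
    have := hessian_identity (α := ι α) (β := ι β) (α' := conj (ι α)) (β' := conj (ι β))
      (δ := ι δ) (δ' := conj (ι δ)) (s := s) (n := n) (g₀ := ι g₀) (g₁ := ι g₁) (g₂ := ι g₂)
      (g₃ := ι g₃) (g₀' := conj (ι g₀)) (g₁' := conj (ι g₁)) (g₂' := conj (ι g₂))
      (g₃' := conj (ι g₃)) hnδ hw hn0 hs0
      (by simp only [← map_pow, ← map_mul, h0]) (by simp only [← map_pow, ← map_mul, h1])
      (by simp only [← map_pow, ← map_mul, h2]) (by simp only [← map_pow, ← map_mul, h3])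
      (by simp only [← map_pow, ← map_mul, h0]) (by simp only [← map_pow, ← map_mul, h1])
      (by simp only [← map_pow, ← map_mul, h2]) (by simp only [← map_pow, ← map_mul, h3])
      (hdiff g₀) (hdiff g₁) (hdiff g₂) (hdiff g₃)
    refine ⟨α, β, hw, ?_⟩
    push_cast
    exact this
  have hpos' : ∀ a b c d, S a b c d → 0 ≤ b ^ 2 - a * c := by
    intro a b c d h
    obtain ⟨α, β, hw, h1, -, -⟩ := hess _ _ _ _ h
    rw [Complex.mul_conj] at h1
    have h2 : (n : ℝ) * ((b ^ 2 - a * c : ℤ) : ℝ) = Complex.normSq (ι α) := by exact_mod_cast h1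
    by_contra hneg
    push Not at hneg
    have h3 : ((b ^ 2 - a * c : ℤ) : ℝ) < 0 := by exact_mod_cast hneg
    have h4 : 0 < (n : ℝ) := by
      have : n ≠ 0 := by exact_mod_cast hn0
      positivity
    have := Complex.normSq_nonneg (ι α)
    nlinarith
  have hdisc : ∀ a b c d, S a b c d →
      (b * c - a * d) ^ 2 - 4 * (b ^ 2 - a * c) * (c ^ 2 - b * d) = Δ := by
    intro a b c d h
    obtain ⟨α, β, hw, h1, h2, h3⟩ := hess _ _ _ _ h
    have h4 : (n : ℂ) ^ 2 *
        ((((b * c - a * d) ^ 2 - 4 * (b ^ 2 - a * c) * (c ^ 2 - b * d) : ℤ)) : ℂ)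
        = (n : ℂ) ^ 2 * Δ := by
      rw [← hs, ← hw]
      push_cast at h1 h2 h3 ⊢
      linear_combination (((n : ℂ) * (b * c - a * d)) + (ι α * conj (ι β) + conj (ι α) * ι β)) * h2
        - 4 * (n * ((c : ℂ) ^ 2 - b * d)) * h1 - 4 * (ι α * conj (ι α)) * h3
    exact_mod_cast mul_left_cancel₀ (pow_ne_zero 2 hn0) h4
  have hpos : ∀ a b c d, S a b c d → 0 < b ^ 2 - a * c := by
    intro a b c d h
    refine lt_of_le_of_ne (hpos' _ _ _ _ h) fun h0 => ?_
    have := hdisc _ _ _ _ h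
    rw [← h0] at this
    nlinarith [sq_nonneg (b * c - a * d)]
  have hcube : ∀ x y z : O, x ∈ I → y ∈ I → z ∈ I → ∃ g, x * y * z = δ * g := by
    intro x y z hx hy hz
    have : x * y * z ∈ I ^ 3 := by
      rw [pow_succ, pow_two]
      exact Ideal.mul_mem_mul (Ideal.mul_mem_mul hx hy) hz
    rw [hδ, Ideal.mem_span_singleton'] at this
    obtain ⟨g, hg⟩ := this
    exact ⟨g, by rw [← hg]; ring⟩
  refine exists_reduced_of_stable (S := S) ?_ ?_ ?_ ?_ ?_ hpos hdisc
  · let bI := Ideal.selfBasis e I hI0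
    obtain ⟨g₀, h0⟩ := hcube _ _ _ (bI 0).2 (bI 0).2 (bI 0).2
    obtain ⟨g₁, h1⟩ := hcube _ _ _ (bI 0).2 (bI 0).2 (bI 1).2
    obtain ⟨g₂, h2⟩ := hcube _ _ _ (bI 0).2 (bI 1).2 (bI 1).2
    obtain ⟨g₃, h3⟩ := hcube _ _ _ (bI 1).2 (bI 1).2 (bI 1).2
    exact ⟨_, _, _, _, bI 0, bI 1, g₀, g₁, g₂, g₃, (bI 0).2, (bI 1).2, hcov I bI,
      ⟨by rw [← h0]; ring, by rw [← h1]; ring, by rw [← h2]; ring, by rw [← h3]; ring⟩,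
      rfl, rfl, rfl, rfl⟩
  · rintro a b c d k ⟨α, β, g₀, g₁, g₂, g₃, hα, hβ, hw, ⟨h0, h1, h2, h3⟩, rfl, rfl, rfl, rfl⟩
    refine ⟨α, β + k • α, g₀, g₁ + k • g₀, g₂ + (2 * k) • g₁ + (k ^ 2) • g₀,
      g₃ + (3 * k) • g₂ + (3 * k ^ 2) • g₁ + (k ^ 3) • g₀, hα,
      I.add_mem hβ (zsmul_mem hα k), ?_, ⟨h0, ?_, ?_, ?_⟩, rfl, ?_, ?_, ?_⟩
    · rw [← hw]
      simp only [zsmul_eq_mul, map_add, map_mul, map_intCast]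
      ring
    · simp only [zsmul_eq_mul]
      linear_combination h1 + k * h0
    · simp only [zsmul_eq_mul]; push_cast
      linear_combination h2 + 2 * k * h1 + k ^ 2 * h0
    · simp only [zsmul_eq_mul]; push_cast
      linear_combination h3 + 3 * k * h2 + 3 * k ^ 2 * h1 + k ^ 3 * h0
    · simp only [map_add, map_zsmul, Finsupp.add_apply, Finsupp.smul_apply, smul_eq_mul]
    · simp only [map_add, map_zsmul, Finsupp.add_apply, Finsupp.smul_apply, smul_eq_mul]
    · simp only [map_add, map_zsmul, Finsupp.add_apply, Finsupp.smul_apply, smul_eq_mul]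
  · rintro a b c d ⟨α, β, g₀, g₁, g₂, g₃, hα, hβ, hw, ⟨h0, h1, h2, h3⟩, rfl, rfl, rfl, rfl⟩
    exact ⟨β, α, g₃, g₂, g₁, g₀, hβ, hα, by rw [← hw]; ring, ⟨h3, by rw [← h2]; ring,
      by rw [← h1]; ring, h0⟩, rfl, rfl, rfl, rfl⟩
  · rintro a b c d ⟨α, β, g₀, g₁, g₂, g₃, hα, hβ, hw, ⟨h0, h1, h2, h3⟩, rfl, rfl, rfl, rfl⟩
    refine ⟨α, -β, g₀, -g₁, g₂, -g₃, hα, I.neg_mem hβ, ?_, ⟨h0, ?_, ?_, ?_⟩, rfl, ?_, rfl, ?_⟩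
    · rw [← hw]; simp only [map_neg]; ring
    · linear_combination -h1
    · linear_combination h2
    · linear_combination -h3
    · simp
    · simp
  · rintro a b c d h rfl
    have hA := hpos _ _ _ _ h
    obtain ⟨α, β, g₀, g₁, g₂, g₃, hα, hβ, hw, ⟨h0, h1, h2, h3⟩, hf0, rfl, rfl, rfl⟩ := h
    have hα0 : α ≠ 0 := by
      rintro rfl
      simp only [map_zero, zero_mul, sub_zero] at hw
      exact mul_ne_zero (pow_ne_zero 2 hn0) (pow_ne_zero 2 hs0) (by simpa using hw.symm)
    -- `g₀` is a rational integer `m` with `m² = A³`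
    set A := e.repr g₁ 1 ^ 2 - 0 * e.repr g₂ 1 with hAdef
    set m := e.repr g₀ 0 with hm
    have hg0 : g₀ = (m : O) := by
      apply hι
      rw [hcoord g₀, hf0]; simp [hm]
    have hnorm : (n : ℂ) * (A : ℂ) = ι α * conj (ι α) := by
      have := (hessian_identity (α := ι α) (β := ι β) (α' := conj (ι α)) (β' := conj (ι β))
        (δ := ι δ) (δ' := conj (ι δ)) (s := s) (n := n) (g₀ := ι g₀) (g₁ := ι g₁) (g₂ := ι g₂)
        (g₃ := ι g₃) (g₀' := conj (ι g₀)) (g₁' := conj (ι g₁)) (g₂' := conj (ι g₂))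
        (g₃' := conj (ι g₃)) hnδ hw hn0 hs0
        (by simp only [← map_pow, ← map_mul, h0]) (by simp only [← map_pow, ← map_mul, h1])
        (by simp only [← map_pow, ← map_mul, h2]) (by simp only [← map_pow, ← map_mul, h3])
        (by simp only [← map_pow, ← map_mul, h0]) (by simp only [← map_pow, ← map_mul, h1])
        (by simp only [← map_pow, ← map_mul, h2]) (by simp only [← map_pow, ← map_mul, h3])
        (hdiff g₀) (hdiff g₁) (hdiff g₂) (hdiff g₃)).1
      rw [← this, hAdef, hf0]; push_cast; ring
    have hmA : A ^ 3 = m ^ 2 := by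
      have h5 : ι α ^ 3 * conj (ι α) ^ 3 = (n : ℂ) ^ 3 * (m : ℂ) ^ 2 := by
        have h6 : ι α ^ 3 = ι δ * m := by rw [← map_pow, h0, hg0]; simp
        have h7 : conj (ι α) ^ 3 = conj (ι δ) * m := by rw [← map_pow, h6]; simp
        rw [h6, h7, ← hnδ]; ring
      have h8 : (n : ℂ) ^ 3 * (A : ℂ) ^ 3 = (n : ℂ) ^ 3 * (m : ℂ) ^ 2 := by
        rw [← h5, ← mul_pow, hnorm]; ring
      exact_mod_cast mul_left_cancel₀ (pow_ne_zero 3 hn0) h8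
    obtain ⟨k, -, hk⟩ := Nat.exists_eq_pow_of_exponent_coprime_of_pow_eq_pow
      (a := A.natAbs) (b := m.natAbs) (m := 3) (n := 2) (by norm_num)
      (by rw [← Int.natAbs_pow, ← Int.natAbs_pow, hmA])
    have hk0 : (k : O) ≠ 0 := by
      intro hk0
      have h9 : α ^ 3 = 0 := by
        rcases Int.natAbs_eq m with h | h <;> rw [h0, hg0, h, hk] <;> push_cast <;>
          rw [hk0] <;> simp
      exact hα0 (pow_eq_zero_iff (by norm_num) |>.1 h9)
    refine hIp k α hk0 hα0 ?_
    have h10 : (Ideal.span {(k : O)} * I) ^ 3 = Ideal.span {α} ^ 3 := by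
      rw [mul_pow, hδ, Ideal.span_singleton_pow, Ideal.span_singleton_pow,
        Ideal.span_singleton_mul_span_singleton, h0, hg0, Ideal.span_singleton_eq_span_singleton]
      rcases Int.natAbs_eq m with h | h
      · rw [h, hk]; push_cast; rw [mul_comm]
      · rw [h, hk]; push_cast; rw [mul_neg, mul_comm]
        exact (Associated.refl _).neg_right
    apply le_antisymm
    · exact Ideal.dvd_iff_le.1 (
        (UniqueFactorizationMonoid.pow_dvd_pow_iff_dvd (by norm_num : 3 ≠ 0)).1 h10.symm.dvd)
    · exact Ideal.dvd_iff_le.1 (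
        (UniqueFactorizationMonoid.pow_dvd_pow_iff_dvd (by norm_num : 3 ≠ 0)).1 h10.dvd)

theorem int_coeffs_of_isIntegral {Δ : ℤ} (hΔ : Δ < 0) (hf : IsFundamentalDiscriminant Δ) {p q : ℚ}
    {a N : ℤ} (ha : 2 * p = a) (hN : p ^ 2 - q ^ 2 * Δ = N) :
    ∃ u t : ℤ, p = u + t * Δ / 2 ∧ q = t / 2 := by
  set k : ℤ := a ^ 2 - 4 * N with hk
  have h1 : (2 * q) ^ 2 * Δ = (k : ℚ) := by
    rw [hk]; push_cast; rw [← ha, ← hN]; ring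
  have h2 : IsIntegral ℤ (2 * q * Δ) := by
    apply IsIntegral.of_pow (n := 2) two_pos
    have : (2 * q * Δ) ^ 2 = ((k * Δ : ℤ) : ℚ) := by push_cast; rw [← h1]; ring
    rw [this]
    exact isIntegral_algebraMap (R := ℤ) (A := ℚ) (x := k * Δ)
  obtain ⟨Y, hY⟩ := (IsIntegrallyClosed.isIntegral_iff (R := ℤ) (K := ℚ)).1 h2
  simp only [algebraMap_int_eq, eq_intCast] at hY
  have hY2 : Y ^ 2 = k * Δ := by
    have : (Y : ℚ) ^ 2 = k * Δ := by rw [hY, ← h1]; ring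
    exact_mod_cast this
  have hΔ0 : (Δ : ℚ) ≠ 0 := by exact_mod_cast hΔ.ne
  have finish : ∀ t : ℤ, 2 * q = t → (2 : ℤ) ∣ a - t * Δ →
      ∃ u t : ℤ, p = u + t * Δ / 2 ∧ q = t / 2 := by
    rintro t ht ⟨u, hu⟩
    refine ⟨u, t, ?_, by rw [← ht]; ring⟩
    have : (a : ℚ) - t * Δ = 2 * u := by exact_mod_cast hu
    linarith
  rcases hf.2 with ⟨hmod, hsq⟩ | ⟨hmod, hsq, hmod'⟩
  · obtain ⟨t, rfl⟩ := (hsq.dvd_pow_iff_dvd two_ne_zero).1 ⟨k, by rw [hY2]; ring⟩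
    have ht : 2 * q = t := by
      apply mul_right_cancel₀ hΔ0
      rw [← hY]; push_cast; ring
    refine finish t ht ?_
    have h3 : t ^ 2 * Δ = a ^ 2 - 4 * N := by
      rw [ht] at h1
      exact_mod_cast h1
    have h4 : (t ^ 2 * Δ) % 4 = a ^ 2 % 4 := by omega
    have h5 : t % 4 = 0 ∨ t % 4 = 1 ∨ t % 4 = 2 ∨ t % 4 = 3 := by omega
    have h6 : a % 4 = 0 ∨ a % 4 = 1 ∨ a % 4 = 2 ∨ a % 4 = 3 := by omega
    have h7 : t % 2 = a % 2 := by
      rcases h5 with h5 | h5 | h5 | h5 <;> rcases h6 with h6 | h6 | h6 | h6 <;>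
        simp [pow_two, Int.mul_emod, h5, h6, hmod] at h4 <;> omega
    have h8 : (t * Δ) % 2 = t % 2 := by
      have : Δ % 2 = 1 := by omega
      rw [Int.mul_emod, this]; omega
    omega
  · obtain ⟨D, rfl⟩ : (4 : ℤ) ∣ Δ := by omega
    have hD : 4 * D / 4 = D := by omega
    rw [hD] at hsq hmod'
    obtain ⟨Z, rfl⟩ : (2 : ℤ) ∣ Y := by
      apply Int.prime_two.dvd_of_dvd_pow (n := 2)
      exact ⟨k * 2 * D, by rw [hY2]; ring⟩
    have hZ2 : Z ^ 2 = k * D := by linarith [hY2]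
    obtain ⟨r, rfl⟩ := (hsq.dvd_pow_iff_dvd two_ne_zero).1 ⟨k, by rw [hZ2]; ring⟩
    have hD0 : (D : ℚ) ≠ 0 := by
      have : D ≠ 0 := by omega
      exact_mod_cast this
    have hr : 4 * q = r := by
      apply mul_right_cancel₀ hD0
      push_cast at hY
      linarith
    have h3 : r ^ 2 * D = a ^ 2 - 4 * N := by
      have : (r : ℚ) ^ 2 * D = a ^ 2 - 4 * N := by
        rw [← hr]; push_cast at h1
        rw [hk] at h1; push_cast at h1; linarith
      exact_mod_cast this
    have h4 : (r ^ 2 * D) % 4 = a ^ 2 % 4 := by omega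
    have h5 : r % 4 = 0 ∨ r % 4 = 1 ∨ r % 4 = 2 ∨ r % 4 = 3 := by omega
    have h6 : a % 4 = 0 ∨ a % 4 = 1 ∨ a % 4 = 2 ∨ a % 4 = 3 := by omega
    have h7 : r % 2 = 0 ∧ a % 2 = 0 := by
      rcases hmod' with hm | hm <;>
      rcases h5 with h5 | h5 | h5 | h5 <;> rcases h6 with h6 | h6 | h6 | h6 <;>
        simp [pow_two, Int.mul_emod, h5, h6, hm] at h4 <;> omega
    obtain ⟨t, rfl⟩ : (2 : ℤ) ∣ r := by omega
    refine finish t (by push_cast at hr; linarith) ?_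
    have : t * (4 * D) = 2 * (2 * (t * D)) := by ring
    omega

open scoped ComplexConjugate in
theorem conj_eq_neg_of_sq_neg {Δ : ℤ} (hΔ : Δ < 0) {s : ℂ} (hs : s ^ 2 = Δ) : conj s = -s := by
  have h1 := congrArg Complex.re hs
  have h2 := congrArg Complex.im hs
  simp [pow_two] at h1 h2
  have hΔ' : (Δ : ℝ) < 0 := by exact_mod_cast hΔ
  have hre : s.re = 0 := by
    by_contra h
    have him : s.im = 0 := by
      have : s.re * s.im = 0 := by linarith
      exact (mul_eq_zero.1 this).resolve_left h
    rw [him] at h1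
    nlinarith [mul_self_nonneg s.re]
  apply Complex.ext <;> simp [hre]

theorem mem_quadField {Δ : ℤ} {s : ℂ} (hs : s ^ 2 = Δ) {z : ℂ} (hz : z ∈ ℚ⟮s⟯) :
    ∃ p q : ℚ, z = p + q * s := by
  have hinteg : IsIntegral ℚ s := by
    refine IsIntegral.of_pow (n := 2) two_pos ?_
    rw [hs]
    simpa using isIntegral_algebraMap (R := ℚ) (A := ℂ) (x := (Δ : ℚ))
  have h1 : z ∈ Algebra.adjoin ℚ {s} := by
    rw [← IntermediateField.adjoin_simple_toSubalgebra_of_isAlgebraic hinteg.isAlgebraic]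
    exact hz
  induction h1 using Algebra.adjoin_induction with
  | mem x hx => rw [Set.mem_singleton_iff.1 hx]; exact ⟨0, 1, by simp⟩
  | algebraMap r => exact ⟨r, 0, by simp⟩
  | add x y hx hy h1 h2 =>
    rw [← IntermediateField.adjoin_simple_toSubalgebra_of_isAlgebraic hinteg.isAlgebraic] at hx hy
    obtain ⟨p, q, rfl⟩ := h1 hx
    obtain ⟨p', q', rfl⟩ := h2 hy
    exact ⟨p + p', q + q', by push_cast; ring⟩
  | mul x y hx hy h1 h2 =>
    rw [← IntermediateField.adjoin_simple_toSubalgebra_of_isAlgebraic hinteg.isAlgebraic] at hx hy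
    obtain ⟨p, q, rfl⟩ := h1 hx
    obtain ⟨p', q', rfl⟩ := h2 hy
    refine ⟨p * p' + q * q' * Δ, p * q' + q * p', ?_⟩
    push_cast
    rw [← hs]; ring

theorem exists_int_of_isIntegral_ratCast {r : ℚ} (h : IsIntegral ℤ (r : ℂ)) : ∃ n : ℤ, r = n := by
  have h1 : IsIntegral ℤ r := by
    rw [← isIntegral_algHom_iff ((algebraMap ℚ ℂ).toIntAlgHom) (algebraMap ℚ ℂ).injective]
    simpa using h
  obtain ⟨n, hn⟩ := (IsIntegrallyClosed.isIntegral_iff (R := ℤ) (K := ℚ)).1 h1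
  exact ⟨n, by rw [← hn]; simp⟩

open scoped ComplexConjugate NumberField in
/-- A negative fundamental discriminant whose class number is divisible by three is the Hessian
discriminant of a reduced integral binary cubic form. -/
theorem exists_reduced_cubic_of_three_dvd_classNum {Δ : ℤ} (hΔ : Δ < 0)
    (hf : IsFundamentalDiscriminant Δ) (h3 : 3 ∣ classNum Δ) :
    ∃ a b c d : ℤ, 0 < a ∧ 0 ≤ b * c - a * d ∧ b * c - a * d ≤ b ^ 2 - a * c ∧
      b ^ 2 - a * c ≤ c ^ 2 - b * d ∧
      (b * c - a * d) ^ 2 - 4 * (b ^ 2 - a * c) * (c ^ 2 - b * d) = Δ := by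
  set s : ℂ := (Δ : ℂ) ^ ((1 : ℂ) / 2) with hsdef
  have hs : s ^ 2 = Δ := by
    rw [hsdef, one_div]
    exact Complex.cpow_nat_inv_pow (Δ : ℂ) two_ne_zero
  have hs' := conj_eq_neg_of_sq_neg hΔ hs
  have hs0 : s ≠ 0 := by
    rintro h
    rw [h] at hs
    have h1 : (Δ : ℂ) = 0 := by simpa using hs.symm
    have h2 : Δ = 0 := by exact_mod_cast h1
    omega
  have hinteg : IsIntegral ℚ s := by
    refine IsIntegral.of_pow (n := 2) two_pos ?_
    rw [hs]
    simpa using isIntegral_algebraMap (R := ℚ) (A := ℂ) (x := (Δ : ℚ))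
  let K : IntermediateField ℚ ℂ := ℚ⟮s⟯
  have : FiniteDimensional ℚ K := IntermediateField.adjoin.finiteDimensional hinteg
  have : NumberField K := ⟨⟩
  let ι : 𝓞 K →+* ℂ := (algebraMap K ℂ).comp (algebraMap (𝓞 K) K)
  have hι : Function.Injective ι :=
    (algebraMap K ℂ).injective.comp (NumberField.RingOfIntegers.coe_injective)
  have hform : ∀ z : 𝓞 K, ∃ u t : ℤ, ι z = u + t * ((Δ + s) / 2) := by
    intro z
    obtain ⟨p, q, hpq⟩ := mem_quadField hs (algebraMap (𝓞 K) K z).2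
    have hz : ι z = p + q * s := hpq
    have hzc : conj (ι z) = p - q * s := by rw [hz]; simp [hs', sub_eq_add_neg]
    have hi : IsIntegral ℤ (ι z) := (NumberField.RingOfIntegers.isIntegral z).map ι.toIntAlgHom
    have hic : IsIntegral ℤ (conj (ι z)) := hi.map (conj : ℂ →+* ℂ).toIntAlgHom
    obtain ⟨a, ha⟩ := exists_int_of_isIntegral_ratCast (r := 2 * p) (by
      have := hi.add hic
      rw [hzc, hz] at this
      have h : ((2 * p : ℚ) : ℂ) = p + q * s + (p - q * s) := by push_cast; ring
      rw [h]; exact this)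
    obtain ⟨N, hN⟩ := exists_int_of_isIntegral_ratCast (r := p ^ 2 - q ^ 2 * Δ) (by
      have := hi.mul hic
      rw [hzc, hz] at this
      have h : ((p ^ 2 - q ^ 2 * Δ : ℚ) : ℂ) = (p + q * s) * (p - q * s) := by
        push_cast; rw [← hs]; ring
      rw [h]; exact this)
    obtain ⟨u, t, hp, hq⟩ := int_coeffs_of_isIntegral hΔ hf ha hN
    refine ⟨u, t, ?_⟩
    rw [hz, hp, hq]; push_cast; ring
  have hω : IsIntegral ℤ ((Δ + s) / 2) := by
    obtain ⟨k, hk⟩ : ∃ k : ℤ, Δ ^ 2 - Δ = 4 * k := by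
      have : Δ % 4 = 0 ∨ Δ % 4 = 1 := by rcases hf.2 with h | h <;> simp [h.1]
      rcases this with h | h
      · obtain ⟨j, hj⟩ : (4 : ℤ) ∣ Δ := by omega
        exact ⟨j * (Δ - 1), by rw [pow_two]; nth_rw 1 [hj]; nth_rw 2 [hj]; ring⟩
      · obtain ⟨j, hj⟩ : (4 : ℤ) ∣ Δ - 1 := by omega
        exact ⟨j * Δ, by linear_combination Δ * hj⟩
    refine ⟨Polynomial.X ^ 2 - Polynomial.C Δ * Polynomial.X + Polynomial.C k, ?_, ?_⟩
    · monicity!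
    · have hk' : (Δ : ℂ) ^ 2 - Δ = 4 * k := by exact_mod_cast hk
      simp only [Polynomial.eval₂_add, Polynomial.eval₂_sub, Polynomial.eval₂_mul,
        Polynomial.eval₂_pow, Polynomial.eval₂_X, Polynomial.eval₂_C]
      simp only [eq_intCast]
      linear_combination hs / 4 - hk' / 4
  have hsK : s ∈ K := IntermediateField.mem_adjoin_simple_self ℚ s
  have hωK : ((Δ : ℂ) + s) / 2 ∈ K := by
    apply K.div_mem (K.add_mem (by simp) hsK)
    simp
  let ω : 𝓞 K := ⟨⟨_, hωK⟩, by
    rw [mem_integralClosure_iff, ← isIntegral_algHom_iff (algebraMap K ℂ).toIntAlgHom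
      (algebraMap K ℂ).injective]
    exact hω⟩
  have hιω : ι ω = (Δ + s) / 2 := rfl
  have hli : LinearIndependent ℤ ![(1 : 𝓞 K), ω] := by
    rw [LinearIndependent.pair_iff]
    intro x y hxy
    have h1 : (x : ℂ) + y * ((Δ + s) / 2) = 0 := by
      have := congrArg ι hxy
      simpa [hιω] using this
    have h2 : (x : ℂ) + y * ((Δ - s) / 2) = 0 := by
      have := congrArg conj h1
      simpa [hs', sub_eq_add_neg, Complex.conj_ofNat] using this
    have h3 : (y : ℂ) * s = 0 := by linear_combination h1 - h2
    have h4 : (y : ℂ) = 0 := (mul_eq_zero.1 h3).resolve_right hs0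
    rw [h4] at h1
    exact ⟨by simpa using h1, by exact_mod_cast h4⟩
  have hspan : (⊤ : Submodule ℤ (𝓞 K)) ≤ Submodule.span ℤ (Set.range ![(1 : 𝓞 K), ω]) := by
    intro z _
    obtain ⟨u, t, hz⟩ := hform z
    have : z = u • (1 : 𝓞 K) + t • ω := by
      apply hι
      rw [hz, map_add, map_zsmul, map_zsmul, hιω]; simp
    rw [this]
    exact add_mem (Submodule.smul_mem _ _ (Submodule.subset_span ⟨0, rfl⟩))
      (Submodule.smul_mem _ _ (Submodule.subset_span ⟨1, rfl⟩))
  let e := Module.Basis.mk hli hspan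
  have hcl : 3 ∣ Nat.card (ClassGroup (𝓞 K)) := h3
  have : Fact (Nat.Prime 3) := ⟨Nat.prime_three⟩
  obtain ⟨κ, hκ⟩ := exists_prime_orderOf_dvd_card' 3 hcl
  refine exists_reduced_cubic hΔ hs hs' ι hι e ?_ ?_ κ ?_ ?_
  · simp [e]
  · simp [e, hιω]
  · rintro rfl
    simp at hκ
  · rw [← hκ]; exact pow_orderOf_eq_one κ

/-- Hessian discriminant of the binary cubic form `v₀ x³ + 3 v₁ x²y + 3 v₂ xy² + v₃ y³`. -/
def cubicDisc {R : Type*} [CommRing R] (v : Fin 4 → R) : R :=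
  (v 1 * v 2 - v 0 * v 3) ^ 2 - 4 * (v 1 ^ 2 - v 0 * v 2) * (v 2 ^ 2 - v 1 * v 3)

/-- The gradient of `cubicDisc`. -/
def cubicGrad {R : Type*} [CommRing R] (v : Fin 4 → R) : Fin 4 → R :=
  ![2 * (v 0 * v 3 ^ 2 - 3 * v 1 * v 2 * v 3 + 2 * v 2 ^ 3),
    6 * (2 * v 1 ^ 2 * v 3 - v 1 * v 2 ^ 2 - v 0 * v 2 * v 3),
    6 * (2 * v 0 * v 2 ^ 2 - v 1 ^ 2 * v 2 - v 0 * v 1 * v 3),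
    2 * (v 0 ^ 2 * v 3 - 3 * v 0 * v 1 * v 2 + 2 * v 1 ^ 3)]

theorem map_cubicDisc {R S : Type*} [CommRing R] [CommRing S] (f : R →+* S) (v : Fin 4 → R) :
    f (cubicDisc v) = cubicDisc (fun i => f (v i)) := by
  simp [cubicDisc, map_ofNat f]

theorem map_cubicGrad {R S : Type*} [CommRing R] [CommRing S] (f : R →+* S) (v : Fin 4 → R)
    (i : Fin 4) : f (cubicGrad v i) = cubicGrad (fun i => f (v i)) i := by
  fin_cases i <;> simp [cubicGrad, map_ofNat f]

theorem cubicDisc_sub {R : Type*} [CommRing R] (v w : Fin 4 → R) (i : Fin 4)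
    (h : ∀ j, j ≠ i → v j = w j) :
    ∃ r, cubicDisc v - cubicDisc w = (v i - w i) * (cubicGrad v i + (w i - v i) * r) := by
  fin_cases i
  · have h1 := h 1 (by decide); have h2 := h 2 (by decide); have h3 := h 3 (by decide)
    refine ⟨v 3 ^ 2, ?_⟩
    simp [cubicDisc, cubicGrad, ← h1, ← h2, ← h3]; ring
  · have h1 := h 0 (by decide); have h2 := h 2 (by decide); have h3 := h 3 (by decide)
    refine ⟨4 * v 3 * (w 1 + 2 * v 1) - 3 * v 2 ^ 2, ?_⟩
    simp [cubicDisc, cubicGrad, ← h1, ← h2, ← h3]; ring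
  · have h1 := h 0 (by decide); have h2 := h 1 (by decide); have h3 := h 3 (by decide)
    refine ⟨4 * v 0 * (w 2 + 2 * v 2) - 3 * v 1 ^ 2, ?_⟩
    simp [cubicDisc, cubicGrad, ← h1, ← h2, ← h3]; ring
  · have h1 := h 0 (by decide); have h2 := h 1 (by decide); have h3 := h 2 (by decide)
    refine ⟨v 0 ^ 2, ?_⟩
    simp [cubicDisc, cubicGrad, ← h1, ← h2, ← h3]; ring

/-- The Hessian of a binary cubic form vanishes identically. -/
def HessianZero {R : Type*} [CommRing R] (v : Fin 4 → R) : Prop :=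
  v 1 ^ 2 - v 0 * v 2 = 0 ∧ v 1 * v 2 - v 0 * v 3 = 0 ∧ v 2 ^ 2 - v 1 * v 3 = 0

theorem hessianZero_of_cubicGrad_eq_zero {F : Type*} [Field F] (h2 : (2 : F) ≠ 0) (v : Fin 4 → F)
    (h : cubicGrad v = 0) : HessianZero v := by
  have e0 := congrFun h 0
  have e1 := congrFun h 1
  have e2 := congrFun h 2
  have e3 := congrFun h 3
  simp only [cubicGrad, Matrix.cons_val, Pi.zero_apply] at e0 e1 e2 e3
  unfold HessianZero
  generalize v 0 = a at *
  generalize v 1 = b at *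
  generalize v 2 = c at *
  generalize v 3 = d at *
  obtain ⟨A, hA⟩ : ∃ A, A = b ^ 2 - a * c := ⟨_, rfl⟩
  obtain ⟨B, hB⟩ : ∃ B, B = b * c - a * d := ⟨_, rfl⟩
  obtain ⟨C, hC⟩ : ∃ C, C = c ^ 2 - b * d := ⟨_, rfl⟩
  have f0 : d * B = 2 * c * C := by
    apply mul_left_cancel₀ h2
    rw [hB, hC]; linear_combination -e0
  have f3 : a * B = 2 * b * A := by
    apply mul_left_cancel₀ h2
    rw [hB, hA]; linear_combination -e3
  have hD : B ^ 2 = 4 * A * C := by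
    have h4 : (2 : F) ^ 2 ≠ 0 := pow_ne_zero 2 h2
    apply mul_left_cancel₀ h4
    rw [hA, hB, hC]
    linear_combination a * e0 + b * e1 + c * e2 + d * e3
  have hA0 : A = 0 := by
    by_contra hne
    have g1 : A * (b ^ 2) = a ^ 2 * C := by
      have h4 : (2 : F) ^ 2 * A ≠ 0 := mul_ne_zero (pow_ne_zero 2 h2) hne
      apply mul_left_cancel₀ h4
      linear_combination -(a * B + 2 * b * A) * f3 + a ^ 2 * hD
    have g2 : A ^ 2 = C * a ^ 2 - B * a * b + A * b ^ 2 := by rw [hA, hB, hC]; ring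
    have : A ^ 2 = 0 := by rw [g2]; linear_combination -b * f3 - g1
    exact hne (pow_eq_zero_iff two_ne_zero |>.1 this)
  have hC0 : C = 0 := by
    by_contra hne
    have g1 : C * (c ^ 2) = d ^ 2 * A := by
      have h4 : (2 : F) ^ 2 * C ≠ 0 := mul_ne_zero (pow_ne_zero 2 h2) hne
      apply mul_left_cancel₀ h4
      linear_combination -(d * B + 2 * c * C) * f0 + d ^ 2 * hD
    have g2 : C ^ 2 = A * d ^ 2 - B * c * d + C * c ^ 2 := by rw [hA, hB, hC]; ring
    have : C ^ 2 = 0 := by rw [g2]; linear_combination -c * f0 - g1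
    exact hne (pow_eq_zero_iff two_ne_zero |>.1 this)
  refine ⟨by rw [← hA, hA0], ?_, by rw [← hC, hC0]⟩
  rw [← hB]
  rw [hA0] at hD
  exact pow_eq_zero_iff two_ne_zero |>.1 (by rw [hD]; ring)

theorem card_ker_pow_mul_le {p k j : ℕ} (hp : p.Prime) (hj : j ≤ k) :
    Nat.card {x : ZMod (p ^ k) // (p : ZMod (p ^ k)) ^ j * x = 0} ≤ p ^ j := by
  have : NeZero (p ^ k) := ⟨pow_ne_zero _ hp.ne_zero⟩
  let f : {x : ZMod (p ^ k) // (p : ZMod (p ^ k)) ^ j * x = 0} → Fin (p ^ j) := fun x =>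
    ⟨x.1.val / p ^ (k - j), by
      rw [Nat.div_lt_iff_lt_mul (pow_pos hp.pos _), ← pow_add, Nat.add_sub_cancel' hj]
      exact ZMod.val_lt _⟩
  have hf : Function.Injective f := by
    intro x y hxy
    have key : ∀ x : {x : ZMod (p ^ k) // (p : ZMod (p ^ k)) ^ j * x = 0},
        p ^ (k - j) ∣ x.1.val := by
      intro x
      have h1 := x.2
      have h2 : ((p ^ j * x.1.val : ℕ) : ZMod (p ^ k)) = 0 := by
        push_cast; rw [ZMod.natCast_zmod_val]; exact h1
      rw [ZMod.natCast_eq_zero_iff] at h2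
      have h3 : p ^ j * p ^ (k - j) ∣ p ^ j * x.1.val := by
        rwa [← pow_add, Nat.add_sub_cancel' hj]
      exact Nat.dvd_of_mul_dvd_mul_left (pow_pos hp.pos _) h3
    apply Subtype.ext
    apply ZMod.val_injective
    have h1 : x.1.val / p ^ (k - j) = y.1.val / p ^ (k - j) := congrArg Fin.val hxy
    rw [← Nat.div_mul_cancel (key x), h1, Nat.div_mul_cancel (key y)]
  simpa using Nat.card_le_card_of_injective f hf

theorem card_fiber_castHom_le {p k j : ℕ} (hp : p.Prime) (hj : j ≤ k) (y : ZMod (p ^ j)) :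
    Nat.card {x : ZMod (p ^ k) // ZMod.castHom (pow_dvd_pow p hj) (ZMod (p ^ j)) x = y}
      ≤ p ^ (k - j) := by
  have : NeZero (p ^ k) := ⟨pow_ne_zero _ hp.ne_zero⟩
  have : NeZero (p ^ j) := ⟨pow_ne_zero _ hp.ne_zero⟩
  let f : {x : ZMod (p ^ k) // ZMod.castHom (pow_dvd_pow p hj) (ZMod (p ^ j)) x = y} →
      Fin (p ^ (k - j)) := fun x =>
    ⟨x.1.val / p ^ j, by
      rw [Nat.div_lt_iff_lt_mul (pow_pos hp.pos _), ← pow_add, Nat.sub_add_cancel hj]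
      exact ZMod.val_lt _⟩
  have hf : Function.Injective f := by
    intro x z hxz
    have key : ∀ x : {x : ZMod (p ^ k) // ZMod.castHom (pow_dvd_pow p hj) (ZMod (p ^ j)) x = y},
        x.1.val % p ^ j = y.val := by
      intro x
      have h := congrArg ZMod.val x.2
      rwa [ZMod.castHom_apply, ZMod.cast_eq_val, ZMod.val_natCast] at h
    apply Subtype.ext
    apply ZMod.val_injective
    have h1 : x.1.val / p ^ j = z.1.val / p ^ j := congrArg Fin.val hxz
    rw [← Nat.div_add_mod x.1.val (p ^ j), ← Nat.div_add_mod z.1.val (p ^ j), h1, key x, key z]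
  simpa using Nat.card_le_card_of_injective f hf

theorem pow_mul_eq_zero_of_mul_eq_zero {p k j : ℕ} (hp : p.Prime) (hj : j + 1 ≤ k)
    {x y : ZMod (p ^ k)} (hxy : x * y = 0)
    (hy : ZMod.castHom (pow_dvd_pow p hj) (ZMod (p ^ (j + 1))) y ≠ 0) :
    (p : ZMod (p ^ k)) ^ j * x = 0 := by
  have : NeZero (p ^ k) := ⟨pow_ne_zero _ hp.ne_zero⟩
  have h1 : p ^ k ∣ x.val * y.val := by
    rw [← ZMod.natCast_eq_zero_iff]; push_cast
    rw [ZMod.natCast_zmod_val, ZMod.natCast_zmod_val, hxy]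
  have h2 : ¬ p ^ (j + 1) ∣ y.val := by
    rw [← ZMod.natCast_eq_zero_iff]
    rwa [ZMod.castHom_apply, ZMod.cast_eq_val] at hy
  have h3 : p ^ (k - j) ∣ x.val := by
    by_cases hx : x.val = 0
    · rw [hx]; exact dvd_zero _
    have hy0 : y.val ≠ 0 := by intro h; rw [h] at h2; exact h2 (dvd_zero _)
    have : Fact p.Prime := ⟨hp⟩
    rw [padicValNat_dvd_iff_le (mul_ne_zero hx hy0), padicValNat.mul hx hy0] at h1
    rw [padicValNat_dvd_iff_le hy0] at h2
    rw [padicValNat_dvd_iff_le hx]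
    omega
  have h4 : p ^ k ∣ p ^ j * x.val := by
    calc p ^ k = p ^ j * p ^ (k - j) := by rw [← pow_add, Nat.add_sub_cancel' (by omega)]
      _ ∣ _ := Nat.mul_dvd_mul_left _ h3
  rw [← ZMod.natCast_eq_zero_iff] at h4
  push_cast at h4
  rwa [ZMod.natCast_zmod_val] at h4

/-- A residue class modulo `p ^ (j + 1)` at which the gradient does not vanish contains few
solutions of `cubicDisc v = m`. -/
theorem card_cubicDisc_fiber_le {p k j : ℕ} (hp : p.Prime) (hj : j + 1 ≤ k) (m : ZMod (p ^ k))
    (v₀ : Fin 4 → ZMod (p ^ (j + 1))) (hv₀ : cubicGrad v₀ ≠ 0) :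
    Nat.card {v : Fin 4 → ZMod (p ^ k) // cubicDisc v = m ∧
      (fun i => ZMod.castHom (pow_dvd_pow p hj) (ZMod (p ^ (j + 1))) (v i)) = v₀}
      ≤ p ^ j * (p ^ (k - (j + 1))) ^ 3 := by
  classical
  have : NeZero (p ^ k) := ⟨pow_ne_zero _ hp.ne_zero⟩
  set π := ZMod.castHom (pow_dvd_pow p hj) (ZMod (p ^ (j + 1))) with hπ
  obtain ⟨i, hi⟩ := Function.ne_iff.1 hv₀
  let T := {v : Fin 4 → ZMod (p ^ k) // cubicDisc v = m ∧ (fun i => π (v i)) = v₀}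
  let N := {x : ZMod (p ^ k) // (p : ZMod (p ^ k)) ^ j * x = 0}
  let Y := (l : {l : Fin 4 // l ≠ i}) → {x : ZMod (p ^ k) // π x = v₀ l}
  let f : T → Y := fun v l => ⟨v.1 l, congrFun v.2.2 l⟩
  have key : ∀ v w : T, f v = f w → (p : ZMod (p ^ k)) ^ j * (v.1 i - w.1 i) = 0 := by
    intro v w hvw
    have hne : ∀ l, l ≠ i → v.1 l = w.1 l := fun l hl =>
      congrArg Subtype.val (congrFun hvw ⟨l, hl⟩)
    obtain ⟨r, hr⟩ := cubicDisc_sub v.1 w.1 i hne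
    rw [v.2.1, w.2.1, sub_self] at hr
    refine pow_mul_eq_zero_of_mul_eq_zero hp hj hr.symm ?_
    rw [map_add, map_mul, map_sub, map_cubicGrad]
    have e1 : (fun i => π (v.1 i)) = v₀ := v.2.2
    have e2 : π (v.1 i) = v₀ i := congrFun v.2.2 i
    have e3 : π (w.1 i) = v₀ i := congrFun w.2.2 i
    rw [← hπ, e1, e2, e3]
    simpa using hi
  let g : Y → T → ZMod (p ^ k) := fun y v =>
    if h : ∃ w : T, f w = y then v.1 i - h.choose.1 i else 0
  have hg : ∀ v : T, (p : ZMod (p ^ k)) ^ j * g (f v) v = 0 := by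
    intro v
    have hex : ∃ w : T, f w = f v := ⟨v, rfl⟩
    simp only [g, dif_pos hex]
    exact key _ _ hex.choose_spec.symm
  let F : T → Y × N := fun v => (f v, ⟨g (f v) v, hg v⟩)
  have hF : Function.Injective F := by
    intro v w hvw
    have h1 : f v = f w := congrArg Prod.fst hvw
    have h2 : g (f v) v = g (f w) w := congrArg (fun z : Y × N => z.2.1) hvw
    have hex : ∃ u : T, f u = f w := ⟨w, rfl⟩
    rw [h1] at h2
    simp only [g, dif_pos hex, sub_left_inj] at h2
    apply Subtype.ext
    funext l
    by_cases hl : l = i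
    · rw [hl]; exact h2
    · exact congrArg Subtype.val (congrFun h1 ⟨l, hl⟩)
  calc Nat.card T ≤ Nat.card (Y × N) := Nat.card_le_card_of_injective F hF
    _ = Nat.card N * Nat.card Y := by rw [Nat.card_prod, mul_comm]
    _ ≤ p ^ j * (p ^ (k - (j + 1))) ^ 3 := by
      apply Nat.mul_le_mul (card_ker_pow_mul_le hp (by omega))
      rw [Nat.card_pi]
      calc ∏ l : {l : Fin 4 // l ≠ i}, Nat.card {x : ZMod (p ^ k) // π x = v₀ l}
          ≤ ∏ _l : {l : Fin 4 // l ≠ i}, p ^ (k - (j + 1)) :=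
            Finset.prod_le_prod' fun l _ => card_fiber_castHom_le hp hj _
        _ = (p ^ (k - (j + 1))) ^ 3 := by
          rw [Finset.prod_const, Finset.card_univ]
          simp [Fintype.card_subtype_compl]

/-- Solutions of `cubicDisc v = m` modulo `p ^ k` are bounded by the number of their reductions
modulo `p ^ (j + 1)`, provided that the gradient does not vanish there. -/
theorem card_cubicDisc_le {p k j : ℕ} (hp : p.Prime) (hj : j + 1 ≤ k) (m : ZMod (p ^ k))
    (S : Finset (Fin 4 → ZMod (p ^ (j + 1)))) (hgrad : ∀ v ∈ S, cubicGrad v ≠ 0)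
    (hS : ∀ v : Fin 4 → ZMod (p ^ k), cubicDisc v = m →
      (fun i => ZMod.castHom (pow_dvd_pow p hj) (ZMod (p ^ (j + 1))) (v i)) ∈ S) :
    Nat.card {v : Fin 4 → ZMod (p ^ k) // cubicDisc v = m}
      ≤ S.card * (p ^ j * (p ^ (k - (j + 1))) ^ 3) := by
  classical
  have : NeZero (p ^ k) := ⟨pow_ne_zero _ hp.ne_zero⟩
  rw [Nat.card_eq_fintype_card, Fintype.card_subtype]
  rw [mul_comm]
  refine Finset.card_le_mul_card_image_of_maps_to
    (f := fun v i => ZMod.castHom (pow_dvd_pow p hj) (ZMod (p ^ (j + 1))) (v i)) ?_ _ ?_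
  · intro v hv
    exact hS v (Finset.mem_filter.1 hv).2
  · intro v₀ hv₀
    have := card_cubicDisc_fiber_le hp hj m v₀ (hgrad _ hv₀)
    rw [Nat.card_eq_fintype_card, Fintype.card_subtype] at this
    rwa [Finset.filter_filter]

section FieldCount

variable {F : Type*} [Field F] [Fintype F] [DecidableEq F]

open Classical in
theorem card_cubicDisc_eq_leading_ne_zero (h2 : (2 : F) ≠ 0) (m : F) (T : Finset F)
    (hT : ∀ x : F, x ≠ 0 ∨ m ≠ 0 → x ∈ T) :
    (Finset.univ.filter fun v : Fin 4 → F => (cubicDisc v = m ∧ ¬ HessianZero v) ∧ v 0 ≠ 0).card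
      ≤ Fintype.card F * ((Fintype.card F - 1) * T.card) := by
  have hU : (Finset.univ.erase (0 : F)).card = Fintype.card F - 1 := by
    rw [Finset.card_erase_of_mem (Finset.mem_univ _), Finset.card_univ]
  rw [← hU, ← Finset.card_univ, ← Finset.card_product, ← Finset.card_product]
  have h4 : (4 : F) ≠ 0 := by
    have : (4 : F) = 2 ^ 2 := by norm_num
    rw [this]; exact pow_ne_zero 2 h2
  let A : (Fin 4 → F) → F := fun v => v 1 ^ 2 - v 0 * v 2
  let G : (Fin 4 → F) → F := fun v => v 0 ^ 2 * v 3 - 3 * v 0 * v 1 * v 2 + 2 * v 1 ^ 3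
  have hGA : ∀ v, cubicDisc v = m → G v ^ 2 - v 0 ^ 2 * m = 4 * A v ^ 3 := by
    rintro v rfl
    simp only [G, A, cubicDisc]; ring
  let φ : (Fin 4 → F) → F × F × F := fun v =>
    (v 1, if A v = 0 then (v 0, G v) else (v 0 / A v, G v / A v))
  have hφ : ∀ v, cubicDisc v = m → 4 * A v = (φ v).2.2 ^ 2 - (φ v).2.1 ^ 2 * m := by
    intro v hv
    have := hGA v hv
    by_cases hA : A v = 0
    · simp only [φ, if_pos hA]
      rw [this, hA]; ring
    · simp only [φ, if_neg hA]
      field_simp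
      linear_combination -this
  have hG : ∀ v, cubicDisc v = m → ¬ HessianZero v → v 0 ≠ 0 → m = 0 → A v ≠ 0 ∧ G v ≠ 0 := by
    intro v hv hH ha hm
    have h1 := hGA v hv
    rw [hm, mul_zero, sub_zero] at h1
    have hA : A v ≠ 0 := by
      intro hA
      have hG0 : G v = 0 := by
        rw [hA] at h1
        exact pow_eq_zero_iff two_ne_zero |>.1 (by rw [h1]; ring)
      apply hH
      have hB : v 1 * v 2 - v 0 * v 3 = 0 := by
        apply mul_left_cancel₀ ha
        simp only [A] at hA
        simp only [G] at hG0
        linear_combination 2 * v 1 * hA - hG0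
      refine ⟨hA, hB, ?_⟩
      apply mul_left_cancel₀ (pow_ne_zero 2 ha)
      simp only [A] at hA
      linear_combination (v 1 ^ 2 - v 0 * v 2) * hA - v 1 ^ 2 * hA + v 0 * v 1 * hB
    refine ⟨hA, fun hG0 => ?_⟩
    rw [hG0] at h1
    have : (4 : F) * A v ^ 3 ≠ 0 := mul_ne_zero h4 (pow_ne_zero 3 hA)
    exact this (by rw [← h1]; ring)
  refine Finset.card_le_card_of_injOn φ ?_ ?_
  · intro v hv
    simp only [Finset.coe_filter, Finset.mem_univ, true_and, Set.mem_ofPred_eq] at hv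
    obtain ⟨⟨hv, hH⟩, ha⟩ := hv
    simp only [Finset.coe_product, Set.mem_prod, Finset.mem_coe, Finset.mem_univ, true_and,
      Finset.mem_erase, and_true]
    by_cases hA : A v = 0
    · simp only [φ, if_pos hA]
      refine ⟨ha, hT _ ?_⟩
      by_contra hcon
      push Not at hcon
      exact (hG v hv hH ha hcon.2).1 hA
    · simp only [φ, if_neg hA]
      refine ⟨div_ne_zero ha hA, hT _ ?_⟩
      by_cases hm : m = 0
      · exact Or.inl (div_ne_zero (hG v hv hH ha hm).2 hA)
      · exact Or.inr hm
  · intro v hv w hw hvw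
    simp only [Finset.coe_filter, Finset.mem_univ, true_and, Set.mem_ofPred_eq] at hv hw
    obtain ⟨⟨hv, -⟩, ha⟩ := hv
    obtain ⟨⟨hw, -⟩, -⟩ := hw
    have hA : A v = A w := by
      apply mul_left_cancel₀ h4
      rw [hφ v hv, hφ w hw, hvw]
    have h1 : v 1 = w 1 := congrArg Prod.fst hvw
    have h2' : (φ v).2 = (φ w).2 := congrArg Prod.snd hvw
    have h3 : v 0 = w 0 ∧ G v = G w := by
      by_cases hA0 : A w = 0
      · simp only [φ, hA, if_pos hA0, Prod.mk.injEq] at h2'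
        exact h2'
      · simp only [φ, hA, if_neg hA0, Prod.mk.injEq] at h2'
        exact ⟨(div_left_inj' hA0).1 h2'.1, (div_left_inj' hA0).1 h2'.2⟩
    obtain ⟨h0, hG'⟩ := h3
    have hc : v 2 = w 2 := by
      apply mul_left_cancel₀ ha
      simp only [A] at hA
      rw [← h1, ← h0] at hA
      linear_combination -hA
    have hd : v 3 = w 3 := by
      apply mul_left_cancel₀ (pow_ne_zero 2 ha)
      simp only [G] at hG'
      rw [← h1, ← h0, ← hc] at hG'
      linear_combination hG'
    funext i
    fin_cases i
    · exact h0
    · exact h1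
    · exact hc
    · exact hd

open Classical in
theorem card_cubicDisc_eq_leading_eq_zero (h2 : (2 : F) ≠ 0) (m : F) :
    (Finset.univ.filter fun v : Fin 4 → F =>
        ((cubicDisc v = m ∧ ¬ HessianZero v) ∧ v 0 = 0) ∧ v 1 ≠ 0).card
      ≤ (Fintype.card F - 1) * Fintype.card F := by
  have hU : (Finset.univ.erase (0 : F)).card = Fintype.card F - 1 := by
    rw [Finset.card_erase_of_mem (Finset.mem_univ _), Finset.card_univ]
  rw [← hU, ← Finset.card_univ, ← Finset.card_product]
  refine Finset.card_le_card_of_injOn (fun v => (v 1, v 2)) ?_ ?_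
  · intro v hv
    simp only [Finset.coe_filter, Finset.mem_univ, true_and, Set.mem_ofPred_eq] at hv
    simpa using hv.2
  · intro v hv w hw hvw
    simp only [Finset.coe_filter, Finset.mem_univ, true_and, Set.mem_ofPred_eq] at hv hw
    obtain ⟨⟨⟨hv, -⟩, ha⟩, hb⟩ := hv
    obtain ⟨⟨⟨hw, -⟩, ha'⟩, -⟩ := hw
    have h1 : v 1 = w 1 := congrArg Prod.fst hvw
    have hc : v 2 = w 2 := congrArg Prod.snd hvw
    have hd : v 3 = w 3 := by
      have h4 : (2 : F) ^ 2 * v 1 ^ 3 ≠ 0 := mul_ne_zero (pow_ne_zero 2 h2) (pow_ne_zero 3 hb)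
      apply mul_left_cancel₀ h4
      rw [← hw] at hv
      simp only [cubicDisc, ha, ha', ← h1, ← hc] at hv
      linear_combination hv
    funext i
    fin_cases i
    · exact ha.trans ha'.symm
    · exact h1
    · exact hc
    · exact hd

open Classical in
theorem card_cubicDisc_eq_leading_pair_eq_zero (m : F) :
    (Finset.univ.filter fun v : Fin 4 → F =>
        ((cubicDisc v = m ∧ ¬ HessianZero v) ∧ v 0 = 0) ∧ ¬ v 1 ≠ 0).card
      ≤ (if m = 0 then (Fintype.card F - 1) * Fintype.card F else 0) := by
  have hU : (Finset.univ.erase (0 : F)).card = Fintype.card F - 1 := by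
    rw [Finset.card_erase_of_mem (Finset.mem_univ _), Finset.card_univ]
  split_ifs with hm
  · rw [← hU, ← Finset.card_univ, ← Finset.card_product]
    refine Finset.card_le_card_of_injOn (fun v => (v 2, v 3)) ?_ ?_
    · intro v hv
      simp only [Finset.coe_filter, Finset.mem_univ, true_and, Set.mem_ofPred_eq, not_not] at hv
      obtain ⟨⟨⟨hv, hH⟩, ha⟩, hb⟩ := hv
      simp only [Finset.coe_product, Set.mem_prod, Finset.mem_coe, Finset.mem_univ,
        Finset.mem_erase, and_true]
      intro hc
      apply hH
      simp [HessianZero, ha, hb, hc]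
    · intro v hv w hw hvw
      simp only [Finset.coe_filter, Finset.mem_univ, true_and, Set.mem_ofPred_eq, not_not] at hv hw
      funext i
      fin_cases i
      · exact hv.1.2.trans hw.1.2.symm
      · exact hv.2.trans hw.2.symm
      · exact congrArg Prod.fst hvw
      · exact congrArg Prod.snd hvw
  · rw [Nat.le_zero, Finset.card_eq_zero, Finset.filter_eq_empty_iff]
    rintro v - ⟨⟨⟨hv, -⟩, ha⟩, hb⟩
    rw [not_not] at hb
    apply hm
    rw [← hv]
    simp [cubicDisc, ha, hb]

open Classical in
/-- Over a finite field of odd characteristic with `q` elements, at most `q³ - q` binary cubic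
forms with nonzero Hessian have a given Hessian discriminant. -/
theorem card_cubicDisc_eq_field_le (h2 : (2 : F) ≠ 0) (m : F) :
    (Finset.univ.filter fun v : Fin 4 → F => cubicDisc v = m ∧ ¬ HessianZero v).card
      + Fintype.card F ≤ Fintype.card F ^ 3 := by
  obtain ⟨q, hq⟩ : ∃ q, Fintype.card F = q + 1 :=
    ⟨Fintype.card F - 1, (Nat.sub_add_cancel Fintype.card_pos).symm⟩
  have e1 := Finset.card_filter_add_card_filter_not (s := Finset.univ.filter
    fun v : Fin 4 → F => cubicDisc v = m ∧ ¬ HessianZero v) (fun v => v 0 ≠ 0)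
  have e2 := Finset.card_filter_add_card_filter_not (s := Finset.univ.filter
    fun v : Fin 4 → F => (cubicDisc v = m ∧ ¬ HessianZero v) ∧ v 0 = 0) (fun v => v 1 ≠ 0)
  simp only [Finset.filter_filter, not_not] at e1 e2
  have h0 := card_cubicDisc_eq_leading_eq_zero h2 m
  have h1 := card_cubicDisc_eq_leading_pair_eq_zero m
  simp only [not_not] at h1
  have hU : (Finset.univ.erase (0 : F)).card = Fintype.card F - 1 := by
    rw [Finset.card_erase_of_mem (Finset.mem_univ _), Finset.card_univ]
  by_cases hm : m = 0
  · have h3 := card_cubicDisc_eq_leading_ne_zero h2 m (Finset.univ.erase 0)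
      (by intro x hx; simpa using hx.resolve_right (not_not.2 hm))
    rw [if_pos hm] at h1
    rw [hU] at h3
    rw [hq, Nat.add_sub_cancel] at h0 h1 h3
    rw [hq]
    nlinarith
  · have h3 := card_cubicDisc_eq_leading_ne_zero h2 m Finset.univ (by simp)
    rw [if_neg hm] at h1
    rw [Finset.card_univ] at h3
    rw [hq, Nat.add_sub_cancel] at h0 h3
    rw [hq]
    nlinarith

end FieldCount

/-- Number of solutions of `cubicDisc v = m` modulo a power of an odd prime. -/
theorem card_cubicDisc_eq_odd_le {p k : ℕ} (hp : p.Prime) (hp2 : p ≠ 2) (hk : 2 ≤ k)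
    (m : ZMod (p ^ k)) (hm : ¬ p ^ 2 ∣ m.val) :
    (Nat.card {v : Fin 4 → ZMod (p ^ k) // cubicDisc v = m} : ℝ)
      ≤ (1 - ((p : ℝ) ^ 2)⁻¹) * ((p ^ k : ℕ) : ℝ) ^ 3 := by
  classical
  have hj : 0 + 1 ≤ k := by omega
  have : NeZero (p ^ k) := ⟨pow_ne_zero _ hp.ne_zero⟩
  have : Fact (p ^ (0 + 1)).Prime := ⟨by simpa using hp⟩
  set π := ZMod.castHom (pow_dvd_pow p hj) (ZMod (p ^ (0 + 1))) with hπ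
  have h2 : (2 : ZMod (p ^ (0 + 1))) ≠ 0 := by
    intro h
    have : ((2 : ℕ) : ZMod (p ^ (0 + 1))) = 0 := by exact_mod_cast h
    rw [ZMod.natCast_eq_zero_iff, zero_add, pow_one] at this
    exact hp2 ((Nat.prime_dvd_prime_iff_eq hp Nat.prime_two).1 this)
  have hπ0 : ∀ x : ZMod (p ^ k), π x = 0 → ∃ y, x = p * y := by
    intro x hx
    rw [hπ, ZMod.castHom_apply, ZMod.cast_eq_val, ZMod.natCast_eq_zero_iff, zero_add, pow_one] at hx
    obtain ⟨y, hy⟩ := hx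
    exact ⟨y, by rw [← ZMod.natCast_zmod_val x, hy]; push_cast; rfl⟩
  have h1 := card_cubicDisc_le hp hj m
    (Finset.univ.filter fun v => cubicDisc v = π m ∧ ¬ HessianZero v) (by
      intro v hv h
      exact (Finset.mem_filter.1 hv).2.2 (hessianZero_of_cubicGrad_eq_zero h2 v h)) (by
      intro v hv
      rw [Finset.mem_filter]
      refine ⟨Finset.mem_univ _, ?_, ?_⟩
      · rw [← hv, map_cubicDisc]
      · rintro ⟨hA, hB, hC⟩
        simp only [← hπ, ← map_pow, ← map_mul, ← map_sub] at hA hB hC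
        obtain ⟨A, hA⟩ := hπ0 _ hA
        obtain ⟨B, hB⟩ := hπ0 _ hB
        obtain ⟨C, hC⟩ := hπ0 _ hC
        apply hm
        have h3 : m = (p : ZMod (p ^ k)) ^ 2 * (B ^ 2 - 4 * A * C) := by
          rw [← hv, cubicDisc, hA, hB, hC]; ring
        have h4 : ZMod.castHom (pow_dvd_pow p hk) (ZMod (p ^ 2)) m = 0 := by
          rw [h3, map_mul, map_pow, map_natCast]
          have : (p : ZMod (p ^ 2)) ^ 2 = ((p ^ 2 : ℕ) : ZMod (p ^ 2)) := by push_cast; rfl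
          rw [this, ZMod.natCast_self, zero_mul]
        rwa [ZMod.castHom_apply, ZMod.cast_eq_val, ZMod.natCast_eq_zero_iff] at h4)
  have h3 := card_cubicDisc_eq_field_le h2 (π m)
  set N := (Finset.univ.filter fun v : Fin 4 → ZMod (p ^ (0 + 1)) =>
    cubicDisc v = π m ∧ ¬ HessianZero v).card with hN
  clear_value N
  rw [ZMod.card, zero_add, pow_one] at h3
  have h4 : (Nat.card {v : Fin 4 → ZMod (p ^ k) // cubicDisc v = m} : ℝ)
      ≤ N * ((p : ℝ) ^ (k - 1)) ^ 3 := by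
    have : (Nat.card {v : Fin 4 → ZMod (p ^ k) // cubicDisc v = m} : ℝ)
      ≤ ((N * (p ^ 0 * (p ^ (k - (0 + 1))) ^ 3) : ℕ) : ℝ) := by exact_mod_cast h1
    push_cast at this
    simpa using this
  have h5 : (N : ℝ) + p ≤ (p : ℝ) ^ 3 := by exact_mod_cast h3
  have hp0 : (0 : ℝ) < p := by exact_mod_cast hp.pos
  have h6 : (p : ℝ) ^ k = p * p ^ (k - 1) := by
    rw [← pow_succ', Nat.sub_add_cancel (by omega)]
  calc (Nat.card {v : Fin 4 → ZMod (p ^ k) // cubicDisc v = m} : ℝ)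
      ≤ N * ((p : ℝ) ^ (k - 1)) ^ 3 := h4
    _ ≤ ((p : ℝ) ^ 3 - p) * ((p : ℝ) ^ (k - 1)) ^ 3 := by gcongr; linarith
    _ = (1 - ((p : ℝ) ^ 2)⁻¹) * ((p ^ k : ℕ) : ℝ) ^ 3 := by
      push_cast; rw [h6]; field_simp

theorem card_cubicDisc_eq_mod_two_pow_le {k j e N : ℕ} (hj : j + 1 ≤ k) (he : e ≤ k) (r : ℤ)
    (hcount : ((Finset.range (2 ^ (j + 1)) ×ˢ Finset.range (2 ^ (j + 1)) ×ˢ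
      Finset.range (2 ^ (j + 1)) ×ˢ Finset.range (2 ^ (j + 1))).filter fun v =>
        cubicDisc ![(v.1 : ℤ), v.2.1, v.2.2.1, v.2.2.2] % 2 ^ e = r).card ≤ N)
    (hgrad : ∀ a b c d : Fin (2 ^ (j + 1)),
        cubicDisc ![((a : ℕ) : ℤ), (b : ℕ), (c : ℕ), (d : ℕ)] % 2 ^ e = r →
          ∃ i, cubicGrad ![((a : ℕ) : ℤ), (b : ℕ), (c : ℕ), (d : ℕ)] i % 2 ^ (j + 1) ≠ 0)
    (hstab : ∀ v w : Fin 4 → ℤ, (∀ i, (2 : ℤ) ^ (j + 1) ∣ v i - w i) → cubicDisc v % 2 ^ e = r →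
      cubicDisc w % 2 ^ e = r)
    (m : ZMod (2 ^ k)) (hm : (m.val : ℤ) % 2 ^ e = r) :
    Nat.card {v : Fin 4 → ZMod (2 ^ k) // cubicDisc v = m}
      ≤ N * (2 ^ j * (2 ^ (k - (j + 1))) ^ 3) := by
  classical
  let lift : (Fin 4 → ZMod (2 ^ (j + 1))) → Fin 4 → ℤ := fun v i => ((v i).val : ℤ)
  have hlift : ∀ v, lift v = ![((v 0).val : ℤ), (v 1).val, (v 2).val, (v 3).val] := by
    intro v; funext i; fin_cases i <;> rfl
  have hcast : ∀ v i, ((lift v i : ℤ) : ZMod (2 ^ (j + 1))) = v i := by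
    intro v i; simp [lift]
  let S : Finset (Fin 4 → ZMod (2 ^ (j + 1))) :=
    Finset.univ.filter fun v => cubicDisc (lift v) % 2 ^ e = r
  have hS : S.card ≤ N := by
    refine le_trans (Finset.card_le_card_of_injOn
      (fun v => ((v 0).val, (v 1).val, (v 2).val, (v 3).val)) ?_ ?_) hcount
    · intro v hv
      have hv' := (Finset.mem_filter.1 hv).2
      rw [hlift] at hv'
      simp only [Finset.coe_filter, Set.mem_ofPred_eq, Finset.mem_product, Finset.mem_range]
      exact ⟨⟨ZMod.val_lt _, ZMod.val_lt _, ZMod.val_lt _, ZMod.val_lt _⟩, hv'⟩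
    · intro v _ w _ hvw
      simp only [Prod.mk.injEq] at hvw
      funext i
      apply ZMod.val_injective
      fin_cases i
      · exact hvw.1
      · exact hvw.2.1
      · exact hvw.2.2.1
      · exact hvw.2.2.2
  refine le_trans (card_cubicDisc_le Nat.prime_two hj m S ?_ ?_) (Nat.mul_le_mul_right _ hS)
  · intro v hv h0
    have hv' := (Finset.mem_filter.1 hv).2
    rw [hlift] at hv'
    obtain ⟨i, hi⟩ := hgrad ⟨(v 0).val, ZMod.val_lt _⟩ ⟨(v 1).val, ZMod.val_lt _⟩
      ⟨(v 2).val, ZMod.val_lt _⟩ ⟨(v 3).val, ZMod.val_lt _⟩ hv'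
    simp only [← hlift] at hi
    apply hi
    apply Int.emod_eq_zero_of_dvd
    have h1 := map_cubicGrad (Int.castRingHom (ZMod (2 ^ (j + 1)))) (lift v) i
    simp only [eq_intCast, hcast] at h1
    rw [h0, Pi.zero_apply, ZMod.intCast_zmod_eq_zero_iff_dvd] at h1
    exact_mod_cast h1
  · intro v hv
    refine Finset.mem_filter.2 ⟨Finset.mem_univ _, ?_⟩
    apply hstab (fun i => ((v i).val : ℤ))
    · intro i
      simp only [lift]
      rw [ZMod.castHom_apply, ZMod.cast_eq_val, ZMod.val_natCast]
      rw [Int.natCast_mod]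
      have := Int.emod_add_mul_ediv ((v i).val : ℤ) ((2 ^ (j + 1) : ℕ) : ℤ)
      exact ⟨((v i).val : ℤ) / ((2 ^ (j + 1) : ℕ) : ℤ), by push_cast at this ⊢; linarith⟩
    · rw [← hm]
      have h1 := map_cubicDisc (Int.castRingHom (ZMod (2 ^ k))) (fun i => ((v i).val : ℤ))
      simp only [eq_intCast, Int.cast_natCast, ZMod.natCast_zmod_val] at h1
      rw [hv] at h1
      have h2 : ((cubicDisc (fun i => ((v i).val : ℤ)) - m.val : ℤ) : ZMod (2 ^ k)) = 0 := by
        push_cast; rw [h1]; simp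
      rw [ZMod.intCast_zmod_eq_zero_iff_dvd] at h2
      apply Int.ModEq.symm
      rw [Int.modEq_iff_dvd]
      refine dvd_trans ?_ h2
      push_cast
      exact pow_dvd_pow 2 he

/-- The residue of `cubicDisc` modulo `32`, computed with natural numbers. -/
def cubicDiscMod (a b c d : ℕ) : ℕ :=
  ((b * c + 31 * (a * d)) * (b * c + 31 * (a * d)) +
    28 * ((b * b + 31 * (a * c)) * (c * c + 31 * (b * d)))) % 32

theorem cubicDisc_emod_eq (a b c d : ℕ) :
    cubicDisc ![(a : ℤ), (b : ℤ), (c : ℤ), (d : ℤ)] % 2 ^ 5 = (cubicDiscMod a b c d : ℤ) := by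
  rw [cubicDiscMod]
  push_cast
  change _ ≡ _ [ZMOD 32]
  rw [Int.modEq_iff_dvd]
  exact ⟨2 * (a * d) * (b * c - a * d) + 32 * (a * d) ^ 2 + (b ^ 2 - a * c) * (c ^ 2 - b * d) +
    28 * (a * c * (c ^ 2 - b * d) + (b ^ 2 - a * c) * (b * d) + 32 * (a * c * (b * d))), by
    simp only [cubicDisc, Matrix.cons_val]
    ring⟩

/-- Whether some partial derivative of `cubicDisc` is nonzero modulo `8`, as a Boolean. -/
def cubicGradTest (a b c d : ℕ) : Bool :=
  !(((2 * (a * d * d + 5 * (b * c * d) + 2 * (c * c * c))) % 8).beq 0 &&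
    ((6 * (2 * (b * b * d) + 7 * (b * c * c) + 7 * (a * c * d))) % 8).beq 0 &&
    ((6 * (2 * (a * c * c) + 7 * (b * b * c) + 7 * (a * b * d))) % 8).beq 0 &&
    ((2 * (a * a * d + 5 * (a * b * c) + 2 * (b * b * b))) % 8).beq 0)

theorem exists_cubicGrad_of_test {a b c d : ℕ} (h : cubicGradTest a b c d = true) :
    ∃ i, cubicGrad ![(a : ℤ), (b : ℤ), (c : ℤ), (d : ℤ)] i % 2 ^ (2 + 1) ≠ 0 := by
  by_contra! hn
  have h0 := hn 0
  have h1 := hn 1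
  have h2 := hn 2
  have h3 := hn 3
  simp only [cubicGrad, Matrix.cons_val] at h0 h1 h2 h3
  have key : ∀ n : ℕ, ∀ y : ℤ, y % 2 ^ (2 + 1) = 0 → (8 : ℤ) ∣ n - y → n % 8 = 0 := by
    intro n y h1 h2
    omega
  have k0 := key (2 * (a * d * d + 5 * (b * c * d) + 2 * (c * c * c))) _ h0
    ⟨2 * (b * c * d), by push_cast; ring⟩
  have k1 := key (6 * (2 * (b * b * d) + 7 * (b * c * c) + 7 * (a * c * d))) _ h1
    ⟨6 * (b * c * c) + 6 * (a * c * d), by push_cast; ring⟩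
  have k2 := key (6 * (2 * (a * c * c) + 7 * (b * b * c) + 7 * (a * b * d))) _ h2
    ⟨6 * (b * b * c) + 6 * (a * b * d), by push_cast; ring⟩
  have k3 := key (2 * (a * a * d + 5 * (a * b * c) + 2 * (b * b * b))) _ h3
    ⟨2 * (a * b * c), by push_cast; ring⟩
  rw [cubicGradTest, k0, k1, k2, k3] at h
  exact absurd h (by decide)

theorem cubicGradTest_of_cubicDiscMod : ∀ a < 8, ∀ b < 8, ∀ c < 8, ∀ d < 8,
    ((cubicDiscMod a b c d % 16).beq 8 || (cubicDiscMod a b c d % 16).beq 12) = true →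
      cubicGradTest a b c d = true := by
  decide +kernel

theorem sum_cubicDiscMod_le : ∀ r ∈ [8, 12, 24, 28], ∑ a ∈ Finset.range 8, ∑ b ∈ Finset.range 8,
    ∑ c ∈ Finset.range 8, ∑ d ∈ Finset.range 8, ((cubicDiscMod a b c d).beq r).toNat ≤ 192 := by
  decide +kernel

theorem exists_cubicGrad_mod_eight {r : ℕ} (hr : r % 16 = 8 ∨ r % 16 = 12)
    (a b c d : Fin (2 ^ (2 + 1)))
    (h : cubicDisc ![((a : ℕ) : ℤ), (b : ℕ), (c : ℕ), (d : ℕ)] % 2 ^ 5 = r) :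
    ∃ i, cubicGrad ![((a : ℕ) : ℤ), (b : ℕ), (c : ℕ), (d : ℕ)] i % 2 ^ (2 + 1) ≠ 0 := by
  rw [cubicDisc_emod_eq, Nat.cast_inj] at h
  refine exists_cubicGrad_of_test (cubicGradTest_of_cubicDiscMod a a.2 b b.2 c c.2 d d.2 ?_)
  rcases hr with hr | hr <;> rw [h, hr] <;> rfl

theorem card_filter_cubicDisc_emod_le {r : ℕ} (hr : r ∈ [8, 12, 24, 28]) :
    ((Finset.range (2 ^ (2 + 1)) ×ˢ Finset.range (2 ^ (2 + 1)) ×ˢ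
      Finset.range (2 ^ (2 + 1)) ×ˢ Finset.range (2 ^ (2 + 1))).filter fun v =>
        cubicDisc ![(v.1 : ℤ), v.2.1, v.2.2.1, v.2.2.2] % 2 ^ 5 = r).card ≤ 192 := by
  refine le_trans (le_of_eq ?_) (sum_cubicDiscMod_le r hr)
  rw [Finset.card_filter, Finset.sum_product]
  simp only [Finset.sum_product, cubicDisc_emod_eq, Nat.cast_inj]
  norm_num only
  refine Finset.sum_congr rfl fun a _ => Finset.sum_congr rfl fun b _ =>
    Finset.sum_congr rfl fun c _ => Finset.sum_congr rfl fun d _ => ?_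
  split_ifs with h
  · rw [h, Nat.beq_refl]; rfl
  · rw [Bool.eq_false_iff.2 (mt Nat.eq_of_beq_eq_true h)]; rfl

/-- Number of solutions of `cubicDisc v = m` modulo a power of two. -/
theorem card_cubicDisc_eq_two_le {k : ℕ} (hk : 5 ≤ k) (m : ZMod (2 ^ k))
    (hm : m.val % 4 = 1 ∨ m.val % 16 = 8 ∨ m.val % 16 = 12) :
    (Nat.card {v : Fin 4 → ZMod (2 ^ k) // cubicDisc v = m} : ℝ)
      ≤ 2 * (1 - ((2 : ℝ) ^ 2)⁻¹) * ((2 ^ k : ℕ) : ℝ) ^ 3 := by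
  have key : Nat.card {v : Fin 4 → ZMod (2 ^ k) // cubicDisc v = m} ≤
        48 * (2 ^ 1 * (2 ^ (k - 2)) ^ 3)
      ∨ Nat.card {v : Fin 4 → ZMod (2 ^ k) // cubicDisc v = m} ≤
        192 * (2 ^ 2 * (2 ^ (k - 3)) ^ 3) := by
    by_cases hm4 : m.val % 4 = 1
    · left
      have hstab : ∀ r, ∀ v w : Fin 4 → ℤ, (∀ i, (2 : ℤ) ^ (1 + 1) ∣ v i - w i) →
          cubicDisc v % 2 ^ 3 = r → cubicDisc w % 2 ^ 3 = r := by
        intro r v w h hv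
        choose t ht using h
        rw [← hv]
        obtain ⟨X, hX⟩ : ∃ X, cubicDisc v - cubicDisc w = 2 ^ 3 * X := by
          have e : ∀ i, v i = w i + 4 * t i := fun i => by linear_combination ht i
          have hB : ∃ β, v 1 * v 2 - v 0 * v 3 = w 1 * w 2 - w 0 * w 3 + 4 * β :=
            ⟨t 1 * w 2 + w 1 * t 2 + 4 * t 1 * t 2 - t 0 * w 3 - w 0 * t 3 - 4 * t 0 * t 3, by
              rw [e, e, e, e]; ring⟩
          have hA : ∃ α, v 1 ^ 2 - v 0 * v 2 = w 1 ^ 2 - w 0 * w 2 + 4 * α :=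
            ⟨2 * t 1 * w 1 + 4 * t 1 ^ 2 - t 0 * w 2 - w 0 * t 2 - 4 * t 0 * t 2, by
              rw [e, e, e]; ring⟩
          have hC : ∃ γ, v 2 ^ 2 - v 1 * v 3 = w 2 ^ 2 - w 1 * w 3 + 4 * γ :=
            ⟨2 * t 2 * w 2 + 4 * t 2 ^ 2 - t 1 * w 3 - w 1 * t 3 - 4 * t 1 * t 3, by
              rw [e, e, e]; ring⟩
          obtain ⟨β, hB⟩ := hB
          obtain ⟨α, hA⟩ := hA
          obtain ⟨γ, hC⟩ := hC
          unfold cubicDisc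
          rw [hB, hA, hC]
          exact ⟨(w 1 * w 2 - w 0 * w 3) * β + 2 * β ^ 2 - 2 * (w 1 ^ 2 - w 0 * w 2) * γ
            - 2 * α * (w 2 ^ 2 - w 1 * w 3) - 8 * α * γ, by ring⟩
        omega
      have hm8 : (m.val : ℤ) % 2 ^ 3 = 1 ∨ (m.val : ℤ) % 2 ^ 3 = 5 := by omega
      rcases hm8 with h | h
      · exact card_cubicDisc_eq_mod_two_pow_le (j := 1) (e := 3) (by omega) (by omega) 1
          (by decide +kernel) (by decide +kernel) (hstab 1) m h
      · exact card_cubicDisc_eq_mod_two_pow_le (j := 1) (e := 3) (by omega) (by omega) 5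
          (by decide +kernel) (by decide +kernel) (hstab 5) m h
    · right
      have hstab : ∀ r, r % 4 = 0 → ∀ v w : Fin 4 → ℤ, (∀ i, (2 : ℤ) ^ (2 + 1) ∣ v i - w i) →
          cubicDisc v % 2 ^ 5 = r → cubicDisc w % 2 ^ 5 = r := by
        intro r hr v w h hv
        choose t ht using h
        rw [← hv]
        obtain ⟨δ, hδ⟩ : (2 : ℤ) ∣ v 1 * v 2 - v 0 * v 3 := by
          apply Int.prime_two.dvd_of_dvd_pow (n := 2)
          have h1 : (v 1 * v 2 - v 0 * v 3) ^ 2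
              = cubicDisc v + 4 * ((v 1 ^ 2 - v 0 * v 2) * (v 2 ^ 2 - v 1 * v 3)) := by
            unfold cubicDisc; ring
          omega
        obtain ⟨X, hX⟩ : ∃ X, cubicDisc v - cubicDisc w = 2 ^ 5 * X := by
          have e : ∀ i, w i = v i - 8 * t i := fun i => by linear_combination -ht i
          have hB : ∃ β, w 1 * w 2 - w 0 * w 3 = 2 * δ + 8 * β :=
            ⟨-t 1 * v 2 - v 1 * t 2 + 8 * t 1 * t 2 + t 0 * v 3 + v 0 * t 3 - 8 * t 0 * t 3, by
              rw [← hδ, e, e, e, e]; ring⟩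
          have hA : ∃ α, w 1 ^ 2 - w 0 * w 2 = v 1 ^ 2 - v 0 * v 2 + 8 * α :=
            ⟨-2 * t 1 * v 1 + 8 * t 1 ^ 2 + t 0 * v 2 + v 0 * t 2 - 8 * t 0 * t 2, by
              rw [e, e, e]; ring⟩
          have hC : ∃ γ, w 2 ^ 2 - w 1 * w 3 = v 2 ^ 2 - v 1 * v 3 + 8 * γ :=
            ⟨-2 * t 2 * v 2 + 8 * t 2 ^ 2 + t 1 * v 3 + v 1 * t 3 - 8 * t 1 * t 3, by
              rw [e, e, e]; ring⟩
          obtain ⟨β, hB⟩ := hB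
          obtain ⟨α, hA⟩ := hA
          obtain ⟨γ, hC⟩ := hC
          unfold cubicDisc
          rw [hB, hA, hC, hδ]
          exact ⟨-(δ * β + 2 * β ^ 2 - (v 1 ^ 2 - v 0 * v 2) * γ
            - α * (v 2 ^ 2 - v 1 * v 3) - 8 * α * γ), by ring⟩
        omega
      have hm32 : (m.val : ℤ) % 2 ^ 5 = 8 ∨ (m.val : ℤ) % 2 ^ 5 = 12 ∨ (m.val : ℤ) % 2 ^ 5 = 24 ∨
        (m.val : ℤ) % 2 ^ 5 = 28 := by omega
      rcases hm32 with h | h | h | h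
      · exact card_cubicDisc_eq_mod_two_pow_le (j := 2) (e := 5) (by omega) hk 8
          (card_filter_cubicDisc_emod_le (by simp)) (exists_cubicGrad_mod_eight (by norm_num))
          (hstab 8 (by norm_num)) m h
      · exact card_cubicDisc_eq_mod_two_pow_le (j := 2) (e := 5) (by omega) hk 12
          (card_filter_cubicDisc_emod_le (by simp)) (exists_cubicGrad_mod_eight (by norm_num))
          (hstab 12 (by norm_num)) m h
      · exact card_cubicDisc_eq_mod_two_pow_le (j := 2) (e := 5) (by omega) hk 24
          (card_filter_cubicDisc_emod_le (by simp)) (exists_cubicGrad_mod_eight (by norm_num))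
          (hstab 24 (by norm_num)) m h
      · exact card_cubicDisc_eq_mod_two_pow_le (j := 2) (e := 5) (by omega) hk 28
          (card_filter_cubicDisc_emod_le (by simp)) (exists_cubicGrad_mod_eight (by norm_num))
          (hstab 28 (by norm_num)) m h
  obtain ⟨l, rfl⟩ : ∃ l, k = l + 3 := ⟨k - 3, by omega⟩
  have e1 : l + 3 - 2 = l + 1 := by omega
  have e2 : l + 3 - 3 = l := by omega
  rw [e1, e2] at key
  have h8 : Nat.card {v : Fin 4 → ZMod (2 ^ (l + 3)) // cubicDisc v = m} ≤ 768 * (2 ^ l) ^ 3 := by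
    rcases key with h | h
    · refine h.trans (le_of_eq ?_); ring
    · refine h.trans (le_of_eq ?_); ring
  calc (Nat.card {v : Fin 4 → ZMod (2 ^ (l + 3)) // cubicDisc v = m} : ℝ)
      ≤ ((768 * (2 ^ l) ^ 3 : ℕ) : ℝ) := by exact_mod_cast h8
    _ = _ := by push_cast; ring

/-- The condition at the prime `p` for an integer to be a fundamental discriminant. -/
def IsFundamentalAt (p : ℕ) (r : ℤ) : Prop :=
  if p = 2 then r % 4 = 1 ∨ r % 16 = 8 ∨ r % 16 = 12 else ¬ (p : ℤ) ^ 2 ∣ r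

theorem IsFundamentalAt.of_modEq {p k : ℕ} (hk : 4 ≤ k) {a b : ℤ}
    (hab : a ≡ b [ZMOD (p ^ k : ℕ)]) (ha : IsFundamentalAt p a) : IsFundamentalAt p b := by
  unfold IsFundamentalAt at *
  split_ifs at * with h
  · subst h
    have h1 : a ≡ b [ZMOD 16] := hab.of_dvd (by
      exact_mod_cast (pow_dvd_pow 2 hk : (2 : ℕ) ^ 4 ∣ 2 ^ k))
    unfold Int.ModEq at h1
    omega
  · intro hb
    apply ha
    have h1 : a ≡ b [ZMOD (p : ℤ) ^ 2] := hab.of_dvd (by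
      push_cast; exact pow_dvd_pow _ (by omega))
    exact (Int.modEq_zero_iff_dvd.1 (h1.trans (Int.modEq_zero_iff_dvd.2 hb)))

theorem squarefree_iff_primes (n : ℤ) :
    Squarefree n ↔ ∀ p : ℕ, p.Prime → ¬ (p : ℤ) ^ 2 ∣ n := by
  rw [← Int.squarefree_natAbs, Nat.squarefree_iff_prime_squarefree]
  refine forall_congr' fun p => forall_congr' fun _ => not_congr ?_
  rw [← Int.natCast_dvd, ← sq]
  push_cast
  rfl

theorem isFundamentalDiscriminant_iff (Δ : ℤ) :
    IsFundamentalDiscriminant Δ ↔ Δ ≠ 1 ∧ ∀ p : ℕ, p.Prime → IsFundamentalAt p Δ := by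
  unfold IsFundamentalDiscriminant
  refine and_congr_right fun _ => ?_
  simp only [squarefree_iff_primes, IsFundamentalAt]
  have hodd : ∀ p : ℕ, p.Prime → p ≠ 2 → Δ % 4 = 0 → ((p : ℤ) ^ 2 ∣ Δ / 4 ↔ (p : ℤ) ^ 2 ∣ Δ) := by
    intro p hp hp2 h4
    obtain ⟨t, rfl⟩ := Int.dvd_of_emod_eq_zero h4
    rw [Int.mul_ediv_cancel_left _ (by norm_num)]
    refine ⟨fun h => Dvd.dvd.mul_left h 4, fun h => ?_⟩
    refine IsCoprime.dvd_of_dvd_mul_left ?_ h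
    have : IsCoprime ((p : ℤ)) (2 : ℤ) := by
      exact_mod_cast Nat.isCoprime_iff_coprime.2 ((Nat.coprime_primes hp Nat.prime_two).2 hp2)
    have := (this.pow (m := 2) (n := 2))
    norm_num at this
    exact this
  constructor
  · rintro (⟨h1, h2⟩ | ⟨h1, h2, h3⟩) p hp
    · split_ifs with h
      · exact Or.inl h1
      · exact h2 p hp
    · split_ifs with h
      · omega
      · rw [← hodd p hp h h1]; exact h2 p hp
  · intro h
    have h2 := h 2 Nat.prime_two
    rw [if_pos rfl] at h2
    rcases h2 with h2 | h2
    · refine Or.inl ⟨h2, fun p hp => ?_⟩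
      by_cases hp2 : p = 2
      · subst hp2; push_cast; omega
      · have := h p hp
        rwa [if_neg hp2] at this
    · refine Or.inr ⟨by omega, fun p hp => ?_, by omega⟩
      by_cases hp2 : p = 2
      · subst hp2; push_cast; omega
      · have := h p hp
        rw [if_neg hp2] at this
        rwa [hodd p hp hp2 (by omega)]

/-- The component at `p` of an element of `ZMod W`. -/
def toPrimePow (W p : ℕ) : ZMod W →+* ZMod (p ^ W.factorization p) :=
  ZMod.castHom (Nat.ordProj_dvd W p) _

theorem toPrimePow_val_modEq {W : ℕ} [NeZero W] {p : ℕ} (hp : p.Prime) (r : ZMod W) :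
    ((toPrimePow W p r).val : ℤ) ≡ r.val [ZMOD (p ^ W.factorization p : ℕ)] := by
  have : NeZero (p ^ W.factorization p) := ⟨pow_ne_zero _ hp.ne_zero⟩
  rw [← ZMod.intCast_eq_intCast_iff]
  simp [toPrimePow, ZMod.natCast_val]

theorem equivPi_apply_eq {W : ℕ} (hW : W ≠ 0) (r : ZMod W) (p : W.primeFactors) :
    ZMod.equivPi W hW r p = toPrimePow W p r := by
  have : NeZero W := ⟨hW⟩
  have h := RingHom.congr_fun (Subsingleton.elim (toPrimePow W p)
    ((Pi.evalRingHom _ p).comp (ZMod.equivPi W hW).toRingHom)) r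
  exact h.symm

theorem card_forall_primeFactors {W : ℕ} [NeZero W] (L : ℕ → ℤ → Prop)
    (hL : ∀ p ∈ W.primeFactors, ∀ a b : ℤ, a ≡ b [ZMOD (p ^ W.factorization p : ℕ)] →
      L p a → L p b) :
    Nat.card {r : ZMod W // ∀ p ∈ W.primeFactors, L p r.val}
      = ∏ p ∈ W.primeFactors, Nat.card {r : ZMod (p ^ W.factorization p) // L p r.val} := by
  have e : {r : ZMod W // ∀ p ∈ W.primeFactors, L p r.val} ≃
      {f : (p : W.primeFactors) → ZMod ((p : ℕ) ^ W.factorization p) //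
        ∀ p : W.primeFactors, L p (f p).val} :=
    (ZMod.equivPi W (NeZero.ne W)).toEquiv.subtypeEquiv fun r => by
      constructor
      · intro h p
        change L p ((ZMod.equivPi W (NeZero.ne W) r p).val)
        rw [equivPi_apply_eq]
        exact hL p p.2 _ _ (toPrimePow_val_modEq (Nat.prime_of_mem_primeFactors p.2) r).symm
          (h p p.2)
      · intro h p hp
        have := h ⟨p, hp⟩
        change L p ((ZMod.equivPi W (NeZero.ne W) r ⟨p, hp⟩).val) at this
        rw [equivPi_apply_eq] at this
        exact hL p hp _ _ (toPrimePow_val_modEq (Nat.prime_of_mem_primeFactors hp) r) this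
  rw [Nat.card_congr e, Nat.card_congr (Equiv.subtypePiEquivPi
    (p := fun (p : W.primeFactors) (r : ZMod ((p : ℕ) ^ W.factorization p)) => L p r.val)),
    Nat.card_pi]
  exact Finset.prod_coe_sort W.primeFactors
    (fun p => Nat.card {r : ZMod (p ^ W.factorization p) // L p r.val})

theorem card_cubicDisc_eq_le {W : ℕ} [NeZero W] (h5 : ∀ p ∈ W.primeFactors, 5 ≤ W.factorization p)
    (h2 : 2 ∣ W) (m : ZMod W) (hm : ∀ p ∈ W.primeFactors, IsFundamentalAt p m.val) :
    (Nat.card {v : Fin 4 → ZMod W // cubicDisc v = m} : ℝ)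
      ≤ 2 * (∏ p ∈ W.primeFactors, (1 - ((p : ℝ) ^ 2)⁻¹)) * (W : ℝ) ^ 3 := by
  have hne : ∀ p : W.primeFactors, NeZero ((p : ℕ) ^ W.factorization p) :=
    fun p => ⟨pow_ne_zero _ (Nat.prime_of_mem_primeFactors p.2).ne_zero⟩
  have hle : Nat.card {v : Fin 4 → ZMod W // cubicDisc v = m} ≤
      Nat.card ((p : W.primeFactors) → {u : Fin 4 → ZMod ((p : ℕ) ^ W.factorization p) //
        cubicDisc u = toPrimePow W p m}) := by
    refine Nat.card_le_card_of_injective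
      (fun v p => ⟨fun i => toPrimePow W p (v.1 i), by
        exact (map_cubicDisc _ _).symm.trans (congrArg _ v.2)⟩) ?_
    intro v w hvw
    apply Subtype.ext
    funext i
    apply (ZMod.equivPi W (NeZero.ne W)).injective
    funext p
    rw [equivPi_apply_eq, equivPi_apply_eq]
    exact congrFun (congrArg Subtype.val (congrFun hvw p)) i
  rw [Nat.card_pi, Finset.prod_coe_sort W.primeFactors
    (fun p => Nat.card {u : Fin 4 → ZMod (p ^ W.factorization p) //
        cubicDisc u = toPrimePow W p m})] at hle
  have hloc : ∀ p ∈ W.primeFactors, (Nat.card {u : Fin 4 → ZMod (p ^ W.factorization p) //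
        cubicDisc u = toPrimePow W p m} : ℝ) ≤
      (if p = 2 then 2 else 1) * (1 - ((p : ℝ) ^ 2)⁻¹) * ((p ^ W.factorization p : ℕ) : ℝ) ^ 3 := by
    intro p hp
    have hpp := Nat.prime_of_mem_primeFactors hp
    have hf := IsFundamentalAt.of_modEq (by linarith [h5 p hp])
      (toPrimePow_val_modEq hpp m).symm (hm p hp)
    split_ifs with h
    · subst h
      refine card_cubicDisc_eq_two_le (h5 2 hp) _ ?_
      unfold IsFundamentalAt at hf
      rw [if_pos rfl] at hf
      omega
    · rw [one_mul]
      refine card_cubicDisc_eq_odd_le hpp h (by linarith [h5 p hp]) _ ?_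
      unfold IsFundamentalAt at hf
      rw [if_neg h] at hf
      intro h'
      exact hf (by exact_mod_cast h')
  calc (Nat.card {v : Fin 4 → ZMod W // cubicDisc v = m} : ℝ)
      ≤ ∏ p ∈ W.primeFactors, (Nat.card {u : Fin 4 → ZMod (p ^ W.factorization p) //
        cubicDisc u = toPrimePow W p m} : ℝ) := by exact_mod_cast hle
    _ ≤ ∏ p ∈ W.primeFactors, ((if p = 2 then 2 else 1) * (1 - ((p : ℝ) ^ 2)⁻¹) *
          ((p ^ W.factorization p : ℕ) : ℝ) ^ 3) :=
        Finset.prod_le_prod (fun _ _ => Nat.cast_nonneg _) hloc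
    _ = _ := by
        rw [Finset.prod_mul_distrib, Finset.prod_mul_distrib, Finset.prod_pow]
        have h1 : (∏ p ∈ W.primeFactors, ((p ^ W.factorization p : ℕ) : ℝ)) = W := by
          rw [← Nat.cast_prod]
          congr 1
          exact Nat.prod_factorization_pow_eq_self (NeZero.ne W)
        rw [h1, Finset.prod_ite_eq' W.primeFactors 2 (fun _ => (2 : ℝ)),
          if_pos (Nat.mem_primeFactors.2 ⟨Nat.prime_two, h2, NeZero.ne W⟩)]

/-- The condition at `p` for `r` to be a fundamental discriminant congruent to `m` modulo `M`. -/
def IsAdmissibleAt (m M p : ℕ) (r : ℤ) : Prop :=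
  IsFundamentalAt p r ∧ r ≡ m [ZMOD (p ^ M.factorization p : ℕ)]

/-- The proportion of `p`-adic integers satisfying `IsAdmissibleAt m M p`. -/
noncomputable def admissibleDensity (M p : ℕ) : ℝ :=
  if p ∣ M then ((p : ℝ) ^ M.factorization p)⁻¹ else if p = 2 then 3 / 8 else 1 - ((p : ℝ) ^ 2)⁻¹

theorem card_zmod_val (n : ℕ) [NeZero n] (P : ℕ → Prop) [DecidablePred P] :
    Nat.card {r : ZMod n // P r.val} = Nat.count P n := by
  rw [Nat.count_eq_card_fintype, ← @Nat.card_eq_fintype_card _ (Nat.CountSet.fintype P n)]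
  exact Nat.card_congr
    { toFun := fun r => ⟨r.1.val, ZMod.val_lt _, r.2⟩
      invFun := fun k => ⟨(k.1 : ZMod n), by rw [ZMod.val_cast_of_lt k.2.1]; exact k.2.2⟩
      left_inv := fun r => by simp
      right_inv := fun k => by simp [ZMod.val_cast_of_lt k.2.1] }

theorem isFundamentalAt_of_modEq {m M p : ℕ} (hM : M ≠ 0) (h : ValidPair m M) (hp : p.Prime)
    (hpM : p ∣ M) {r : ℤ} (hr : r ≡ m [ZMOD (p ^ M.factorization p : ℕ)]) :
    IsFundamentalAt p r := by
  have hdvd : ∀ j, p ^ j ∣ M → r ≡ m [ZMOD (p ^ j : ℕ)] := fun j hj =>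
    hr.of_dvd (by exact_mod_cast pow_dvd_pow p ((hp.pow_dvd_iff_le_factorization hM).1 hj))
  unfold IsFundamentalAt
  split_ifs with h2
  · subst h2
    rcases h.2 hpM with ⟨h4, h1⟩ | ⟨h16, h1⟩
    · have := hdvd 2 h4
      unfold Int.ModEq at this
      norm_num at this
      omega
    · have := hdvd 4 h16
      unfold Int.ModEq at this
      norm_num at this
      omega
  · intro hd
    have hpm : p ∣ m := by
      have h1 := hdvd 1 (by simpa using hpM)
      have h3 : (p : ℤ) ∣ r := (dvd_pow_self _ two_ne_zero).trans hd
      rw [pow_one] at h1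
      have := h1.symm.trans (Int.modEq_zero_iff_dvd.2 h3)
      exact_mod_cast Int.modEq_zero_iff_dvd.1 this
    obtain ⟨h3, h4⟩ := h.1 p hp h2 (Nat.dvd_gcd hpm hpM)
    have h5 := hdvd 2 h3
    apply h4
    have := h5.symm.trans (Int.modEq_zero_iff_dvd.2 (by exact_mod_cast hd))
    exact_mod_cast Int.modEq_zero_iff_dvd.1 this

theorem count_modEq_of_dvd {n b : ℕ} (hb : 0 < b) (hn : b ∣ n) (v : ℕ) :
    Nat.count (· ≡ v [MOD b]) n = n / b := by
  rw [Nat.count_modEq_card _ hb, Nat.mod_eq_zero_of_dvd hn]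
  simp

theorem card_isAdmissibleAt {m M p k : ℕ} (hM : M ≠ 0) (h : ValidPair m M) (hp : p.Prime)
    (hk : 5 ≤ k) (hkM : M.factorization p ≤ k) :
    (Nat.card {r : ZMod (p ^ k) // IsAdmissibleAt m M p r.val} : ℝ)
      = admissibleDensity M p * (p ^ k : ℕ) := by
  classical
  have : NeZero (p ^ k) := ⟨pow_ne_zero _ hp.ne_zero⟩
  rw [card_zmod_val (p ^ k) (fun r => IsAdmissibleAt m M p r)]
  have hp0 : (p : ℝ) ≠ 0 := by exact_mod_cast hp.ne_zero
  unfold admissibleDensity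
  split_ifs with h1 h2
  · have e : (fun r : ℕ => IsAdmissibleAt m M p r)
        = (· ≡ m [MOD (p ^ M.factorization p)]) := by
      funext r
      apply propext
      rw [IsAdmissibleAt, Int.natCast_modEq_iff]
      exact and_iff_right_of_imp fun hr =>
        isFundamentalAt_of_modEq hM h hp h1 (Int.natCast_modEq_iff.2 hr)
    simp only [e]
    rw [count_modEq_of_dvd (pow_pos hp.pos _) (pow_dvd_pow p hkM), Nat.cast_div
      (pow_dvd_pow p hkM) (by exact_mod_cast pow_ne_zero _ hp.ne_zero)]
    push_cast
    field_simp
  · subst h2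
    have e : (fun r : ℕ => IsAdmissibleAt m M 2 r) =
        fun r => r ≡ 1 [MOD 4] ∨ (r ≡ 8 [MOD 16] ∨ r ≡ 12 [MOD 16]) := by
      funext r
      apply propext
      rw [IsAdmissibleAt, Nat.factorization_eq_zero_of_not_dvd h1]
      simp only [IsFundamentalAt, if_pos, Nat.ModEq, Int.ModEq]
      norm_num
      omega
    simp only [e]
    obtain ⟨l, rfl⟩ : ∃ l, k = l + 4 := ⟨k - 4, by omega⟩
    have hcount : Nat.count (fun r => r ≡ 1 [MOD 4] ∨ (r ≡ 8 [MOD 16] ∨ r ≡ 12 [MOD 16]))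
        (2 ^ (l + 4)) = 2 ^ (l + 4) / 4 + (2 ^ (l + 4) / 16 + 2 ^ (l + 4) / 16) := by
      have hd : (4 : ℕ) ∣ 2 ^ (l + 4) := ⟨2 ^ (l + 2), by ring⟩
      have hd' : (16 : ℕ) ∣ 2 ^ (l + 4) := ⟨2 ^ l, by ring⟩
      have c1 := count_modEq_of_dvd (by norm_num) hd 1
      have c2 := count_modEq_of_dvd (by norm_num) hd' 8
      have c3 := count_modEq_of_dvd (by norm_num) hd' 12
      refine Eq.trans ?_ (congrArg₂ _ c1 (congrArg₂ _ c2 c3))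
      simp only [Nat.count_eq_card_filter_range]
      rw [Finset.filter_or, Finset.card_union_of_disjoint, Finset.filter_or,
        Finset.card_union_of_disjoint]
      · rw [Finset.disjoint_filter]; intro x _; simp only [Nat.ModEq]; omega
      · rw [Finset.disjoint_filter]; intro x _; simp only [Nat.ModEq]; omega
    rw [hcount]
    have e4 : 2 ^ (l + 4) / 4 = 4 * 2 ^ l := by rw [pow_add]; omega
    have e16 : 2 ^ (l + 4) / 16 = 2 ^ l := by rw [pow_add]; omega
    rw [e4, e16]
    push_cast
    ring
  · have e : (fun r : ℕ => IsAdmissibleAt m M p r) = fun r => ¬ (r ≡ 0 [MOD p ^ 2]) := by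
      funext r
      apply propext
      rw [IsAdmissibleAt, Nat.factorization_eq_zero_of_not_dvd h1]
      simp only [IsFundamentalAt, if_neg h2, Nat.modEq_zero_iff_dvd]
      norm_num [Int.modEq_one]
      exact_mod_cast Iff.rfl
    simp only [e]
    have hcount : Nat.count (· ≡ 0 [MOD p ^ 2]) (p ^ k)
        + Nat.count (fun r => ¬ (r ≡ 0 [MOD p ^ 2])) (p ^ k) = p ^ k := by
      simp only [Nat.count_eq_card_filter_range]
      rw [Finset.card_filter_add_card_filter_not, Finset.card_range]
    have hd : p ^ 2 ∣ p ^ k := pow_dvd_pow p (by omega)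
    rw [count_modEq_of_dvd (pow_pos hp.pos _) hd] at hcount
    have hcount' : (((p ^ k / p ^ 2 : ℕ) : ℝ)
        + (Nat.count (fun r => ¬ (r ≡ 0 [MOD p ^ 2])) (p ^ k) : ℕ) = (p ^ k : ℕ)) := by
      exact_mod_cast hcount
    rw [Nat.cast_div hd (by exact_mod_cast pow_ne_zero _ hp.ne_zero)] at hcount'
    push_cast at hcount' ⊢
    rw [sub_mul, one_mul, inv_mul_eq_div]
    linarith

theorem card_forall_isAdmissibleAt {m M W : ℕ} [NeZero W] (hM : M ≠ 0) (h : ValidPair m M)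
    (h5 : ∀ p ∈ W.primeFactors, 5 ≤ W.factorization p) (hMW : M ∣ W) :
    (Nat.card {r : ZMod W // ∀ p ∈ W.primeFactors, IsAdmissibleAt m M p r.val} : ℝ)
      = (∏ p ∈ W.primeFactors, admissibleDensity M p) * W := by
  have hle : ∀ p, M.factorization p ≤ W.factorization p := fun p =>
    (Nat.factorization_le_iff_dvd hM (NeZero.ne W)).2 hMW p
  rw [card_forall_primeFactors (IsAdmissibleAt m M) fun p hp a b hab ha =>
    ⟨IsFundamentalAt.of_modEq (by linarith [h5 p hp]) hab ha.1,
      ((hab.of_dvd (by exact_mod_cast pow_dvd_pow p (hle p))).symm.trans ha.2)⟩, Nat.cast_prod,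
    Finset.prod_congr rfl fun p hp => card_isAdmissibleAt hM h
      (Nat.prime_of_mem_primeFactors hp) (h5 p hp) (hle p), Finset.prod_mul_distrib]
  congr 1
  rw [← Nat.cast_prod]
  congr 1
  exact Nat.prod_factorization_pow_eq_self (NeZero.ne W)

theorem prod_admissibleDensity {M W : ℕ} (hM : M ≠ 0) (hW : W ≠ 0) (hMW : M ∣ W) :
    ∏ p ∈ W.primeFactors, admissibleDensity M p =
      (1 / (M.totient : ℝ) * ∏ p ∈ M.primeFactors,
        (if p = 2 then (4 : ℝ) else (p : ℝ)) / ((p : ℝ) + 1)) *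
      ∏ p ∈ W.primeFactors, admissibleDensity 1 p := by
  have hsub : M.primeFactors ⊆ W.primeFactors := Nat.primeFactors_mono hMW hW
  rw [← Finset.prod_sdiff hsub, ← Finset.prod_sdiff hsub (f := fun p => admissibleDensity 1 p)]
  have h1 : ∏ p ∈ W.primeFactors \ M.primeFactors, admissibleDensity M p
      = ∏ p ∈ W.primeFactors \ M.primeFactors, admissibleDensity 1 p := by
    refine Finset.prod_congr rfl fun p hp => ?_
    obtain ⟨hp1, hp2⟩ := Finset.mem_sdiff.1 hp
    have hpp := Nat.prime_of_mem_primeFactors hp1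
    have : ¬ p ∣ M := fun hd => hp2 (Nat.mem_primeFactors.2 ⟨hpp, hd, hM⟩)
    have h' : ¬ p ∣ 1 := fun hd => hpp.one_lt.ne' (Nat.dvd_one.1 hd)
    simp only [admissibleDensity, if_neg this, if_neg h']
  have h2 : ∏ p ∈ M.primeFactors, admissibleDensity M p =
      (1 / (M.totient : ℝ) * ∏ p ∈ M.primeFactors,
        (if p = 2 then (4 : ℝ) else (p : ℝ)) / ((p : ℝ) + 1)) *
      ∏ p ∈ M.primeFactors, admissibleDensity 1 p := by
    have hφ : (M.totient : ℝ) = ∏ p ∈ M.primeFactors,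
        ((p : ℝ) ^ M.factorization p * (1 - (p : ℝ)⁻¹)) := by
      have h3 := Nat.totient_eq_mul_prod_factors M
      have h4 : (M.totient : ℝ) = M * ∏ p ∈ M.primeFactors, (1 - (p : ℝ)⁻¹) := by
        have := congrArg (fun x : ℚ => (x : ℝ)) h3
        push_cast at this
        exact this
      rw [Finset.prod_mul_distrib, h4]
      congr 1
      nth_rw 1 [← Nat.prod_factorization_pow_eq_self hM]
      rw [Finsupp.prod]
      push_cast
      rfl
    rw [hφ, one_div, ← Finset.prod_inv_distrib, ← Finset.prod_mul_distrib,
      ← Finset.prod_mul_distrib]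
    refine Finset.prod_congr rfl fun p hp => ?_
    have hpp := Nat.prime_of_mem_primeFactors hp
    have h' : ¬ p ∣ 1 := fun hd => hpp.one_lt.ne' (Nat.dvd_one.1 hd)
    have hp0 : (1 : ℝ) < p := by exact_mod_cast hpp.one_lt
    have hp1 : (p : ℝ) ≠ 0 := by linarith
    have hp2 : (p : ℝ) - 1 ≠ 0 := by linarith
    have hp3 : (p : ℝ) + 1 ≠ 0 := by linarith
    simp only [admissibleDensity, if_pos (Nat.dvd_of_mem_primeFactors hp), if_neg h']
    split_ifs with h2
    · subst h2; norm_num; ring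
    · have : 1 - (p : ℝ)⁻¹ = (p - 1) / p := by field_simp
      have h3 : 1 - ((p : ℝ) ^ 2)⁻¹ = (p - 1) * (p + 1) / p ^ 2 := by field_simp; ring
      rw [this, h3]
      field_simp
  rw [h1, h2]
  ring

theorem prod_admissibleDensity_one {W : ℕ} (hW : W ≠ 0) (h2 : 2 ∣ W) :
    ∏ p ∈ W.primeFactors, admissibleDensity 1 p =
      (∏ p ∈ W.primeFactors, (1 - ((p : ℝ) ^ 2)⁻¹)) / 2 := by
  have h2W : 2 ∈ W.primeFactors := Nat.mem_primeFactors.2 ⟨Nat.prime_two, h2, hW⟩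
  rw [← Finset.mul_prod_erase _ _ h2W, ← Finset.mul_prod_erase _ _ h2W]
  rw [Finset.prod_congr rfl (g := fun p : ℕ => (1 - ((p : ℝ) ^ 2)⁻¹)) fun p hp => ?_]
  · simp only [admissibleDensity]
    norm_num
    ring
  · obtain ⟨hp1, hp2⟩ := Finset.mem_erase.1 hp
    have hpp := Nat.prime_of_mem_primeFactors hp2
    have h' : ¬ p ∣ 1 := fun hd => hpp.one_lt.ne' (Nat.dvd_one.1 hd)
    simp only [admissibleDensity, if_neg h', if_neg hp1]

/-- The integers in the interval `(-x, 0)`. -/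
noncomputable def negInts (x : ℝ) : Finset ℤ := Finset.Ioc ⌊-x⌋ (-1)

theorem mem_negInts {x : ℝ} {Δ : ℤ} : Δ ∈ negInts x ↔ -x < (Δ : ℝ) ∧ Δ < 0 := by
  rw [negInts, Finset.mem_Ioc, Int.floor_lt]
  exact and_congr_right fun _ => by omega

theorem abs_card_negInts_modEq_sub_le {W : ℕ} (hW : 0 < W) (v : ℤ) {x : ℝ} (hx : 0 < x) :
    |(((negInts x).filter fun Δ => Δ ≡ v [ZMOD W]).card : ℝ) - x / W| ≤ 2 := by
  have h := Int.Ioc_filter_modEq_card ⌊-x⌋ (-1) (r := (W : ℤ)) (by exact_mod_cast hW) v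
  have hf1 := Int.floor_le (-x)
  have hf2 := Int.lt_floor_add_one (-x)
  have hW' : (1 : ℝ) ≤ W := by exact_mod_cast hW
  have hW0 : (0 : ℝ) < W := by linarith
  set A : ℤ := ⌊(((-1 : ℤ) : ℚ) - v) / ((W : ℤ) : ℚ)⌋ with hA
  set B : ℤ := ⌊((⌊-x⌋ : ℚ) - v) / ((W : ℤ) : ℚ)⌋ with hB
  have hA1 : (A : ℝ) ≤ (-1 - v) / W := by
    have := Int.floor_le ((((-1 : ℤ) : ℚ) - v) / ((W : ℤ) : ℚ))
    rw [← hA] at this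
    exact_mod_cast this
  have hA2 : ((-1 : ℝ) - v) / W < A + 1 := by
    have := Int.lt_floor_add_one ((((-1 : ℤ) : ℚ) - v) / ((W : ℤ) : ℚ))
    rw [← hA] at this
    exact_mod_cast this
  have hB1 : (B : ℝ) ≤ (⌊-x⌋ - v) / W := by
    have := Int.floor_le (((⌊-x⌋ : ℚ) - v) / ((W : ℤ) : ℚ))
    rw [← hB] at this
    exact_mod_cast this
  have hB2 : ((⌊-x⌋ : ℝ) - v) / W < B + 1 := by
    have := Int.lt_floor_add_one (((⌊-x⌋ : ℚ) - v) / ((W : ℤ) : ℚ))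
    rw [← hB] at this
    exact_mod_cast this
  have hfx : ⌊-x⌋ ≤ -1 := by
    have : ⌊-x⌋ < 0 := Int.floor_lt.2 (by simpa using hx)
    omega
  have hBA : B ≤ A := by
    apply Int.floor_le_floor
    gcongr
  rw [max_eq_left (by omega)] at h
  have h' : (((negInts x).filter fun Δ => Δ ≡ v [ZMOD W]).card : ℝ) = A - B := by
    exact_mod_cast h
  rw [h']
  have k1 : ((-1 : ℝ) - v) / W - (⌊-x⌋ - v) / W ≤ x / W := by
    rw [← sub_div]; exact div_le_div_of_nonneg_right (by linarith) hW0.le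
  have k2 : x / W - 1 ≤ ((-1 : ℝ) - v) / W - (⌊-x⌋ - v) / W := by
    rw [← sub_div]
    calc x / W - 1 ≤ x / W - 1 / W := by
          have : 1 / (W : ℝ) ≤ 1 := by rw [div_le_one hW0]; exact hW'
          linarith
      _ = (x - 1) / W := by rw [sub_div]
      _ ≤ _ := div_le_div_of_nonneg_right (by linarith) hW0.le
  rw [abs_le]
  constructor <;> linarith

theorem abs_card_negInts_residues_sub_le {W : ℕ} [NeZero W] (R : Finset (ZMod W)) {x : ℝ}
    (hx : 0 < x) :
    |(((negInts x).filter fun Δ : ℤ => (Δ : ZMod W) ∈ R).card : ℝ) - R.card * (x / W)|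
      ≤ R.card * 2 := by
  have h1 : ((negInts x).filter fun Δ : ℤ => (Δ : ZMod W) ∈ R).card =
      ∑ r ∈ R, ((negInts x).filter fun Δ => Δ ≡ (r.val : ℤ) [ZMOD W]).card := by
    rw [Finset.card_eq_sum_card_fiberwise
      (s := (negInts x).filter fun Δ : ℤ => (Δ : ZMod W) ∈ R)
      (f := fun Δ : ℤ => (Δ : ZMod W)) (t := R) (fun Δ hΔ => (Finset.mem_filter.1 hΔ).2)]
    refine Finset.sum_congr rfl fun r hr => congrArg _ ?_
    ext Δ
    have : (Δ : ZMod W) = r ↔ Δ ≡ (r.val : ℤ) [ZMOD W] := by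
      rw [← ZMod.intCast_eq_intCast_iff]; simp
    simp only [Finset.mem_filter, ← this]
    constructor
    · rintro ⟨⟨h1, h2⟩, h3⟩; exact ⟨h1, h3⟩
    · rintro ⟨h1, rfl⟩; exact ⟨⟨h1, hr⟩, rfl⟩
  rw [h1, Nat.cast_sum, ← nsmul_eq_mul R.card (x / W), ← Finset.sum_const,
    ← Finset.sum_sub_distrib, ← nsmul_eq_mul R.card 2, ← Finset.sum_const]
  exact (Finset.abs_sum_le_sum_abs _ _).trans (Finset.sum_le_sum fun r _ =>
    abs_card_negInts_modEq_sub_le (NeZero.pos W) _ hx)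

theorem card_negInts_sq_dvd_le {n : ℕ} (hn : 0 < n) {x : ℝ} (hx : 0 < x) :
    (((negInts x).filter fun Δ => (n : ℤ) ^ 2 ∣ Δ).card : ℝ) ≤ x * ((n : ℝ) ^ 2)⁻¹ := by
  have hsub : (negInts x).filter (fun Δ => (n : ℤ) ^ 2 ∣ Δ) ⊆
      (Finset.Icc 1 ⌊x * ((n : ℝ) ^ 2)⁻¹⌋₊).image fun t : ℕ => -((n : ℤ) ^ 2 * t) := by
    intro Δ hΔ
    obtain ⟨h1, s, rfl⟩ := Finset.mem_filter.1 hΔ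
    obtain ⟨h2, h3⟩ := mem_negInts.1 h1
    have hs : s < 0 := by
      by_contra hs
      have : 0 ≤ (n : ℤ) ^ 2 * s := mul_nonneg (sq_nonneg _) (by omega)
      omega
    have h4 : ((-s).toNat : ℤ) = -s := Int.toNat_of_nonneg (by omega)
    refine Finset.mem_image.2 ⟨(-s).toNat, Finset.mem_Icc.2 ⟨by omega, ?_⟩, by rw [h4]; ring⟩
    apply Nat.le_floor
    rw [← div_eq_mul_inv, le_div_iff₀ (by positivity)]
    have h5 : (((-s).toNat : ℕ) : ℝ) = -s := by exact_mod_cast h4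
    rw [h5]
    push_cast at h2
    linarith
  calc (((negInts x).filter fun Δ => (n : ℤ) ^ 2 ∣ Δ).card : ℝ)
      ≤ ((⌊x * ((n : ℝ) ^ 2)⁻¹⌋₊ : ℕ) : ℝ) := by
        have := (Finset.card_le_card hsub).trans Finset.card_image_le
        rw [Nat.card_Icc, Nat.add_sub_cancel] at this
        exact_mod_cast this
    _ ≤ _ := Nat.floor_le (by positivity)

open Classical in
theorem card_negInts_exists_sq_dvd_le {z : ℕ} (hz : 0 < z) {x : ℝ} (hx : 0 < x) :
    (((negInts x).filter fun Δ => ∃ n : ℕ, z < n ∧ (n : ℤ) ^ 2 ∣ Δ).card : ℝ) ≤ x / z := by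
  set N := max z ⌊x⌋₊
  have hsub : (negInts x).filter (fun Δ => ∃ n : ℕ, z < n ∧ (n : ℤ) ^ 2 ∣ Δ) ⊆
      (Finset.Ioc z N).biUnion fun n => (negInts x).filter fun Δ => (n : ℤ) ^ 2 ∣ Δ := by
    intro Δ hΔ
    obtain ⟨h1, n, h2, h3⟩ := Finset.mem_filter.1 hΔ
    refine Finset.mem_biUnion.2 ⟨n, Finset.mem_Ioc.2 ⟨h2, le_max_of_le_right ?_⟩,
      Finset.mem_filter.2 ⟨h1, h3⟩⟩
    obtain ⟨h4, h5⟩ := mem_negInts.1 h1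
    have h6 : (n : ℤ) ^ 2 ≤ -Δ := Int.le_of_dvd (by omega) (Int.dvd_neg.2 h3)
    have h7 : (n : ℤ) ≤ -Δ := by nlinarith
    apply Nat.le_floor
    have h8 : (n : ℝ) ≤ -Δ := by exact_mod_cast h7
    linarith
  calc (((negInts x).filter fun Δ => ∃ n : ℕ, z < n ∧ (n : ℤ) ^ 2 ∣ Δ).card : ℝ)
      ≤ ∑ n ∈ Finset.Ioc z N, (((negInts x).filter fun Δ => (n : ℤ) ^ 2 ∣ Δ).card : ℝ) := by
        exact_mod_cast (Finset.card_le_card hsub).trans Finset.card_biUnion_le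
    _ ≤ ∑ n ∈ Finset.Ioc z N, x * ((n : ℝ) ^ 2)⁻¹ := Finset.sum_le_sum fun n hn =>
        card_negInts_sq_dvd_le (hz.trans (Finset.mem_Ioc.1 hn).1) hx
    _ ≤ x / z := by
        rw [← Finset.mul_sum, div_eq_mul_inv]
        refine mul_le_mul_of_nonneg_left ?_ hx.le
        refine (sum_Ioc_inv_sq_le_sub hz.ne' (le_max_left _ _)).trans ?_
        simp

/-- The residues modulo `W` satisfying `IsAdmissibleAt m M p` at all primes `p ∣ W`. -/
noncomputable def admissibleResidues (m M W : ℕ) [NeZero W] : Finset (ZMod W) :=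
  open Classical in
  Finset.univ.filter fun r => ∀ p ∈ W.primeFactors, IsAdmissibleAt m M p r.val

theorem mem_admissibleResidues {m M W : ℕ} [NeZero W] {r : ZMod W} :
    r ∈ admissibleResidues m M W ↔ ∀ p ∈ W.primeFactors, IsAdmissibleAt m M p r.val := by
  classical
  simp [admissibleResidues]

theorem card_admissibleResidues {m M W : ℕ} [NeZero W] (hM : M ≠ 0) (h : ValidPair m M)
    (h5 : ∀ p ∈ W.primeFactors, 5 ≤ W.factorization p) (hMW : M ∣ W) :
    ((admissibleResidues m M W).card : ℝ)
      = (∏ p ∈ W.primeFactors, admissibleDensity M p) * W := by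
  rw [← card_forall_isAdmissibleAt hM h h5 hMW, ← Nat.subtype_card _
    (fun r => mem_admissibleResidues)]

theorem intCast_val_modEq {W : ℕ} [NeZero W] (Δ : ℤ) :
    ((Δ : ZMod W).val : ℤ) ≡ Δ [ZMOD W] := by
  rw [← ZMod.intCast_eq_intCast_iff]; simp

theorem intCast_mem_admissibleResidues {m M W : ℕ} [NeZero W]
    (h5 : ∀ p ∈ W.primeFactors, 5 ≤ W.factorization p) (hMW : M ∣ W) {Δ : ℤ}
    (hΔ : IsFundamentalDiscriminant Δ) (hm : Δ ≡ m [ZMOD M]) :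
    (Δ : ZMod W) ∈ admissibleResidues m M W := by
  refine mem_admissibleResidues.2 fun p hp => ?_
  have hpp := Nat.prime_of_mem_primeFactors hp
  have hmod := intCast_val_modEq (W := W) Δ
  refine ⟨(((isFundamentalDiscriminant_iff Δ).1 hΔ).2 p hpp).of_modEq
    (le_trans (by norm_num) (h5 p hp))
    (hmod.of_dvd (by exact_mod_cast Nat.ordProj_dvd W p)).symm, ?_⟩
  exact ((hmod.of_dvd (by exact_mod_cast hMW)).trans hm).of_dvd
    (by exact_mod_cast Nat.ordProj_dvd M p)

theorem isFundamentalDiscriminant_of_mem {m M W z : ℕ} [NeZero W] (hM : M ≠ 0)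
    (h5 : ∀ p ∈ W.primeFactors, 5 ≤ W.factorization p) (hMW : M ∣ W) (hz : 2 ≤ z)
    (hzW : ∀ p : ℕ, p.Prime → p ≤ z → p ∣ W) {Δ : ℤ} (hΔ0 : Δ < 0)
    (hΔ : (Δ : ZMod W) ∈ admissibleResidues m M W) (hn : ¬ ∃ n : ℕ, z < n ∧ (n : ℤ) ^ 2 ∣ Δ) :
    IsFundamentalDiscriminant Δ ∧ Δ ≡ m [ZMOD M] := by
  have hmod := intCast_val_modEq (W := W) Δ
  have h := mem_admissibleResidues.1 hΔ
  constructor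
  · refine (isFundamentalDiscriminant_iff Δ).2 ⟨by omega, fun p hp => ?_⟩
    by_cases hpW : p ∣ W
    · have hpW' := Nat.mem_primeFactors.2 ⟨hp, hpW, NeZero.ne W⟩
      exact (h p hpW').1.of_modEq (le_trans (by norm_num) (h5 p hpW'))
        (hmod.of_dvd (by exact_mod_cast Nat.ordProj_dvd W p))
    · have hpz : z < p := by
        by_contra hpz
        exact hpW (hzW p hp (by omega))
      unfold IsFundamentalAt
      rw [if_neg (by omega)]
      exact fun hd => hn ⟨p, hpz, hd⟩
  · have h1 : ∀ p : ℕ, p.Prime → ∀ k, p ^ k ∣ M → ((p ^ k : ℕ) : ℤ) ∣ (Δ - m) := by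
      intro p hp k hk
      by_cases hk0 : k = 0
      · simp [hk0]
      have hpM : p ∣ M := (dvd_pow_self p hk0).trans hk
      have hpW' := Nat.mem_primeFactors.2 ⟨hp, hpM.trans hMW, NeZero.ne W⟩
      have h2 := (h p hpW').2.of_dvd (m := (p ^ k : ℕ)) (by
        exact_mod_cast pow_dvd_pow p ((hp.pow_dvd_iff_le_factorization hM).1 hk))
      have h3 := (hmod.of_dvd (m := (p ^ k : ℕ)) (by exact_mod_cast hk.trans hMW)).symm.trans h2
      exact h3.symm.dvd
    apply Int.ModEq.symm
    rw [Int.modEq_iff_dvd, Int.natCast_dvd, Nat.dvd_iff_prime_pow_dvd_dvd]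
    intro p k hp hk
    exact Int.natCast_dvd.1 (h1 p hp k hk)

open MeasureTheory Topology in
/-- An upper bound for the number of lattice points of a residue class in a dilated compact set. -/
theorem eventually_card_lattice_le {K : Set (ℝ × ℝ × ℝ × ℝ)} (hK : IsCompact K) {W : ℕ}
    (hW : 0 < W) {ε : ℝ} (hε : 0 < ε) :
    ∀ᶠ t : ℝ in atTop, ∀ S : Finset (ℤ × ℤ × ℤ × ℤ),
      (∀ v ∈ S, ∀ w ∈ S, (W : ℤ) ∣ v.1 - w.1 ∧ (W : ℤ) ∣ v.2.1 - w.2.1 ∧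
        (W : ℤ) ∣ v.2.2.1 - w.2.2.1 ∧ (W : ℤ) ∣ v.2.2.2 - w.2.2.2) →
      (∀ v ∈ S, ((v.1 : ℝ) / t, (v.2.1 : ℝ) / t, (v.2.2.1 : ℝ) / t, (v.2.2.2 : ℝ) / t) ∈ K) →
      (S.card : ℝ) * W ^ 4 ≤ (volume.real K + ε) * t ^ 4 := by
  have hW' : (0 : ℝ) < W := by exact_mod_cast hW
  have hfin : volume K ≠ ⊤ := hK.measure_lt_top.ne
  have h1 := tendsto_measure_cthickening_of_isCompact (μ := volume) hK
  have h2 : Tendsto (fun t : ℝ => (W : ℝ) / t) atTop (𝓝 0) :=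
    tendsto_const_nhds.div_atTop tendsto_id
  have h3 := h1.comp h2
  have hlt : volume K < ENNReal.ofReal (volume.real K + ε) := by
    rw [← ENNReal.ofReal_toReal hfin]
    exact (ENNReal.ofReal_lt_ofReal_iff (by positivity)).2 (lt_add_of_pos_right _ hε)
  filter_upwards [h3.eventually_lt_const hlt, eventually_gt_atTop 0] with t ht ht0 S hS hSK
  let Q : ℤ → Set ℝ := fun n => Set.Ico ((n : ℝ) / t) (((n : ℝ) + W) / t)
  have hQvol : ∀ n, volume (Q n) = ENNReal.ofReal (W / t) := fun n => by
    rw [Real.volume_Ico]; congr 1; ring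
  have hQd : ∀ n k : ℤ, (W : ℤ) ∣ n - k → n ≠ k → Disjoint (Q n) (Q k) := by
    intro n k hd hne
    rw [Set.disjoint_left]
    rintro y ⟨hy1, hy2⟩ ⟨hy3, hy4⟩
    rw [div_le_iff₀ ht0] at hy1 hy3
    rw [lt_div_iff₀ ht0] at hy2 hy4
    have e1 : (n : ℝ) < k + W := by linarith
    have e2 : (k : ℝ) < n + W := by linarith
    have e1' : n < k + W := by exact_mod_cast e1
    have e2' : k < n + W := by exact_mod_cast e2
    apply hne
    have := Int.eq_zero_of_abs_lt_dvd hd (by rw [abs_lt]; constructor <;> linarith)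
    omega
  have hQdist : ∀ n : ℤ, ∀ y ∈ Q n, dist y ((n : ℝ) / t) ≤ W / t := by
    rintro n y ⟨hy1, hy2⟩
    rw [Real.dist_eq, abs_of_nonneg (by linarith)]
    rw [add_div] at hy2
    linarith
  let P : ℤ × ℤ × ℤ × ℤ → Set (ℝ × ℝ × ℝ × ℝ) := fun v =>
    Q v.1 ×ˢ Q v.2.1 ×ˢ Q v.2.2.1 ×ˢ Q v.2.2.2
  have hPm : ∀ v, MeasurableSet (P v) := fun v =>
    measurableSet_Ico.prod (measurableSet_Ico.prod (measurableSet_Ico.prod measurableSet_Ico))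
  have hPvol : ∀ v, volume (P v) = ENNReal.ofReal ((W / t) ^ 4) := by
    intro v
    have h0 : 0 ≤ (W : ℝ) / t := by positivity
    simp only [P, Measure.volume_eq_prod, Measure.prod_prod, hQvol]
    rw [← ENNReal.ofReal_mul h0, ← ENNReal.ofReal_mul h0, ← ENNReal.ofReal_mul h0]
    congr 1; ring
  have hPd : (S : Set (ℤ × ℤ × ℤ × ℤ)).PairwiseDisjoint P := by
    intro v hv w hw hne
    obtain ⟨d1, d2, d3, d4⟩ := hS v hv w hw
    change Disjoint (P v) (P w)
    by_cases e1 : v.1 = w.1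
    · by_cases e2 : v.2.1 = w.2.1
      · by_cases e3 : v.2.2.1 = w.2.2.1
        · by_cases e4 : v.2.2.2 = w.2.2.2
          · exact absurd (Prod.ext e1 (Prod.ext e2 (Prod.ext e3 e4))) hne
          · exact Set.Disjoint.set_prod_right (Set.Disjoint.set_prod_right
              (Set.Disjoint.set_prod_right (hQd _ _ d4 e4) _ _) _ _) _ _
        · exact Set.Disjoint.set_prod_right (Set.Disjoint.set_prod_right
            (Set.Disjoint.set_prod_left (hQd _ _ d3 e3) _ _) _ _) _ _
      · exact Set.Disjoint.set_prod_right (Set.Disjoint.set_prod_left (hQd _ _ d2 e2) _ _) _ _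
    · exact Set.Disjoint.set_prod_left (hQd _ _ d1 e1) _ _
  have hPsub : (⋃ v ∈ S, P v) ⊆ Metric.cthickening (W / t) K := by
    intro y hy
    obtain ⟨v, hv, hy⟩ := Set.mem_iUnion₂.1 hy
    refine Metric.mem_cthickening_of_dist_le y _ _ K (hSK v hv) ?_
    obtain ⟨y1, y2, y3, y4⟩ := hy
    simp only [Prod.dist_eq, max_le_iff]
    exact ⟨hQdist _ _ y1, hQdist _ _ y2, hQdist _ _ y3, hQdist _ _ y4⟩
  have h4 : (S.card : ENNReal) * ENNReal.ofReal ((W / t) ^ 4)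
      ≤ ENNReal.ofReal (volume.real K + ε) := by
    calc (S.card : ENNReal) * ENNReal.ofReal ((W / t) ^ 4)
        = ∑ v ∈ S, volume (P v) := by simp [hPvol]
      _ = volume (⋃ v ∈ S, P v) := (measure_biUnion_finset hPd fun v _ => hPm v).symm
      _ ≤ volume (Metric.cthickening (W / t) K) := measure_mono hPsub
      _ ≤ _ := ht.le
  rw [← ENNReal.ofReal_natCast, ← ENNReal.ofReal_mul (by positivity),
    ENNReal.ofReal_le_ofReal_iff (by positivity)] at h4
  rw [div_pow, mul_div_assoc', div_le_iff₀ (by positivity)] at h4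
  exact h4

/-- The vector of residues of an integral quadruple. -/
def residueVec (W : ℕ) (v : ℤ × ℤ × ℤ × ℤ) : Fin 4 → ZMod W :=
  ![(v.1 : ZMod W), (v.2.1 : ZMod W), (v.2.2.1 : ZMod W), (v.2.2.2 : ZMod W)]

open MeasureTheory in
theorem eventually_card_lattice_residues_le {K : Set (ℝ × ℝ × ℝ × ℝ)} (hK : IsCompact K) {W : ℕ}
    (hW : 0 < W) (Ω : Finset (Fin 4 → ZMod W)) {ε : ℝ} (hε : 0 < ε) :
    ∀ᶠ t : ℝ in atTop, ∀ S : Finset (ℤ × ℤ × ℤ × ℤ), (∀ v ∈ S, residueVec W v ∈ Ω) →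
      (∀ v ∈ S, ((v.1 : ℝ) / t, (v.2.1 : ℝ) / t, (v.2.2.1 : ℝ) / t, (v.2.2.2 : ℝ) / t) ∈ K) →
      (S.card : ℝ) ≤ Ω.card / W ^ 4 * (volume.real K + ε) * t ^ 4 := by
  classical
  have hW' : (0 : ℝ) < W := by exact_mod_cast hW
  filter_upwards [eventually_card_lattice_le hK hW hε] with t ht S hS hSK
  rw [Finset.card_eq_sum_card_fiberwise (f := residueVec W) (t := Ω) hS, Nat.cast_sum]
  have h1 : ∀ ω ∈ Ω, ((S.filter fun v => residueVec W v = ω).card : ℝ)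
      ≤ (volume.real K + ε) * t ^ 4 / W ^ 4 := by
    intro ω _
    rw [le_div_iff₀ (by positivity)]
    refine ht _ ?_ fun v hv => hSK v (Finset.mem_filter.1 hv).1
    intro v hv w hw
    have h2 := (Finset.mem_filter.1 hw).2.trans (Finset.mem_filter.1 hv).2.symm
    have h3 : ∀ i, residueVec W w i = residueVec W v i := fun i => congrFun h2 i
    refine ⟨?_, ?_, ?_, ?_⟩
    · exact (ZMod.intCast_eq_intCast_iff_dvd_sub _ _ _).1 (h3 0)
    · exact (ZMod.intCast_eq_intCast_iff_dvd_sub _ _ _).1 (h3 1)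
    · exact (ZMod.intCast_eq_intCast_iff_dvd_sub _ _ _).1 (h3 2)
    · exact (ZMod.intCast_eq_intCast_iff_dvd_sub _ _ _).1 (h3 3)
  refine (Finset.sum_le_sum h1).trans (le_of_eq ?_)
  rw [Finset.sum_const, nsmul_eq_mul]
  field_simp

theorem reduced_bounds {a b c d A B C : ℝ} (hA : A = b ^ 2 - a * c) (hB : B = b * c - a * d)
    (hC : C = c ^ 2 - b * d) (hB0 : 0 ≤ B) (hBA : B ≤ A) (hAC : A ≤ C) :
    3 * (A * C) ≤ 4 * A * C - B ^ 2 ∧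
      (0 < A → b ^ 2 ≤ 2 * A ∧ c ^ 2 ≤ 2 * C ∧ C * a ^ 2 ≤ 2 * A ^ 2 ∧ A * d ^ 2 ≤ 2 * C ^ 2 ∧
        a ^ 2 ≤ 2 * A) := by
  have hA0 : 0 ≤ A := hB0.trans hBA
  have hC0 : 0 ≤ C := hA0.trans hAC
  have hB2 : B ^ 2 ≤ A * C := by nlinarith
  refine ⟨by linarith, fun hApos => ?_⟩
  have hCpos : 0 < C := hApos.trans_le hAC
  have key : ∀ x y : ℝ, C * x ^ 2 + A * y ^ 2 ≤ 2 * (C * x ^ 2 - B * (x * y) + A * y ^ 2) := by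
    intro x y
    have h1 : 0 ≤ A * (C * x ^ 2 - 2 * B * (x * y) + A * y ^ 2) := by
      have : A * (C * x ^ 2 - 2 * B * (x * y) + A * y ^ 2)
        = (A * y - B * x) ^ 2 + (A * C - B ^ 2) * x ^ 2 := by ring
      rw [this]
      have := mul_nonneg (sub_nonneg.2 hB2) (sq_nonneg x)
      positivity
    have h2 := nonneg_of_mul_nonneg_right h1 hApos
    linarith
  have i1 : C * b ^ 2 - B * (b * c) + A * c ^ 2 = A * C := by subst hA hB hC; ring
  have i2 : C * a ^ 2 - B * (a * b) + A * b ^ 2 = A ^ 2 := by subst hA hB hC; ring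
  have i3 : C * c ^ 2 - B * (c * d) + A * d ^ 2 = C ^ 2 := by subst hA hB hC; ring
  have k1 := key b c
  have k2 := key a b
  have k3 := key c d
  rw [i1] at k1
  rw [i2] at k2
  rw [i3] at k3
  have e1 : b ^ 2 ≤ 2 * A := by
    refine le_of_mul_le_mul_left ?_ hCpos
    nlinarith [mul_nonneg hA0 (sq_nonneg c)]
  have e2 : c ^ 2 ≤ 2 * C := by
    refine le_of_mul_le_mul_left ?_ hApos
    nlinarith [mul_nonneg hC0 (sq_nonneg b)]
  have e3 : C * a ^ 2 ≤ 2 * A ^ 2 := by nlinarith [mul_nonneg hA0 (sq_nonneg b)]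
  have e4 : A * d ^ 2 ≤ 2 * C ^ 2 := by nlinarith [mul_nonneg hC0 (sq_nonneg c)]
  refine ⟨e1, e2, e3, e4, ?_⟩
  refine le_of_mul_le_mul_left ?_ hApos
  nlinarith [mul_le_mul_of_nonneg_right hAC (sq_nonneg a)]

/-- Real binary cubic forms `(a, b, c, d)` with reduced Hessian, discriminant at most one and
leading coefficient at least `η`. -/
def reducedBody (η : ℝ) : Set (ℝ × ℝ × ℝ × ℝ) :=
  {v | η ≤ v.1 ∧ v.1 ^ 2 ≤ 2 * (v.2.1 ^ 2 - v.1 * v.2.2.1) ∧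
    0 ≤ v.2.1 * v.2.2.1 - v.1 * v.2.2.2 ∧
    v.2.1 * v.2.2.1 - v.1 * v.2.2.2 ≤ v.2.1 ^ 2 - v.1 * v.2.2.1 ∧
    v.2.1 ^ 2 - v.1 * v.2.2.1 ≤ v.2.2.1 ^ 2 - v.2.1 * v.2.2.2 ∧
    4 * (v.2.1 ^ 2 - v.1 * v.2.2.1) * (v.2.2.1 ^ 2 - v.2.1 * v.2.2.2)
      - (v.2.1 * v.2.2.1 - v.1 * v.2.2.2) ^ 2 ≤ 1}

theorem isClosed_reducedBody (η : ℝ) : IsClosed (reducedBody η) := by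
  unfold reducedBody
  simp only [Set.ofPred_and]
  refine IsClosed.inter ?_ (IsClosed.inter ?_ (IsClosed.inter ?_ (IsClosed.inter ?_
    (IsClosed.inter ?_ ?_)))) <;>
  exact isClosed_le (by fun_prop) (by fun_prop)

theorem isCompact_reducedBody {η : ℝ} (hη : 0 < η) : IsCompact (reducedBody η) := by
  set R : ℝ := 4 + 2 / η ^ 2 + 2 / η ^ 6 with hR
  have hη2 : 0 < 2 / η ^ 2 := by positivity
  have hη6 : 0 < 2 / η ^ 6 := by positivity
  have hcomp : IsCompact (Set.Icc (-R) R ×ˢ Set.Icc (-R) R ×ˢ Set.Icc (-R) R ×ˢ Set.Icc (-R) R) :=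
    isCompact_Icc.prod (isCompact_Icc.prod (isCompact_Icc.prod isCompact_Icc))
  refine hcomp.of_isClosed_subset (isClosed_reducedBody η) ?_
  rintro ⟨a, b, c, d⟩ ⟨h1, h2, h3, h4, h5, h6⟩
  simp only at h1 h2 h3 h4 h5 h6
  obtain ⟨k1, k2⟩ := reduced_bounds rfl rfl rfl h3 h4 h5
  set A := b ^ 2 - a * c
  set B := b * c - a * d
  set C := c ^ 2 - b * d
  have hAη : η ^ 2 / 2 ≤ A := by
    have : η ^ 2 ≤ a ^ 2 := by gcongr
    linarith
  have hA : 0 < A := lt_of_lt_of_le (by positivity) hAη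
  obtain ⟨e1, e2, e3, e4, e5⟩ := k2 hA
  have hAC : 3 * (A * C) ≤ 1 := k1.trans h6
  have hA1 : A ≤ 1 := by nlinarith
  have hC1 : C ≤ 1 / η ^ 2 := by
    rw [le_div_iff₀ (by positivity)]
    nlinarith
  have hC0 : 0 ≤ C := hA.le.trans h5
  have hd : d ^ 2 ≤ 4 / η ^ 6 := by
    have h7 : C ^ 2 ≤ (1 / η ^ 2) ^ 2 := by gcongr
    have h8 : η ^ 2 / 2 * d ^ 2 ≤ 2 * (1 / η ^ 2) ^ 2 :=
      (mul_le_mul_of_nonneg_right hAη (sq_nonneg d)).trans (e4.trans (by linarith))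
    have h9 : (4 : ℝ) / η ^ 6 = (2 * (1 / η ^ 2) ^ 2) / (η ^ 2 / 2) := by field_simp; norm_num
    rw [h9, le_div_iff₀ (by positivity)]
    linarith
  have hc : c ^ 2 ≤ 2 / η ^ 2 := by
    have : (2 : ℝ) / η ^ 2 = 2 * (1 / η ^ 2) := by ring
    linarith
  have h46 : (4 : ℝ) / η ^ 6 = 2 * (2 / η ^ 6) := by ring
  have hR4 : 4 ≤ R := by linarith
  have mem : ∀ y : ℝ, y ^ 2 ≤ R → y ∈ Set.Icc (-R) R := fun y hy => by
    have := abs_le_of_sq_le_sq' (hy.trans (by nlinarith : R ≤ R ^ 2)) (by linarith)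
    exact this
  have mem' : ∀ y : ℝ, y ^ 2 ≤ 2 * R → y ∈ Set.Icc (-R) R := fun y hy =>
    abs_le_of_sq_le_sq' (hy.trans (by nlinarith : 2 * R ≤ R ^ 2)) (by linarith)
  exact ⟨mem a (by linarith), mem b (by linarith), mem c (by linarith), mem' d (by linarith)⟩

theorem sum_rpow_neg_le {s : ℝ} (hs0 : 0 < s) (hs1 : s < 1) (N : ℕ) :
    ∑ n ∈ Finset.Icc 1 N, (n : ℝ) ^ (-s) ≤ (N : ℝ) ^ (1 - s) / (1 - s) := by
  have h1s : 0 < 1 - s := by linarith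
  induction N with
  | zero => simp [Real.zero_rpow h1s.ne']
  | succ n ih =>
    rw [Finset.sum_Icc_succ_top (by omega)]
    have hm : (0 : ℝ) < ((n + 1 : ℕ) : ℝ) := by positivity
    set m : ℝ := ((n + 1 : ℕ) : ℝ) with hmdef
    have hn : (n : ℝ) = m * (1 + -(1 / m)) := by
      field_simp; rw [hmdef]; push_cast; ring
    have h1 : -1 ≤ -(1 / m) := by
      have : 1 / m ≤ 1 := by
        rw [div_le_one hm, hmdef]; exact_mod_cast Nat.succ_le_succ (Nat.zero_le n)
      linarith
    have h2 := rpow_one_add_le_one_add_mul_self h1 h1s.le (by linarith)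
    have h3 : (n : ℝ) ^ (1 - s) ≤ m ^ (1 - s) - (1 - s) * m ^ (-s) := by
      rw [hn, Real.mul_rpow hm.le (by linarith)]
      have h4 : m ^ (-s) = m ^ (1 - s) * (1 / m) := by
        rw [show -s = (1 - s) - 1 by ring, Real.rpow_sub_one hm.ne']; ring
      rw [h4]
      calc m ^ (1 - s) * (1 + -(1 / m)) ^ (1 - s)
          ≤ m ^ (1 - s) * (1 + (1 - s) * -(1 / m)) := by gcongr
        _ = _ := by ring
    calc ∑ k ∈ Finset.Icc 1 n, (k : ℝ) ^ (-s) + m ^ (-s)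
        ≤ (n : ℝ) ^ (1 - s) / (1 - s) + m ^ (-s) := by gcongr
      _ ≤ (m ^ (1 - s) - (1 - s) * m ^ (-s)) / (1 - s) + m ^ (-s) := by gcongr
      _ = m ^ (1 - s) / (1 - s) := by field_simp; ring

theorem sum_rpow_neg_floor_le {s : ℝ} (hs0 : 0 < s) (hs1 : s < 1) {Y : ℝ} (hY : 0 ≤ Y) :
    ∑ n ∈ Finset.Icc 1 ⌊Y⌋₊, (n : ℝ) ^ (-s) ≤ Y ^ (1 - s) / (1 - s) := by
  have h1s : 0 < 1 - s := by linarith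
  refine (sum_rpow_neg_le hs0 hs1 _).trans ?_
  gcongr
  exact Nat.floor_le hY

theorem card_le_of_forall_sub_le {D : Finset ℤ} {L : ℝ} (hL : 0 ≤ L)
    (h : ∀ d ∈ D, ∀ e ∈ D, (d : ℝ) - e ≤ L) : (D.card : ℝ) ≤ L + 1 := by
  rcases D.eq_empty_or_nonempty with rfl | hD
  · simp; linarith
  · have hsub : D ⊆ Finset.Icc (D.min' hD) (D.max' hD) := fun d hd =>
      Finset.mem_Icc.2 ⟨D.min'_le d hd, D.le_max' d hd⟩
    have h1 := Finset.card_le_card hsub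
    rw [Int.card_Icc] at h1
    have h2 := h _ (D.max'_mem hD) _ (D.min'_mem hD)
    have h3 : D.min' hD ≤ D.max' hD := D.min'_le _ (D.max'_mem hD)
    have h4 : ((D.max' hD + 1 - D.min' hD).toNat : ℤ) = D.max' hD + 1 - D.min' hD :=
      Int.toNat_of_nonneg (by omega)
    have h5 : (D.card : ℤ) ≤ D.max' hD + 1 - D.min' hD := by
      rw [← h4]; exact_mod_cast h1
    have h6 : (D.card : ℝ) ≤ D.max' hD + 1 - D.min' hD := by exact_mod_cast h5
    linarith

/-- An integral binary cubic form with reduced Hessian, positive leading coefficient and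
discriminant in `(-x, 0)`. -/
def IsReducedForm (x : ℝ) (v : ℤ × ℤ × ℤ × ℤ) : Prop :=
  0 < v.1 ∧ 0 ≤ v.2.1 * v.2.2.1 - v.1 * v.2.2.2 ∧
    v.2.1 * v.2.2.1 - v.1 * v.2.2.2 ≤ v.2.1 ^ 2 - v.1 * v.2.2.1 ∧
    v.2.1 ^ 2 - v.1 * v.2.2.1 ≤ v.2.2.1 ^ 2 - v.2.1 * v.2.2.2 ∧
    0 < v.2.1 ^ 2 - v.1 * v.2.2.1 ∧
    ((4 * (v.2.1 ^ 2 - v.1 * v.2.2.1) * (v.2.2.1 ^ 2 - v.2.1 * v.2.2.2)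
      - (v.2.1 * v.2.2.1 - v.1 * v.2.2.2) ^ 2 : ℤ) : ℝ) ≤ x

theorem reduced_aux_bounds {a b c d A B C x : ℝ} (ha : 1 ≤ a) (hA : A = b ^ 2 - a * c)
    (hB : B = b * c - a * d) (hC : C = c ^ 2 - b * d) (hB0 : 0 ≤ B) (hBA : B ≤ A) (hAC : A ≤ C)
    (hA1 : 1 ≤ A) (hx : 4 * A * C - B ^ 2 ≤ x) :
    a ≤ 2 * A ∧ (|b| + 1) ^ 2 ≤ 6 * A ∧ ((|b| + 1) * (|c| + 1)) ^ 2 ≤ 16 * x ∧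
      a * (|c| + 1) ^ 3 ≤ 16 * x ∧ 3 * A ^ 2 ≤ x ∧ 9 * A ^ 3 * d ^ 2 ≤ 2 * x ^ 2 := by
  obtain ⟨k1, k2⟩ := reduced_bounds hA hB hC hB0 hBA hAC
  obtain ⟨e1, e2, e3, e4, e5⟩ := k2 (by linarith)
  have hxAC : 3 * (A * C) ≤ x := k1.trans hx
  clear hB hC k1 k2 hx hB0 hBA
  have hC1 : 1 ≤ C := hA1.trans hAC
  have haγ : a * |c| ≤ A := by
    have : a * |c| = |a * c| := by rw [abs_mul, abs_of_nonneg (by linarith : 0 ≤ a)]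
    rw [this, abs_le]
    constructor <;> nlinarith [sq_nonneg b]
  have nb := abs_nonneg b
  have nc := abs_nonneg c
  rw [← sq_abs b] at e1
  rw [← sq_abs c] at e2
  clear hA
  generalize |b| = β at *
  generalize |c| = γ at *
  have hu : (β + 1) ^ 2 ≤ 6 * A := by nlinarith [sq_nonneg (β - 1)]
  have hw : (γ + 1) ^ 2 ≤ 6 * C := by nlinarith [sq_nonneg (γ - 1)]
  have ha2 : a ≤ 2 * A := by nlinarith
  have hAA : A ^ 2 ≤ A * C := by nlinarith
  have hAC0 : 0 ≤ A * C := by positivity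
  refine ⟨ha2, hu, ?_, ?_, by linarith, ?_⟩
  · have h1 : (β + 1) ^ 2 * (γ + 1) ^ 2 ≤ (6 * A) * (6 * C) :=
      mul_le_mul hu hw (sq_nonneg _) (by linarith)
    rw [mul_pow]
    linarith
  · have h1 : (a * γ + a) * (γ + 1) ^ 2 ≤ (3 * A) * (6 * C) :=
      mul_le_mul (by linarith) hw (sq_nonneg _) (by linarith)
    have h2 : a * (γ + 1) ^ 3 = (a * γ + a) * (γ + 1) ^ 2 := by ring
    rw [h2]
    linarith
  · have h1 : 9 * A ^ 2 * (A * d ^ 2) ≤ 9 * A ^ 2 * (2 * C ^ 2) :=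
      mul_le_mul_of_nonneg_left e4 (by positivity)
    have h2 : (3 * (A * C)) ^ 2 ≤ x ^ 2 :=
      pow_le_pow_left₀ (by nlinarith) hxAC 2
    linarith

theorem IsReducedForm.bounds {x : ℝ} {a b c d : ℤ} (h : IsReducedForm x (a, b, c, d)) :
    (1 : ℝ) ≤ a ∧ (1 : ℝ) ≤ b ^ 2 - a * c ∧ (0 : ℝ) ≤ b * c - a * d ∧
      (b : ℝ) * c - a * d ≤ b ^ 2 - a * c ∧ (a : ℝ) ≤ 2 * (b ^ 2 - a * c) ∧
      (|(b : ℝ)| + 1) ^ 2 ≤ 6 * (b ^ 2 - a * c) ∧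
      ((|(b : ℝ)| + 1) * (|(c : ℝ)| + 1)) ^ 2 ≤ 16 * x ∧
      (a : ℝ) * (|(c : ℝ)| + 1) ^ 3 ≤ 16 * x ∧
      3 * ((b : ℝ) ^ 2 - a * c) ^ 2 ≤ x ∧
      9 * ((b : ℝ) ^ 2 - a * c) ^ 3 * (d : ℝ) ^ 2 ≤ 2 * x ^ 2 := by
  obtain ⟨h1, h2, h3, h4, h5, h6⟩ := h
  dsimp only at h1 h2 h3 h4 h5 h6
  have g1 : (1 : ℝ) ≤ a := by exact_mod_cast h1
  have g2 : (0 : ℝ) ≤ b * c - a * d := by exact_mod_cast h2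
  have g3 : (b : ℝ) * c - a * d ≤ b ^ 2 - a * c := by exact_mod_cast h3
  have g4 : (b : ℝ) ^ 2 - a * c ≤ c ^ 2 - b * d := by exact_mod_cast h4
  have g5 : (1 : ℝ) ≤ b ^ 2 - a * c := by exact_mod_cast h5
  push_cast at h6
  exact ⟨g1, g5, g2, g3, reduced_aux_bounds g1 rfl rfl rfl g2 g3 g4 g5 h6⟩

theorem card_reduced_fiber_le {x : ℝ} (hx : 1 ≤ x) {a b c : ℤ} {S : Finset (ℤ × ℤ × ℤ × ℤ)}
    (hS : ∀ v ∈ S, IsReducedForm x v) (hS' : ∀ v ∈ S, v.1 = a ∧ v.2.1 = b ∧ v.2.2.1 = c)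
    (hne : S.Nonempty) :
    (S.card : ℝ) ^ 2 * (a * (|(b : ℝ)| + 1)) ≤ 16 * x := by
  obtain ⟨⟨a₀, b₀, c₀, d₀⟩, hv₀⟩ := hne
  obtain ⟨rfl, rfl, rfl⟩ := hS' _ hv₀
  dsimp only
  obtain ⟨g1, g2, -, -, g3, g4, -, -, g7, -⟩ := (hS _ hv₀).bounds
  have hall : ∀ v ∈ S, (a₀, b₀, c₀, v.2.2.2) = v := by
    rintro ⟨a, b, c, d⟩ hv
    obtain ⟨h1, h2, h3⟩ := hS' _ hv
    simp only at h1 h2 h3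
    rw [h1, h2, h3]
  have hmem : ∀ d : ℤ, d ∈ S.image (fun v : ℤ × ℤ × ℤ × ℤ => v.2.2.2) →
      IsReducedForm x (a₀, b₀, c₀, d) := by
    intro d hd
    obtain ⟨v, hv, rfl⟩ := Finset.mem_image.1 hd
    rw [hall v hv]; exact hS v hv
  have hcard : (S.image fun v : ℤ × ℤ × ℤ × ℤ => v.2.2.2).card = S.card :=
    Finset.card_image_of_injOn fun v hv w hw hvw => by
      rw [← hall v hv, ← hall w hw]
      have hvw' : v.2.2.2 = w.2.2.2 := hvw
      rw [hvw']
  set A : ℝ := (b₀ : ℝ) ^ 2 - a₀ * c₀ with hA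
  set u : ℝ := |(b₀ : ℝ)| + 1 with hu
  have hu1 : 1 ≤ u := by
    have := abs_nonneg (b₀ : ℝ)
    linarith
  have n1 : (S.card : ℝ) ≤ A / a₀ + 1 := by
    rw [← hcard]
    refine card_le_of_forall_sub_le (by positivity) fun d hd e he => ?_
    obtain ⟨-, -, i1, i2, -⟩ := (hmem d hd).bounds
    obtain ⟨-, -, j1, j2, -⟩ := (hmem e he).bounds
    rw [le_div_iff₀ (by linarith)]
    nlinarith
  have n1' : (S.card : ℝ) * a₀ ≤ 3 * A := by
    have : A / a₀ * a₀ = A := div_mul_cancel₀ _ (by linarith)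
    nlinarith
  have hA3 : A ^ 3 ≤ x ^ 2 := by
    have h1 : A ^ 3 ≤ (A ^ 2) ^ 2 := by
      nlinarith [sq_nonneg A, mul_nonneg (by linarith : 0 ≤ A) (sq_nonneg A)]
    have h2 : (A ^ 2) ^ 2 ≤ x ^ 2 := by gcongr; nlinarith
    linarith
  have hApos : 0 < A ^ 3 := by positivity
  set r : ℝ := Real.sqrt (x ^ 2 / A ^ 3) with hr
  have hr2 : r ^ 2 = x ^ 2 / A ^ 3 := Real.sq_sqrt (by positivity)
  have hr1 : 1 ≤ r := by
    rw [hr, Real.one_le_sqrt, le_div_iff₀ hApos]; linarith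
  have n2 : (S.card : ℝ) ≤ r + 1 := by
    rw [← hcard]
    refine card_le_of_forall_sub_le (by linarith) fun d hd e he => ?_
    have bd : ∀ d : ℤ, d ∈ S.image (fun v : ℤ × ℤ × ℤ × ℤ => v.2.2.2) → |(d : ℝ)| ≤ r / 2 := by
      intro d hd
      obtain ⟨-, -, -, -, -, -, -, -, -, i⟩ := (hmem d hd).bounds
      apply abs_le_of_sq_le_sq _ (by linarith)
      rw [div_pow, hr2, div_div, le_div_iff₀ (by positivity)]
      nlinarith [mul_nonneg hApos.le (sq_nonneg (d : ℝ))]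
    have h1 := abs_le.1 (bd d hd)
    have h2 := abs_le.1 (bd e he)
    linarith
  have n2' : (S.card : ℝ) ^ 2 * A ^ 3 ≤ 4 * x ^ 2 := by
    have h1 : (S.card : ℝ) ^ 2 ≤ (2 * r) ^ 2 := by gcongr; linarith
    rw [mul_pow, hr2] at h1
    calc (S.card : ℝ) ^ 2 * A ^ 3 ≤ 2 ^ 2 * (x ^ 2 / A ^ 3) * A ^ 3 := by gcongr
      _ = 4 * x ^ 2 := by field_simp; norm_num
  set n : ℝ := (S.card : ℝ)
  have hn : 0 ≤ n := Nat.cast_nonneg _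
  have h1 : (n * a₀) ^ 2 ≤ (3 * A) ^ 2 := by gcongr
  have h2 : (n ^ 2 * (a₀ * u)) ^ 2 * A ^ 3 ≤ (16 * x) ^ 2 * A ^ 3 := by
    calc (n ^ 2 * (a₀ * u)) ^ 2 * A ^ 3 = (n ^ 2 * A ^ 3) * (n * a₀) ^ 2 * u ^ 2 := by ring
      _ ≤ (4 * x ^ 2) * (3 * A) ^ 2 * (6 * A) := by gcongr
      _ = 216 * x ^ 2 * A ^ 3 := by ring
      _ ≤ (16 * x) ^ 2 * A ^ 3 := by gcongr; nlinarith
  exact abs_le_of_sq_le_sq (le_of_mul_le_mul_right h2 hApos) (by linarith) |>.trans' (le_abs_self _)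

theorem sum_cusp_le {y N : ℝ} (hy : 0 < y) (hN : 0 ≤ N) :
    ∑ a ∈ Finset.Icc 1 ⌊N⌋₊, ∑ w ∈ Finset.Icc 1 ⌊(y / a) ^ (1 / 3 : ℝ)⌋₊,
      ∑ u ∈ Finset.Icc 1 ⌊y ^ (1 / 2 : ℝ) / w⌋₊,
        y ^ (1 / 2 : ℝ) * (a : ℝ) ^ (-(1 / 2) : ℝ) * (u : ℝ) ^ (-(1 / 2) : ℝ) ≤
      12 * y ^ (11 / 12 : ℝ) * N ^ (1 / 3 : ℝ) := by
  have hu : ∀ a ∈ Finset.Icc 1 ⌊N⌋₊, ∀ w ∈ Finset.Icc 1 ⌊(y / (a : ℕ)) ^ (1 / 3 : ℝ)⌋₊,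
      ∑ u ∈ Finset.Icc 1 ⌊y ^ (1 / 2 : ℝ) / w⌋₊,
        y ^ (1 / 2 : ℝ) * (a : ℝ) ^ (-(1 / 2) : ℝ) * (u : ℝ) ^ (-(1 / 2) : ℝ) ≤
      2 * y ^ (3 / 4 : ℝ) * (a : ℝ) ^ (-(1 / 2) : ℝ) * (w : ℝ) ^ (-(1 / 2) : ℝ) := by
    intro a ha w hw
    rw [← Finset.mul_sum]
    have hY : (0 : ℝ) ≤ y ^ (1 / 2 : ℝ) / w := by positivity
    have h1 := sum_rpow_neg_floor_le (s := 1 / 2) (by norm_num) (by norm_num) hY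
    have h2 : (y ^ (1 / 2 : ℝ) / (w : ℝ)) ^ (1 - 1 / 2 : ℝ)
        = y ^ (1 / 4 : ℝ) * (w : ℝ) ^ (-(1 / 2) : ℝ) := by
      rw [Real.div_rpow (by positivity) (by positivity), ← Real.rpow_mul hy.le,
        Real.rpow_neg (by positivity), div_eq_mul_inv]
      norm_num
    have h3 : y ^ (3 / 4 : ℝ) = y ^ (1 / 2 : ℝ) * y ^ (1 / 4 : ℝ) := by
      rw [← Real.rpow_add hy]; norm_num
    rw [h2] at h1
    calc _ ≤ y ^ (1 / 2 : ℝ) * (a : ℝ) ^ (-(1 / 2) : ℝ) *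
          (y ^ (1 / 4 : ℝ) * (w : ℝ) ^ (-(1 / 2) : ℝ) / (1 - 1 / 2)) := by gcongr
      _ = _ := by rw [h3]; ring
  have hw : ∀ a ∈ Finset.Icc 1 ⌊N⌋₊,
      ∑ w ∈ Finset.Icc 1 ⌊(y / (a : ℕ)) ^ (1 / 3 : ℝ)⌋₊,
        2 * y ^ (3 / 4 : ℝ) * (a : ℝ) ^ (-(1 / 2) : ℝ) * (w : ℝ) ^ (-(1 / 2) : ℝ) ≤
      4 * y ^ (11 / 12 : ℝ) * (a : ℝ) ^ (-(2 / 3) : ℝ) := by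
    intro a ha
    have ha0 : (0 : ℝ) < a := by
      have := (Finset.mem_Icc.1 ha).1
      exact_mod_cast this
    rw [← Finset.mul_sum]
    have hY : (0 : ℝ) ≤ (y / a) ^ (1 / 3 : ℝ) := by positivity
    have h1 := sum_rpow_neg_floor_le (s := 1 / 2) (by norm_num) (by norm_num) hY
    have h2 : ((y / a) ^ (1 / 3 : ℝ)) ^ (1 - 1 / 2 : ℝ)
        = y ^ (1 / 6 : ℝ) * (a : ℝ) ^ (-(1 / 6) : ℝ) := by
      rw [← Real.rpow_mul (by positivity), Real.div_rpow hy.le ha0.le, Real.rpow_neg ha0.le,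
        div_eq_mul_inv]
      norm_num
    have h3 : y ^ (11 / 12 : ℝ) = y ^ (3 / 4 : ℝ) * y ^ (1 / 6 : ℝ) := by
      rw [← Real.rpow_add hy]; norm_num
    have h4 : (a : ℝ) ^ (-(2 / 3) : ℝ) = (a : ℝ) ^ (-(1 / 2) : ℝ) * (a : ℝ) ^ (-(1 / 6) : ℝ) := by
      rw [← Real.rpow_add ha0]; norm_num
    rw [h2] at h1
    calc _ ≤ 2 * y ^ (3 / 4 : ℝ) * (a : ℝ) ^ (-(1 / 2) : ℝ) *
          (y ^ (1 / 6 : ℝ) * (a : ℝ) ^ (-(1 / 6) : ℝ) / (1 - 1 / 2)) := by gcongr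
      _ = _ := by rw [h3, h4]; ring
  calc _ ≤ ∑ a ∈ Finset.Icc 1 ⌊N⌋₊, ∑ w ∈ Finset.Icc 1 ⌊(y / (a : ℕ)) ^ (1 / 3 : ℝ)⌋₊,
        2 * y ^ (3 / 4 : ℝ) * (a : ℝ) ^ (-(1 / 2) : ℝ) * (w : ℝ) ^ (-(1 / 2) : ℝ) :=
        Finset.sum_le_sum fun a ha => Finset.sum_le_sum fun w hw' => hu a ha w hw'
    _ ≤ ∑ a ∈ Finset.Icc 1 ⌊N⌋₊, 4 * y ^ (11 / 12 : ℝ) * (a : ℝ) ^ (-(2 / 3) : ℝ) :=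
        Finset.sum_le_sum hw
    _ = 4 * y ^ (11 / 12 : ℝ) * ∑ a ∈ Finset.Icc 1 ⌊N⌋₊, (a : ℝ) ^ (-(2 / 3) : ℝ) := by
        rw [Finset.mul_sum]
    _ ≤ 4 * y ^ (11 / 12 : ℝ) * (N ^ (1 - 2 / 3 : ℝ) / (1 - 2 / 3)) := by
        gcongr
        exact sum_rpow_neg_floor_le (by norm_num) (by norm_num) hN
    _ = _ := by norm_num; ring

/-- The leading coefficient, the sizes of the third and second coefficients, and the signs of the
latter two. -/
def cuspKey (v : ℤ × ℤ × ℤ × ℤ) : (_ : ℕ) × (_ : ℕ) × ℕ × Bool × Bool :=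
  ⟨v.1.natAbs, v.2.2.1.natAbs + 1, v.2.1.natAbs + 1, decide (0 ≤ v.2.1), decide (0 ≤ v.2.2.1)⟩

theorem card_cusp_le {x N : ℝ} (hx : 1 ≤ x) (hN : 0 ≤ N) {S : Finset (ℤ × ℤ × ℤ × ℤ)}
    (hS : ∀ v ∈ S, IsReducedForm x v) (hSN : ∀ v ∈ S, (v.1 : ℝ) ≤ N) :
    (S.card : ℝ) ≤ 48 * (16 * x) ^ (11 / 12 : ℝ) * N ^ (1 / 3 : ℝ) := by
  set y : ℝ := 16 * x with hy
  have hy0 : 0 < y := by linarith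
  set T : Finset ((_ : ℕ) × (_ : ℕ) × ℕ × Bool × Bool) :=
    (Finset.Icc 1 ⌊N⌋₊).sigma fun a => (Finset.Icc 1 ⌊(y / a) ^ (1 / 3 : ℝ)⌋₊).sigma fun w =>
      Finset.Icc 1 ⌊y ^ (1 / 2 : ℝ) / w⌋₊ ×ˢ Finset.univ with hT
  have cb : ∀ z : ℤ, ((z.natAbs + 1 : ℕ) : ℝ) = |(z : ℝ)| + 1 := fun z => by
    push_cast
    rw [Nat.cast_natAbs, Int.cast_abs]
  have hmaps : Set.MapsTo cuspKey (S : Set (ℤ × ℤ × ℤ × ℤ)) (T : Set _) := by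
    rintro ⟨a, b, c, d⟩ hv
    obtain ⟨g1, -, -, -, -, -, g5, g6, -, -⟩ := (hS _ hv).bounds
    have hpos : 0 < a := (hS _ hv).1
    have haN : (a : ℝ) ≤ N := hSN _ hv
    have ca : ((a.natAbs : ℕ) : ℝ) = a := by
      rw [Nat.cast_natAbs, Int.cast_abs, abs_of_nonneg (by linarith)]
    have hw1 : (0 : ℝ) < |(c : ℝ)| + 1 := by positivity
    have hu1 : (0 : ℝ) < |(b : ℝ)| + 1 := by positivity
    simp only [cuspKey, hT, Finset.coe_sigma, Set.mem_sigma_iff, Finset.coe_Icc, Set.mem_Icc,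
      Finset.coe_product, Set.mem_prod, Finset.coe_univ, Set.mem_univ, and_true]
    refine ⟨⟨by omega, Nat.le_floor (by rw [ca]; exact haN)⟩, ⟨by omega, Nat.le_floor ?_⟩,
      by omega, Nat.le_floor ?_⟩
    · rw [cb, ca, one_div, Real.le_rpow_inv_iff_of_pos hw1.le (by positivity) (by norm_num),
        le_div_iff₀ (by linarith)]
      have h3 : (|(c : ℝ)| + 1) ^ (3 : ℝ) = (|(c : ℝ)| + 1) ^ 3 := by norm_cast
      rw [h3]
      linarith
    · rw [cb, cb, le_div_iff₀ hw1, ← Real.sqrt_eq_rpow]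
      exact Real.le_sqrt_of_sq_le g5
  have hfib : ∀ k ∈ T, ((S.filter fun v => cuspKey v = k).card : ℝ) ≤
      y ^ (1 / 2 : ℝ) * (k.1 : ℝ) ^ (-(1 / 2) : ℝ) * (k.2.2.1 : ℝ) ^ (-(1 / 2) : ℝ) := by
    intro k _
    rcases (S.filter fun v => cuspKey v = k).eq_empty_or_nonempty with h0 | hne
    · rw [h0]; simp only [Finset.card_empty, Nat.cast_zero]; positivity
    obtain ⟨⟨a, b, c, d⟩, hv⟩ := id hne
    obtain ⟨hvS, rfl⟩ := Finset.mem_filter.1 hv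
    have hpos : 0 < a := (hS _ hvS).1
    have ca : ((a.natAbs : ℕ) : ℝ) = a := by
      rw [Nat.cast_natAbs, Int.cast_abs, abs_of_nonneg (by exact_mod_cast hpos.le)]
    have h1 := card_reduced_fiber_le hx (a := a) (b := b) (c := c)
      (S := S.filter fun v => cuspKey v = cuspKey (a, b, c, d))
      (fun v hv => hS v (Finset.mem_filter.1 hv).1) ?_ hne
    · have ha0 : (0 : ℝ) < a := by exact_mod_cast hpos
      have hu1 : (0 : ℝ) < |(b : ℝ)| + 1 := by positivity
      simp only [cuspKey]
      rw [cb, ca]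
      rw [Real.rpow_neg ha0.le, Real.rpow_neg hu1.le, mul_assoc, ← mul_inv,
        ← Real.mul_rpow ha0.le hu1.le, ← div_eq_mul_inv, ← Real.div_rpow hy0.le (by positivity),
        ← Real.sqrt_eq_rpow]
      refine Real.le_sqrt_of_sq_le ?_
      rw [le_div_iff₀ (by positivity)]
      exact h1
    · rintro ⟨a', b', c', d'⟩ hv'
      obtain ⟨hvS', he⟩ := Finset.mem_filter.1 hv'
      have hpos' : 0 < a' := (hS _ hvS').1
      simp only [cuspKey, Sigma.mk.injEq, heq_eq_eq, Prod.mk.injEq, decide_eq_decide] at he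
      obtain ⟨e1, e2, e3, e4, e5⟩ := he
      dsimp only
      omega
  rw [Finset.card_eq_sum_card_fiberwise hmaps]
  push_cast
  refine (Finset.sum_le_sum hfib).trans ?_
  rw [hT, Finset.sum_sigma]
  simp only [Finset.sum_sigma, Finset.sum_product, Finset.sum_const, Finset.card_univ,
    Fintype.card_prod, Fintype.card_bool, nsmul_eq_mul, ← Finset.mul_sum]
  have := sum_cusp_le hy0 hN
  simp only [← Finset.mul_sum] at this
  have h4 := mul_le_mul_of_nonneg_left this (by norm_num : (0 : ℝ) ≤ 4)
  rw [Finset.mul_sum] at h4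
  refine (le_of_eq (Finset.sum_congr rfl fun _ _ => ?_)).trans (h4.trans (by linarith))
  push_cast
  ring

theorem IsReducedForm.div_mem_reducedBody {t η : ℝ} (ht : 0 < t) {v : ℤ × ℤ × ℤ × ℤ}
    (h : IsReducedForm (t ^ 4) v) (hη : η * t ≤ v.1) :
    ((v.1 : ℝ) / t, (v.2.1 : ℝ) / t, (v.2.2.1 : ℝ) / t, (v.2.2.2 : ℝ) / t) ∈ reducedBody η := by
  obtain ⟨a, b, c, d⟩ := v
  obtain ⟨h1, h2, h3, h4, h5, h6⟩ := h
  dsimp only at h1 h2 h3 h4 h5 h6 hη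
  have g2 : (0 : ℝ) ≤ b * c - a * d := by exact_mod_cast h2
  have g3 : (b : ℝ) * c - a * d ≤ b ^ 2 - a * c := by exact_mod_cast h3
  have g4 : (b : ℝ) ^ 2 - a * c ≤ c ^ 2 - b * d := by exact_mod_cast h4
  have g5 : (0 : ℝ) < b ^ 2 - a * c := by exact_mod_cast h5
  push_cast at h6
  obtain ⟨-, -, -, -, e5⟩ := (reduced_bounds rfl rfl rfl g2 g3 g4).2 g5
  have iA : ((b : ℝ) / t) ^ 2 - a / t * (c / t) = (b ^ 2 - a * c) / t ^ 2 := by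
    field_simp
  have iB : (b : ℝ) / t * (c / t) - a / t * (d / t) = (b * c - a * d) / t ^ 2 := by
    field_simp
  have iC : ((c : ℝ) / t) ^ 2 - b / t * (d / t) = (c ^ 2 - b * d) / t ^ 2 := by
    field_simp
  have ht2 : 0 < t ^ 2 := by positivity
  refine ⟨?_, ?_, ?_, ?_, ?_, ?_⟩ <;> dsimp only
  · rwa [le_div_iff₀ ht]
  · rw [iA, div_pow, mul_div_assoc']
    exact div_le_div_of_nonneg_right e5 ht2.le
  · rw [iB]; exact div_nonneg g2 ht2.le
  · rw [iB, iA]; exact div_le_div_of_nonneg_right g3 ht2.le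
  · rw [iA, iC]; exact div_le_div_of_nonneg_right g4 ht2.le
  · rw [iA, iB, iC]
    have : 4 * (((b : ℝ) ^ 2 - a * c) / t ^ 2) * ((c ^ 2 - b * d) / t ^ 2) -
        ((b * c - a * d) / t ^ 2) ^ 2 =
        (4 * (b ^ 2 - a * c) * (c ^ 2 - b * d) - (b * c - a * d) ^ 2) / t ^ 4 := by
      field_simp
    rw [this, div_le_one (by positivity)]
    exact h6

theorem eventually_card_isReducedForm_le {V ε : ℝ}
    (hV : ∀ η, 0 < η → MeasureTheory.volume.real (reducedBody η) ≤ V) {W : ℕ} (hW : 0 < W)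
    (Ω : Finset (Fin 4 → ZMod W)) (hε : 0 < ε) :
    ∀ᶠ x : ℝ in atTop, ∀ S : Finset (ℤ × ℤ × ℤ × ℤ), (∀ v ∈ S, IsReducedForm x v) →
      (∀ v ∈ S, residueVec W v ∈ Ω) →
      (S.card : ℝ) ≤ ((Ω.card : ℝ) / (W : ℝ) ^ 4 * V + ε) * x := by
  set K : ℝ := 48 * (16 : ℝ) ^ (11 / 12 : ℝ) with hK
  have hK0 : 0 < K := by positivity
  set η : ℝ := (ε / (2 * K)) ^ 3 with hηdef
  have hη : 0 < η := by positivity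
  have hη3 : K * η ^ (1 / 3 : ℝ) = ε / 2 := by
    rw [hηdef, ← Real.rpow_natCast, ← Real.rpow_mul (by positivity)]
    norm_num
    field_simp
  set ρ : ℝ := (Ω.card : ℝ) / (W : ℝ) ^ 4 with hρ
  have hρ0 : 0 ≤ ρ := by positivity
  set ε' : ℝ := ε / (2 * (ρ + 1)) with hε'
  have hε'0 : 0 < ε' := by positivity
  have hρε : ρ * ε' ≤ ε / 2 := by
    rw [hε', mul_div_assoc', div_le_div_iff₀ (by positivity) (by norm_num)]
    nlinarith
  have key := (tendsto_rpow_atTop (by norm_num : (0 : ℝ) < 1 / 4)).eventually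
    (eventually_card_lattice_residues_le (isCompact_reducedBody hη) hW Ω hε'0)
  filter_upwards [key, eventually_ge_atTop 1] with x hxkey hx1 S hS hSΩ
  have hx0 : 0 < x := by linarith
  set t : ℝ := x ^ (1 / 4 : ℝ) with ht
  have ht0 : 0 < t := by positivity
  have ht4 : t ^ 4 = x := by
    rw [ht, ← Real.rpow_natCast, ← Real.rpow_mul hx0.le]
    norm_num
  rw [← Finset.card_filter_add_card_filter_not (s := S) (fun v => η * t ≤ (v.1 : ℝ))]
  push_cast
  have b1 := hxkey (S.filter fun v => η * t ≤ (v.1 : ℝ))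
    (fun v hv => hSΩ v (Finset.mem_filter.1 hv).1) fun v hv =>
      IsReducedForm.div_mem_reducedBody ht0
        (by rw [ht4]; exact hS v (Finset.mem_filter.1 hv).1) (Finset.mem_filter.1 hv).2
  have b2 := card_cusp_le hx1 (by positivity : 0 ≤ η * t)
    (S := S.filter fun v => ¬ η * t ≤ (v.1 : ℝ))
    (fun v hv => hS v (Finset.mem_filter.1 hv).1)
    (fun v hv => (not_le.1 (Finset.mem_filter.1 hv).2).le)
  have b3 : 48 * (16 * x) ^ (11 / 12 : ℝ) * (η * t) ^ (1 / 3 : ℝ) = ε / 2 * x := by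
    rw [← hη3, Real.mul_rpow (by norm_num) hx0.le, Real.mul_rpow hη.le ht0.le, ht,
      ← Real.rpow_mul hx0.le]
    have : x = x ^ (11 / 12 : ℝ) * x ^ (1 / 4 * (1 / 3) : ℝ) := by
      rw [← Real.rpow_add hx0]; norm_num
    calc _ = K * η ^ (1 / 3 : ℝ) * (x ^ (11 / 12 : ℝ) * x ^ (1 / 4 * (1 / 3) : ℝ)) := by
          rw [hK]; ring
      _ = _ := by rw [← this]
  rw [b3] at b2
  rw [ht4] at b1
  have b4 : ρ * (MeasureTheory.volume.real (reducedBody η) + ε') * x ≤ (ρ * V + ε / 2) * x := by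
    have : ρ * MeasureTheory.volume.real (reducedBody η) ≤ ρ * V := by
      gcongr
      exact hV η hη
    gcongr
    linarith
  linarith

open MeasureTheory in
theorem lintegral_comp_affine (f : ℝ → ENNReal) {k : ℝ} (hk : k ≠ 0) (e : ℝ) :
    ∫⁻ x, f (e + k * x) = ENNReal.ofReal |k⁻¹| * ∫⁻ x, f x := by
  have h1 : ∫⁻ x, f (e + x) ∂(Measure.map (k * ·) volume) = ∫⁻ x, f (e + k * x) :=
    (Homeomorph.mulLeft₀ k hk).measurableEmbedding.lintegral_map _
  rw [← h1, Real.map_volume_mul_left hk, lintegral_smul_measure, lintegral_add_left_eq_self,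
    smul_eq_mul]

open MeasureTheory in
theorem lintegral_Icc_of_hasDerivAt {f f' : ℝ → ℝ} {a b : ℝ} (hab : a ≤ b)
    (hf : ContinuousOn f (Set.Icc a b)) (hf' : ∀ x ∈ Set.Ioo a b, HasDerivAt f (f' x) x)
    (h0 : ∀ x ∈ Set.Ioo a b, 0 ≤ f' x) :
    ∫⁻ x in Set.Icc a b, ENNReal.ofReal (f' x) = ENNReal.ofReal (f b - f a) := by
  have hinteg := intervalIntegral.integrableOn_deriv_of_nonneg hf hf' h0
  have hinteg' : IntegrableOn f' (Set.Ioo a b) := hinteg.mono_set Set.Ioo_subset_Ioc_self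
  rw [← setLIntegral_congr (Ioo_ae_eq_Icc (μ := volume) (a := a) (b := b)),
    ← ofReal_integral_eq_lintegral_ofReal hinteg'
      ((ae_restrict_iff' measurableSet_Ioo).2 (Eventually.of_forall h0)),
    ← integral_Ioc_eq_integral_Ioo, ← intervalIntegral.integral_of_le hab,
    intervalIntegral.integral_eq_sub_of_hasDerivAt_of_le hab hf hf'
      ((intervalIntegrable_iff_integrableOn_Ioc_of_le hab).2 hinteg)]

theorem hasDerivAt_arcsin_div {R x : ℝ} (hR : 0 < R) (hx : x ^ 2 < R ^ 2) :
    HasDerivAt (fun x => Real.arcsin (x / R)) (1 / Real.sqrt (R ^ 2 - x ^ 2)) x := by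
  have hx' := abs_lt_of_sq_lt_sq' hx hR.le
  have h1 : x / R ≠ -1 := by
    intro h; rw [div_eq_iff hR.ne'] at h; linarith
  have h2 : x / R ≠ 1 := by
    intro h; rw [div_eq_iff hR.ne'] at h; linarith
  have h := (Real.hasDerivAt_arcsin h1 h2).comp x ((hasDerivAt_id x).div_const R)
  refine h.congr_deriv ?_
  have h3 : R ^ 2 - x ^ 2 = R ^ 2 * (1 - (x / R) ^ 2) := by field_simp
  rw [h3, Real.sqrt_mul (sq_nonneg R), Real.sqrt_sq hR.le]
  field_simp

theorem lintegral_Icc_inv_sq {u v : ℝ} (hu : 0 < u) (huv : u ≤ v) :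
    ∫⁻ x in Set.Icc u v, ENNReal.ofReal (x ^ 2)⁻¹ = ENNReal.ofReal (u⁻¹ - v⁻¹) := by
  have h := lintegral_Icc_of_hasDerivAt (f := fun x => -x⁻¹) (f' := fun x => (x ^ 2)⁻¹) huv ?_ ?_ ?_
  · rw [h]; congr 1; ring
  · exact (continuousOn_inv₀.mono fun x hx => (hu.trans_le hx.1).ne').neg
  · intro x hx
    exact (hasDerivAt_inv (hu.trans hx.1).ne').neg.congr_deriv (neg_neg _)
  · intro x hx; positivity

theorem lintegral_Icc_inv_sqrt_sub_sq {R u v : ℝ} (hR : 0 < R) (hu : -R ≤ u) (huv : u ≤ v)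
    (hv : v ≤ R) :
    ∫⁻ x in Set.Icc u v, ENNReal.ofReal (1 / Real.sqrt (R ^ 2 - x ^ 2)) =
      ENNReal.ofReal (Real.arcsin (v / R) - Real.arcsin (u / R)) := by
  refine lintegral_Icc_of_hasDerivAt (f := fun x => Real.arcsin (x / R)) huv ?_ ?_ ?_
  · exact (Real.continuous_arcsin.comp (continuous_id.div_const R)).continuousOn
  · intro x hx
    exact hasDerivAt_arcsin_div hR (sq_lt_sq' (by linarith [hx.1]) (by linarith [hx.2]))
  · intro x hx; positivity

theorem lintegral_Icc_one_sub_mul {s : ℝ} (hs : 0 < s) :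
    ∫⁻ x in Set.Icc 0 s⁻¹, ENNReal.ofReal (1 - x * s) = ENNReal.ofReal (1 / (2 * s)) := by
  have h := lintegral_Icc_of_hasDerivAt (f := fun x => x - x ^ 2 * (s / 2))
    (f' := fun x => 1 - x * s) (inv_pos.2 hs).le (by fun_prop) ?_ ?_
  · rw [h]; congr 1; field_simp; ring
  · intro x _
    have := (hasDerivAt_id x).sub (((hasDerivAt_id x).pow 2).mul_const (s / 2))
    refine this.congr_deriv ?_
    simp only [id]; ring
  · intro x hx
    have : x * s ≤ s⁻¹ * s := by gcongr; exact hx.2.le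
    rw [inv_mul_cancel₀ hs.ne'] at this
    linarith

theorem lintegral_Icc_zero_one_inv_sqrt :
    ∫⁻ x in Set.Icc (0 : ℝ) 1, ENNReal.ofReal (1 / Real.sqrt (4 - x ^ 2)) =
      ENNReal.ofReal (Real.pi / 6) := by
  have h := lintegral_Icc_inv_sqrt_sub_sq (R := 2) (u := 0) (v := 1) (by norm_num) (by norm_num)
    (by norm_num) (by norm_num)
  have h2 : Real.arcsin (1 / 2) = Real.pi / 6 :=
    Real.arcsin_eq_of_sin_eq Real.sin_pi_div_six
      ⟨by linarith [Real.pi_pos], by linarith [Real.pi_pos]⟩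
  have h4 : (2 : ℝ) ^ 2 = 4 := by norm_num
  rw [h4, h2, zero_div, Real.arcsin_zero, sub_zero] at h
  exact h

open MeasureTheory in
theorem lintegral_swap_pairs {F : (ℝ × ℝ) × (ℝ × ℝ) → ENNReal} (hF : Measurable F) :
    ∫⁻ a, ∫⁻ b, ∫⁻ c, ∫⁻ d, F ((a, b), (c, d)) = ∫⁻ c, ∫⁻ d, ∫⁻ a, ∫⁻ b, F ((a, b), (c, d)) := by
  have h1 : ∀ p : ℝ × ℝ, ∫⁻ c, ∫⁻ d, F (p, (c, d)) = ∫⁻ q : ℝ × ℝ, F (p, q) := fun p => by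
    rw [Measure.volume_eq_prod, lintegral_prod _ (by fun_prop)]
  have h2 : ∀ q : ℝ × ℝ, ∫⁻ a, ∫⁻ b, F ((a, b), q) = ∫⁻ p : ℝ × ℝ, F (p, q) := fun q => by
    rw [Measure.volume_eq_prod, lintegral_prod _ (by fun_prop)]
  simp only [h1, h2]
  have h3 := lintegral_prod (μ := volume) (ν := volume)
    (fun p : ℝ × ℝ => ∫⁻ q : ℝ × ℝ, F (p, q)) hF.lintegral_prod_right'.aemeasurable
  have h4 := lintegral_prod (μ := volume) (ν := volume)
    (fun q : ℝ × ℝ => ∫⁻ p : ℝ × ℝ, F (p, q)) hF.lintegral_prod_left'.aemeasurable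
  rw [← h3, ← h4]
  exact lintegral_lintegral_swap hF.aemeasurable

open Classical in
/-- The density on triples (leading coefficient, Hessian coefficients) and cubic covariant
coefficient obtained from `reducedBody` by a change of variables. -/
noncomputable def bodyDensity (a A B g : ℝ) : ENNReal :=
  if 0 < a ∧ 0 < A ∧ 0 ≤ B ∧ B ≤ A ∧ 4 * A ^ 3 - g ^ 2 ≤ a ^ 2 ∧
    a ^ 2 * (4 * A ^ 2 - B ^ 2) ≤ 4 * A ^ 3 - g ^ 2 then ENNReal.ofReal (a ^ 2)⁻¹ else 0

theorem measurable_bodyDensity :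
    Measurable fun p : ℝ × ℝ × ℝ × ℝ => bodyDensity p.1 p.2.1 p.2.2.1 p.2.2.2 := by
  unfold bodyDensity
  refine Measurable.ite ?_ (by fun_prop) measurable_const
  simp only [Set.ofPred_and]
  refine MeasurableSet.inter ?_ (MeasurableSet.inter ?_ (MeasurableSet.inter ?_
    (MeasurableSet.inter ?_ (MeasurableSet.inter ?_ ?_))))
  · exact measurableSet_lt (by fun_prop) (by fun_prop)
  · exact measurableSet_lt (by fun_prop) (by fun_prop)
  all_goals exact measurableSet_le (by fun_prop) (by fun_prop)

open MeasureTheory in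
theorem lintegral_bodyDensity_fst_le {A B : ℝ} (hA : 0 < A) (hB0 : 0 ≤ B) (hBA : B ≤ A) (g : ℝ) :
    ∫⁻ a, bodyDensity a A B g ≤
      (Set.Icc (-Real.sqrt (4 * A ^ 3)) (Real.sqrt (4 * A ^ 3))).indicator
        (fun g => ENNReal.ofReal (1 / Real.sqrt (Real.sqrt (4 * A ^ 3) ^ 2 - g ^ 2))) g *
      ENNReal.ofReal (1 - Real.sqrt (4 * A ^ 2 - B ^ 2)) := by
  have hs0 : 0 < 4 * A ^ 2 - B ^ 2 := by nlinarith
  have hR : Real.sqrt (4 * A ^ 3) ^ 2 = 4 * A ^ 3 := Real.sq_sqrt (by positivity)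
  rw [hR]
  set s := Real.sqrt (4 * A ^ 2 - B ^ 2) with hs
  have hspos : 0 < s := Real.sqrt_pos.2 hs0
  have hs2 : s ^ 2 = 4 * A ^ 2 - B ^ 2 := Real.sq_sqrt hs0.le
  set L := 4 * A ^ 3 - g ^ 2 with hL
  rcases le_or_gt L 0 with hL0 | hL0
  · have : ∀ a, bodyDensity a A B g = 0 := fun a => by
      refine if_neg ?_
      rintro ⟨h1, -, -, -, -, h6⟩
      have := mul_pos (pow_pos h1 2) hs0
      linarith
    simp [this]
  have hmem : g ∈ Set.Icc (-Real.sqrt (4 * A ^ 3)) (Real.sqrt (4 * A ^ 3)) :=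
    abs_le.1 (Real.abs_le_sqrt (by linarith))
  rw [Set.indicator_of_mem hmem, ← ENNReal.ofReal_mul (by positivity)]
  set q := Real.sqrt L with hq
  have hqpos : 0 < q := Real.sqrt_pos.2 hL0
  have hq2 : q ^ 2 = L := Real.sq_sqrt hL0.le
  have hle : ∀ a, bodyDensity a A B g ≤
      (Set.Icc q (q / s)).indicator (fun a => ENNReal.ofReal (a ^ 2)⁻¹) a := fun a => by
    unfold bodyDensity
    split_ifs with h
    · obtain ⟨h1, -, -, -, h5, h6⟩ := h
      rw [Set.indicator_of_mem]
      constructor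
      · exact abs_le_of_sq_le_sq' (by rw [hq2]; exact h5) h1.le |>.2
      · rw [le_div_iff₀ hspos]
        refine (abs_le_of_sq_le_sq' ?_ hqpos.le).2
        rw [mul_pow, hs2, hq2]; exact h6
    · exact zero_le
  refine (lintegral_mono hle).trans ?_
  rw [lintegral_indicator measurableSet_Icc]
  rcases le_or_gt q (q / s) with hqs | hqs
  · rw [lintegral_Icc_inv_sq hqpos hqs]
    refine ENNReal.ofReal_le_ofReal (le_of_eq ?_)
    field_simp
  · rw [Set.Icc_eq_empty (not_le.2 hqs)]
    simp

open MeasureTheory in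
theorem lintegral_bodyDensity_pair_le {A B : ℝ} (hA : 0 < A) (hB0 : 0 ≤ B) (hBA : B ≤ A) :
    ∫⁻ a, ∫⁻ b, bodyDensity a A B (2 * A * b - a * B) ≤
      ENNReal.ofReal (Real.pi / (2 * A) * (1 - Real.sqrt (4 * A ^ 2 - B ^ 2))) := by
  have h1 : ∀ a, ∫⁻ b, bodyDensity a A B (2 * A * b - a * B) =
      ENNReal.ofReal (2 * A)⁻¹ * ∫⁻ g, bodyDensity a A B g := fun a => by
    have := lintegral_comp_affine (bodyDensity a A B) (k := 2 * A) (by positivity) (-(a * B))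
    rw [abs_of_pos (by positivity)] at this
    rw [← this]
    congr 1; ext b; congr 1; ring
  simp only [h1]
  rw [lintegral_const_mul' _ _ ENNReal.ofReal_ne_top]
  have hmeas : Measurable (Function.uncurry fun a g => bodyDensity a A B g) :=
    measurable_bodyDensity.comp (by fun_prop : Measurable fun p : ℝ × ℝ => (p.1, A, B, p.2))
  rw [lintegral_lintegral_swap hmeas.aemeasurable]
  have hRpos : 0 < Real.sqrt (4 * A ^ 3) := Real.sqrt_pos.2 (by positivity)
  calc _ ≤ ENNReal.ofReal (2 * A)⁻¹ * (ENNReal.ofReal Real.pi *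
        ENNReal.ofReal (1 - Real.sqrt (4 * A ^ 2 - B ^ 2))) := by
        gcongr
        refine (lintegral_mono (lintegral_bodyDensity_fst_le hA hB0 hBA)).trans ?_
        rw [lintegral_mul_const' _ _ ENNReal.ofReal_ne_top, lintegral_indicator measurableSet_Icc,
          lintegral_Icc_inv_sqrt_sub_sq hRpos le_rfl (by linarith) le_rfl, neg_div,
          div_self hRpos.ne', Real.arcsin_one, Real.arcsin_neg_one]
        refine le_of_eq ?_
        congr 2; ring
    _ = _ := by
        rw [← ENNReal.ofReal_mul Real.pi_pos.le, ← ENNReal.ofReal_mul (by positivity)]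
        congr 1; field_simp

open MeasureTheory in
theorem lintegral_bodyDensity_le :
    ∫⁻ A, ∫⁻ B, ∫⁻ a, ∫⁻ b, bodyDensity a A B (2 * A * b - a * B) ≤
      ENNReal.ofReal (Real.pi ^ 2 / 24) := by
  set h : ℝ → ℝ → ENNReal := fun A r => (Set.Icc (0 : ℝ) 1).indicator (fun r =>
    (Set.Ioi (0 : ℝ)).indicator (fun A =>
      ENNReal.ofReal (Real.pi / 2) * ENNReal.ofReal (1 - A * Real.sqrt (4 - r ^ 2))) A) r with hh
  have h1 : ∀ A, ∫⁻ B, ∫⁻ a, ∫⁻ b, bodyDensity a A B (2 * A * b - a * B) ≤ ∫⁻ r, h A r := by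
    intro A
    rcases le_or_gt A 0 with hA | hA
    · have : ∀ B a b, bodyDensity a A B (2 * A * b - a * B) = 0 := fun B a b =>
        if_neg fun hc => absurd hc.2.1 (not_lt.2 hA)
      simp [this]
    set f : ℝ → ENNReal := fun B => ∫⁻ a, ∫⁻ b, bodyDensity a A B (2 * A * b - a * B) with hf
    have h2 := lintegral_comp_affine f hA.ne' 0
    have h3 : ∫⁻ B, f B = ∫⁻ r, ENNReal.ofReal A * f (0 + A * r) := by
      rw [lintegral_const_mul' _ _ ENNReal.ofReal_ne_top, h2, ← mul_assoc,
        ← ENNReal.ofReal_mul hA.le, abs_of_pos (by positivity), mul_inv_cancel₀ hA.ne',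
        ENNReal.ofReal_one, one_mul]
    rw [h3]
    refine lintegral_mono fun r => ?_
    dsimp only
    rw [zero_add]
    by_cases hr : r ∈ Set.Icc (0 : ℝ) 1
    · have hr0 := hr.1
      have hr1 := hr.2
      have h4 := lintegral_bodyDensity_pair_le hA (mul_nonneg hA.le hr0) (by nlinarith : A * r ≤ A)
      have h5 : Real.sqrt (4 * A ^ 2 - (A * r) ^ 2) = A * Real.sqrt (4 - r ^ 2) := by
        have : 4 * A ^ 2 - (A * r) ^ 2 = A ^ 2 * (4 - r ^ 2) := by ring
        rw [this, Real.sqrt_mul (sq_nonneg A), Real.sqrt_sq hA.le]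
      rw [h5] at h4
      simp only [hh]
      rw [Set.indicator_of_mem hr, Set.indicator_of_mem (Set.mem_Ioi.2 hA),
        ← ENNReal.ofReal_mul (by positivity)]
      refine (mul_le_mul_right h4 _).trans (le_of_eq ?_)
      rw [← ENNReal.ofReal_mul hA.le]
      congr 1; field_simp
    · have : ∀ a b, bodyDensity a A (A * r) (2 * A * b - a * (A * r)) = 0 := fun a b => by
        refine if_neg fun hc => hr ⟨?_, ?_⟩
        · exact nonneg_of_mul_nonneg_right hc.2.2.1 hA
        · exact le_of_mul_le_mul_left (by linarith [hc.2.2.2.1]) hA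
      simp [hf, this]
  refine (lintegral_mono h1).trans ?_
  have hmeas : Measurable (Function.uncurry h) := by
    have e : Function.uncurry h = (Prod.snd ⁻¹' Set.Icc (0 : ℝ) 1).indicator
        ((Prod.fst ⁻¹' Set.Ioi (0 : ℝ)).indicator fun p : ℝ × ℝ =>
          ENNReal.ofReal (Real.pi / 2) * ENNReal.ofReal (1 - p.1 * Real.sqrt (4 - p.2 ^ 2))) := by
      ext ⟨A, r⟩
      rfl
    rw [e]
    exact ((by fun_prop : Measurable fun p : ℝ × ℝ => ENNReal.ofReal (Real.pi / 2) *
      ENNReal.ofReal (1 - p.1 * Real.sqrt (4 - p.2 ^ 2))).indicator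
        (measurable_fst measurableSet_Ioi)).indicator (measurable_snd measurableSet_Icc)
  rw [lintegral_lintegral_swap hmeas.aemeasurable]
  have h6 : ∀ r, ∫⁻ A, h A r ≤ (Set.Icc (0 : ℝ) 1).indicator
      (fun r => ENNReal.ofReal (Real.pi / 4) * ENNReal.ofReal (1 / Real.sqrt (4 - r ^ 2))) r := by
    intro r
    by_cases hr : r ∈ Set.Icc (0 : ℝ) 1
    · have hr0 := hr.1
      have hr1 := hr.2
      have hs : 0 < Real.sqrt (4 - r ^ 2) := Real.sqrt_pos.2 (by nlinarith)
      simp only [hh, Set.indicator_of_mem hr]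
      set s := Real.sqrt (4 - r ^ 2)
      have h7 : ∀ A, (Set.Ioi (0 : ℝ)).indicator (fun A =>
          ENNReal.ofReal (Real.pi / 2) * ENNReal.ofReal (1 - A * s)) A ≤
          ENNReal.ofReal (Real.pi / 2) * (Set.Icc 0 s⁻¹).indicator
            (fun A => ENNReal.ofReal (1 - A * s)) A := fun A => by
        by_cases hA : A ∈ Set.Ioi (0 : ℝ)
        · rw [Set.indicator_of_mem hA]
          by_cases hA' : A ≤ s⁻¹
          · rw [Set.indicator_of_mem (show A ∈ Set.Icc 0 s⁻¹ from ⟨(Set.mem_Ioi.1 hA).le, hA'⟩)]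
          · rw [ENNReal.ofReal_of_nonpos (p := 1 - A * s), mul_zero]
            · exact zero_le
            · have := mul_lt_mul_of_pos_right (not_le.1 hA') hs
              rw [inv_mul_cancel₀ hs.ne'] at this
              linarith
        · rw [Set.indicator_of_notMem hA]; exact zero_le
      refine (lintegral_mono h7).trans ?_
      rw [lintegral_const_mul' _ _ ENNReal.ofReal_ne_top, lintegral_indicator measurableSet_Icc,
        lintegral_Icc_one_sub_mul hs, ← ENNReal.ofReal_mul (by positivity),
        ← ENNReal.ofReal_mul (by positivity)]
      refine ENNReal.ofReal_le_ofReal (le_of_eq ?_)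
      field_simp; norm_num
    · simp [hh, Set.indicator_of_notMem hr]
  refine (lintegral_mono h6).trans ?_
  rw [lintegral_indicator measurableSet_Icc, lintegral_const_mul' _ _ ENNReal.ofReal_ne_top,
    lintegral_Icc_zero_one_inv_sqrt, ← ENNReal.ofReal_mul (by positivity)]
  refine ENNReal.ofReal_le_ofReal (le_of_eq ?_)
  ring

open MeasureTheory in
theorem volume_reducedBody_le {η : ℝ} (hη : 0 < η) :
    volume.real (reducedBody η) ≤ Real.pi ^ 2 / 24 := by
  have hmeas : MeasurableSet (reducedBody η) := (isClosed_reducedBody η).measurableSet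
  have hind : Measurable ((reducedBody η).indicator fun _ => (1 : ENNReal)) :=
    measurable_const.indicator hmeas
  have h1 : volume (reducedBody η) = ∫⁻ a : ℝ, ∫⁻ b : ℝ, ∫⁻ c : ℝ, ∫⁻ d : ℝ,
      (reducedBody η).indicator (fun _ => (1 : ENNReal)) (a, b, c, d) := by
    have h0 : volume (reducedBody η) =
        ∫⁻ v, (reducedBody η).indicator (fun _ => (1 : ENNReal)) v :=
      (lintegral_indicator_one hmeas).symm
    rw [h0, Measure.volume_eq_prod, lintegral_prod _ hind.aemeasurable]
    refine lintegral_congr fun a => ?_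
    have ha : Measurable fun v : ℝ × ℝ × ℝ =>
        (reducedBody η).indicator (fun _ => (1 : ENNReal)) (a, v) :=
      hind.comp measurable_prodMk_left
    rw [Measure.volume_eq_prod, lintegral_prod _ ha.aemeasurable]
    refine lintegral_congr fun b => ?_
    have hb : Measurable fun v : ℝ × ℝ =>
        (reducedBody η).indicator (fun _ => (1 : ENNReal)) (a, b, v) :=
      ha.comp measurable_prodMk_left
    rw [Measure.volume_eq_prod, lintegral_prod _ hb.aemeasurable]
  have h2 : ∀ a b, ∫⁻ c : ℝ, ∫⁻ d : ℝ,
      (reducedBody η).indicator (fun _ => (1 : ENNReal)) (a, b, c, d) ≤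
      ∫⁻ A, ∫⁻ B, bodyDensity a A B (2 * A * b - a * B) := by
    intro a b
    rcases le_or_gt a 0 with ha | ha
    · have : ∀ c d, (reducedBody η).indicator (fun _ => (1 : ENNReal)) (a, b, c, d) = 0 :=
        fun c d => Set.indicator_of_notMem (fun hc => absurd (hη.trans_le hc.1) (not_lt.2 ha)) _
      simp [this]
    set q : ℝ → ℝ → ENNReal := fun A B => bodyDensity a A B (2 * A * b - a * B) with hq
    have h3 : ∀ c d, (reducedBody η).indicator (fun _ => (1 : ENNReal)) (a, b, c, d) ≤
        ENNReal.ofReal (a ^ 2) * q (b ^ 2 + -a * c) (b * c + -a * d) := by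
      intro c d
      by_cases hm : (a, b, c, d) ∈ reducedBody η
      · rw [Set.indicator_of_mem hm]
        obtain ⟨-, k2, k3, k4, k5, k6⟩ := hm
        dsimp only at k2 k3 k4 k5 k6
        have hc : b ^ 2 + -a * c = b ^ 2 - a * c := by ring
        have hd : b * c + -a * d = b * c - a * d := by ring
        rw [hc, hd]
        simp only [hq, bodyDensity]
        have i1 : a ^ 2 * (4 * (b ^ 2 - a * c) * (c ^ 2 - b * d) - (b * c - a * d) ^ 2) =
            4 * (b ^ 2 - a * c) ^ 3 - (2 * (b ^ 2 - a * c) * b - a * (b * c - a * d)) ^ 2 := by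
          ring
        have ha2 : 0 < a ^ 2 := by positivity
        have hA : 0 < b ^ 2 - a * c := by linarith
        rw [if_pos, ← ENNReal.ofReal_mul ha2.le, mul_inv_cancel₀ ha2.ne', ENNReal.ofReal_one]
        refine ⟨ha, hA, k3, k4, ?_, ?_⟩
        · rw [← i1]; nlinarith
        · rw [← i1]
          refine mul_le_mul_of_nonneg_left ?_ ha2.le
          nlinarith
      · rw [Set.indicator_of_notMem hm]; exact zero_le
    refine (lintegral_mono fun c => lintegral_mono (h3 c)).trans (le_of_eq ?_)
    have h4 : ∀ c, ∫⁻ d, ENNReal.ofReal (a ^ 2) * q (b ^ 2 + -a * c) (b * c + -a * d) =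
        ENNReal.ofReal a * ∫⁻ B, q (b ^ 2 + -a * c) B := fun c => by
      rw [lintegral_const_mul' _ _ ENNReal.ofReal_ne_top,
        lintegral_comp_affine (q (b ^ 2 + -a * c)) (neg_ne_zero.2 ha.ne'), ← mul_assoc,
        ← ENNReal.ofReal_mul (by positivity), inv_neg, abs_neg, abs_of_pos (by positivity)]
      congr 2; field_simp
    simp only [h4]
    rw [lintegral_const_mul' _ _ ENNReal.ofReal_ne_top,
      lintegral_comp_affine (fun A => ∫⁻ B, q A B) (neg_ne_zero.2 ha.ne'), ← mul_assoc,
        ← ENNReal.ofReal_mul (by positivity), inv_neg, abs_neg, abs_of_pos (by positivity),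
        mul_inv_cancel₀ ha.ne', ENNReal.ofReal_one, one_mul]
  have h5 : volume (reducedBody η) ≤ ENNReal.ofReal (Real.pi ^ 2 / 24) := by
    rw [h1]
    refine (lintegral_mono fun a => lintegral_mono (h2 a)).trans ?_
    rw [lintegral_swap_pairs (F := fun p => bodyDensity p.1.1 p.2.1 p.2.2
      (2 * p.2.1 * p.1.2 - p.1.1 * p.2.2))]
    · exact lintegral_bodyDensity_le
    · exact measurable_bodyDensity.comp (by fun_prop : Measurable fun p : (ℝ × ℝ) × (ℝ × ℝ) =>
        (p.1.1, p.2.1, p.2.2, 2 * p.2.1 * p.1.2 - p.1.1 * p.2.2))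
  exact ENNReal.toReal_le_of_le_ofReal (by positivity) h5

theorem hasProd_one_sub_inv_sq :
    Tendsto (fun s : Finset Nat.Primes => ∏ p ∈ s, (1 - ((p : ℝ) ^ 2)⁻¹)) atTop
      (nhds (6 / Real.pi ^ 2)) := by
  let f : ℕ →*₀ ℝ :=
    { toFun := fun n => ((n : ℝ) ^ 2)⁻¹
      map_zero' := by simp
      map_one' := by simp
      map_mul' := fun a b => by push_cast; rw [mul_pow, mul_inv] }
  have hz : HasSum (fun n : ℕ => ((n : ℝ) ^ 2)⁻¹) (Real.pi ^ 2 / 6) := by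
    simpa only [one_div] using hasSum_zeta_two
  have hsum : Summable fun n => ‖f n‖ := by
    refine hz.summable.congr fun n => ?_
    change _ = ‖((n : ℝ) ^ 2)⁻¹‖
    rw [Real.norm_of_nonneg (by positivity)]
  have h := EulerProduct.eulerProduct_completely_multiplicative_hasProd hsum
  have hval : ∑' n, f n = Real.pi ^ 2 / 6 := hz.tsum_eq
  rw [hval] at h
  have h' : Tendsto (fun s : Finset Nat.Primes => ∏ p ∈ s, (1 - f p)⁻¹) atTop
      (nhds (Real.pi ^ 2 / 6)) := by
    simpa [HasProd] using h
  have h2 := h'.inv₀ (by positivity)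
  rw [inv_div] at h2
  refine h2.congr fun s => ?_
  rw [Finset.prod_inv_distrib, inv_inv]
  rfl

theorem one_sub_inv_sq_mem {p : ℕ} (hp : p.Prime) :
    0 ≤ 1 - ((p : ℝ) ^ 2)⁻¹ ∧ 1 - ((p : ℝ) ^ 2)⁻¹ ≤ 1 := by
  have h2 : (1 : ℝ) ≤ (p : ℝ) ^ 2 := one_le_pow₀ (by exact_mod_cast hp.one_lt.le)
  exact ⟨sub_nonneg.2 (inv_le_one_of_one_le₀ h2), by simp⟩

theorem antitone_prod_one_sub_inv_sq :
    Antitone (fun s : Finset Nat.Primes => ∏ p ∈ s, (1 - ((p : ℝ) ^ 2)⁻¹)) :=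
  Finset.prod_anti_set_of_le_one (fun p => (one_sub_inv_sq_mem p.2).1)
    fun p => (one_sub_inv_sq_mem p.2).2

theorem exists_prod_one_sub_inv_sq_lt {ε : ℝ} (hε : 0 < ε) (N : ℕ) :
    ∃ z : ℕ, N ≤ z ∧ ∀ W : ℕ, W ≠ 0 → (∀ p : ℕ, p.Prime → p ≤ z → p ∣ W) →
      6 / Real.pi ^ 2 ≤ ∏ p ∈ W.primeFactors, (1 - ((p : ℝ) ^ 2)⁻¹) ∧
      ∏ p ∈ W.primeFactors, (1 - ((p : ℝ) ^ 2)⁻¹) < 6 / Real.pi ^ 2 + ε := by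
  obtain ⟨s, hs⟩ := eventually_atTop.1
    (hasProd_one_sub_inv_sq.eventually_lt_const (lt_add_of_pos_right _ hε))
  refine ⟨max N (s.sup fun p => (p : ℕ)), le_max_left _ _, fun W hW hz => ?_⟩
  set t : Finset Nat.Primes := W.primeFactors.subtype Nat.Prime with ht
  have hprod : ∏ p ∈ t, (1 - ((p : ℝ) ^ 2)⁻¹) =
      ∏ p ∈ W.primeFactors, (1 - ((p : ℝ) ^ 2)⁻¹) :=
    Finset.prod_subtype_of_mem (fun p : ℕ => 1 - ((p : ℝ) ^ 2)⁻¹)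
      fun p hp => Nat.prime_of_mem_primeFactors hp
  rw [← hprod]
  refine ⟨antitone_prod_one_sub_inv_sq.le_of_tendsto hasProd_one_sub_inv_sq t, hs t fun p hp => ?_⟩
  refine Finset.mem_subtype.2 (Nat.mem_primeFactors.2 ?_)
  exact ⟨p.2, hz p p.2 ((Finset.le_sup (f := fun p : Nat.Primes => (p : ℕ)) hp).trans
    (le_max_right _ _)), hW⟩

open Classical in
theorem card_cubicDisc_mem_le {m M W : ℕ} [NeZero W]
    (h5 : ∀ p ∈ W.primeFactors, 5 ≤ W.factorization p) (h2 : 2 ∣ W) :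
    ((Finset.univ.filter fun v : Fin 4 → ZMod W => cubicDisc v ∈ admissibleResidues m M W).card : ℝ)
      ≤ (admissibleResidues m M W).card *
        (2 * (∏ p ∈ W.primeFactors, (1 - ((p : ℝ) ^ 2)⁻¹)) * (W : ℝ) ^ 3) := by
  have hmaps : Set.MapsTo (fun v : Fin 4 → ZMod W => cubicDisc v)
      (Finset.univ.filter fun v : Fin 4 → ZMod W => cubicDisc v ∈ admissibleResidues m M W)
      (admissibleResidues m M W) := fun v hv => (Finset.mem_filter.1 hv).2
  rw [Finset.card_eq_sum_card_fiberwise hmaps, Nat.cast_sum, ← nsmul_eq_mul]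
  refine Finset.sum_le_card_nsmul _ _ _ fun r hr => ?_
  refine le_trans ?_ (card_cubicDisc_eq_le h5 h2 r
    fun p hp => (mem_admissibleResidues.1 hr p hp).1)
  rw [Nat.card_eq_fintype_card, Fintype.card_subtype]
  exact_mod_cast Finset.card_le_card fun v hv =>
    Finset.mem_filter.2 ⟨Finset.mem_univ _, (Finset.mem_filter.1 hv).2⟩

theorem cubicDisc_residueVec (W : ℕ) (a b c d : ℤ) :
    cubicDisc (residueVec W (a, b, c, d)) =
      (((b * c - a * d) ^ 2 - 4 * (b ^ 2 - a * c) * (c ^ 2 - b * d) : ℤ) : ZMod W) := by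
  simp [cubicDisc, residueVec]

theorem eventually_card_three_dvd_le {m M W : ℕ} [NeZero W]
    (h5 : ∀ p ∈ W.primeFactors, 5 ≤ W.factorization p) (h2 : 2 ∣ W) (hMW : M ∣ W) {ε : ℝ}
    (hε : 0 < ε) :
    ∀ᶠ x : ℝ in atTop, ∀ T : Finset ℤ, (∀ Δ ∈ T, IsFundamentalDiscriminant Δ ∧ -x < (Δ : ℝ) ∧
      Δ < 0 ∧ Δ ≡ m [ZMOD M] ∧ 3 ∣ classNum Δ) →
      (T.card : ℝ) ≤ ((admissibleResidues m M W).card / W *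
        (2 * ∏ p ∈ W.primeFactors, (1 - ((p : ℝ) ^ 2)⁻¹)) * (Real.pi ^ 2 / 24) + ε) * x := by
  classical
  have hW : 0 < W := NeZero.pos W
  have hW' : (0 : ℝ) < W := by exact_mod_cast hW
  filter_upwards [eventually_card_isReducedForm_le (fun η hη => volume_reducedBody_le hη) hW
    (Finset.univ.filter fun v : Fin 4 → ZMod W => cubicDisc v ∈ admissibleResidues m M W) hε,
    eventually_ge_atTop 0] with x hx hx0 T hT
  have hex : ∀ Δ : ℤ, ∃ v : ℤ × ℤ × ℤ × ℤ, Δ ∈ T → IsReducedForm x v ∧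
      (v.2.1 * v.2.2.1 - v.1 * v.2.2.2) ^ 2 - 4 * (v.2.1 ^ 2 - v.1 * v.2.2.1) *
        (v.2.2.1 ^ 2 - v.2.1 * v.2.2.2) = Δ := by
    intro Δ
    by_cases hΔ : Δ ∈ T
    · obtain ⟨h1, hxΔ, h3, -, h6⟩ := hT Δ hΔ
      obtain ⟨a, b, c, d, k1, k2, k3, k4, k5⟩ :=
        exists_reduced_cubic_of_three_dvd_classNum h3 h1 h6
      refine ⟨(a, b, c, d), fun _ => ⟨⟨k1, k2, k3, k4, ?_, ?_⟩, k5⟩⟩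
      · dsimp only
        rcases (k2.trans k3).lt_or_eq with h | h
        · exact h
        · rw [← h] at k3 k5
          have : b * c - a * d = 0 := le_antisymm k3 k2
          rw [this] at k5
          norm_num at k5
          omega
      · have k6 : 4 * (b ^ 2 - a * c) * (c ^ 2 - b * d) - (b * c - a * d) ^ 2 = -Δ := by
          rw [← k5]; ring
        dsimp only
        rw [k6]
        push_cast
        linarith
    · exact ⟨0, fun h => absurd h hΔ⟩
  choose v hv using hex
  have hinj : Set.InjOn v (T : Set ℤ) := fun Δ hΔ Δ' hΔ' he => by
    rw [← (hv Δ hΔ).2, ← (hv Δ' hΔ').2, he]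
  have hcard := hx (T.image v) (fun w hw => by
      obtain ⟨Δ, hΔ, rfl⟩ := Finset.mem_image.1 hw
      exact (hv Δ hΔ).1) (fun w hw => by
      obtain ⟨Δ, hΔ, rfl⟩ := Finset.mem_image.1 hw
      refine Finset.mem_filter.2 ⟨Finset.mem_univ _, ?_⟩
      obtain ⟨h1, -, h3, h4, -⟩ := hT Δ hΔ
      have he : cubicDisc (residueVec W (v Δ)) = (Δ : ZMod W) := by
        conv_rhs => rw [← (hv Δ hΔ).2]
        exact cubicDisc_residueVec W _ _ _ _
      rw [he]
      exact intCast_mem_admissibleResidues h5 hMW h1 h4)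
  rw [Finset.card_image_of_injOn hinj] at hcard
  refine hcard.trans ?_
  gcongr
  rw [div_le_iff₀ (by positivity)]
  refine (card_cubicDisc_mem_le h5 h2).trans (le_of_eq ?_)
  field_simp

theorem validPair_one_one : ValidPair 1 1 :=
  ⟨fun ℓ hℓ _ hd => absurd (Nat.dvd_one.1 (by simpa using hd)) hℓ.one_lt.ne',
    fun h => absurd h (by norm_num)⟩

theorem exists_modulus {M z : ℕ} (hM : M ≠ 0) (hz : 2 ≤ z) :
    ∃ W : ℕ, W ≠ 0 ∧ (∀ p ∈ W.primeFactors, 5 ≤ W.factorization p) ∧ M ∣ W ∧ 2 ∣ W ∧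
      ∀ p : ℕ, p.Prime → p ≤ z → p ∣ W := by
  have h0 : M * z.factorial ≠ 0 := mul_ne_zero hM z.factorial_ne_zero
  have hdvd : M * z.factorial ∣ (M * z.factorial) ^ 5 := dvd_pow_self _ (by norm_num)
  have hp : ∀ p : ℕ, p.Prime → p ≤ z → p ∣ (M * z.factorial) ^ 5 := fun p hp hpz =>
    ((Nat.dvd_factorial hp.pos hpz).trans (dvd_mul_left _ _)).trans hdvd
  refine ⟨(M * z.factorial) ^ 5, pow_ne_zero _ h0, fun p hp => ?_,
    (dvd_mul_right _ _).trans hdvd, hp 2 Nat.prime_two hz, hp⟩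
  rw [Nat.primeFactors_pow _ (by norm_num)] at hp
  have h1 := (Nat.prime_of_mem_primeFactors hp).factorization_pos_of_dvd h0
    (Nat.dvd_of_mem_primeFactors hp)
  rw [Nat.factorization_pow, Finsupp.smul_apply, smul_eq_mul]
  omega

open Classical in
theorem card_fundamental_le {W : ℕ} [NeZero W]
    (h5 : ∀ p ∈ W.primeFactors, 5 ≤ W.factorization p) {x : ℝ} (hx : 0 < x) :
    (((negInts x).filter IsFundamentalDiscriminant).card : ℝ) ≤
      (admissibleResidues 1 1 W).card * (x / W) + (admissibleResidues 1 1 W).card * 2 := by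
  have h1 := (abs_le.1 (abs_card_negInts_residues_sub_le (admissibleResidues 1 1 W) hx)).2
  have h2 : ((negInts x).filter IsFundamentalDiscriminant).card ≤
      ((negInts x).filter fun Δ : ℤ => (Δ : ZMod W) ∈ admissibleResidues 1 1 W).card := by
    refine Finset.card_le_card fun Δ hΔ => ?_
    obtain ⟨k1, k2⟩ := Finset.mem_filter.1 hΔ
    exact Finset.mem_filter.2 ⟨k1, intCast_mem_admissibleResidues h5 (one_dvd _) k2
      (by simpa using Int.modEq_one)⟩
  have h3 : (((negInts x).filter IsFundamentalDiscriminant).card : ℝ) ≤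
      ((negInts x).filter fun Δ : ℤ => (Δ : ZMod W) ∈ admissibleResidues 1 1 W).card := by
    exact_mod_cast h2
  linarith

open Classical in
theorem le_card_fundamental_modEq {m M W z : ℕ} [NeZero W] (hM : M ≠ 0)
    (h5 : ∀ p ∈ W.primeFactors, 5 ≤ W.factorization p) (hMW : M ∣ W) (hz : 2 ≤ z)
    (hzW : ∀ p : ℕ, p.Prime → p ≤ z → p ∣ W) {x : ℝ} (hx : 0 < x) :
    (admissibleResidues m M W).card * (x / W) - (admissibleResidues m M W).card * 2 - x / z ≤
      (((negInts x).filter fun Δ => IsFundamentalDiscriminant Δ ∧ Δ ≡ m [ZMOD M]).card : ℝ) := by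
  have h1 := (abs_le.1 (abs_card_negInts_residues_sub_le (admissibleResidues m M W) hx)).1
  have h2 := card_negInts_exists_sq_dvd_le (z := z) (by omega) hx
  have h3 : ((negInts x).filter fun Δ : ℤ => (Δ : ZMod W) ∈ admissibleResidues m M W).card ≤
      ((negInts x).filter fun Δ => IsFundamentalDiscriminant Δ ∧ Δ ≡ m [ZMOD M]).card +
      ((negInts x).filter fun Δ => ∃ n : ℕ, z < n ∧ (n : ℤ) ^ 2 ∣ Δ).card := by
    refine le_trans (Finset.card_le_card fun Δ hΔ => ?_) (Finset.card_union_le _ _)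
    obtain ⟨k1, k2⟩ := Finset.mem_filter.1 hΔ
    by_cases hn : ∃ n : ℕ, z < n ∧ (n : ℤ) ^ 2 ∣ Δ
    · exact Finset.mem_union_right _ (Finset.mem_filter.2 ⟨k1, hn⟩)
    · exact Finset.mem_union_left _ (Finset.mem_filter.2 ⟨k1,
        isFundamentalDiscriminant_of_mem hM h5 hMW hz hzW (mem_negInts.1 k1).2 k2 hn⟩)
  have h4 : (((negInts x).filter fun Δ : ℤ =>
      (Δ : ZMod W) ∈ admissibleResidues m M W).card : ℝ) ≤
      ((negInts x).filter fun Δ => IsFundamentalDiscriminant Δ ∧ Δ ≡ m [ZMOD M]).card +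
      ((negInts x).filter fun Δ => ∃ n : ℕ, z < n ∧ (n : ℤ) ^ 2 ∣ Δ).card := by
    exact_mod_cast h3
  linarith

open Classical in
/-- The counting inequality behind the density bound, with explicit sieving parameters. -/
theorem eventually_le_card_not_three_dvd {m M W z : ℕ} [NeZero W] (hM : M ≠ 0)
    (h5 : ∀ p ∈ W.primeFactors, 5 ≤ W.factorization p) (hMW : M ∣ W) (h2 : 2 ∣ W) (hz : 2 ≤ z)
    (hzW : ∀ p : ℕ, p.Prime → p ≤ z → p ∣ W) {ε : ℝ} (hε : 0 < ε) :
    ∀ᶠ x : ℝ in atTop,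
      ((admissibleResidues m M W).card / W *
        (1 - (2 * ∏ p ∈ W.primeFactors, (1 - ((p : ℝ) ^ 2)⁻¹)) * (Real.pi ^ 2 / 24))
        - 1 / z - ε) * x ≤
      (((negInts x).filter fun Δ => IsFundamentalDiscriminant Δ ∧ Δ ≡ m [ZMOD M] ∧
        ¬ 3 ∣ classNum Δ).card : ℝ) := by
  filter_upwards [eventually_card_three_dvd_le (m := m) h5 h2 hMW (half_pos hε),
    eventually_gt_atTop 0,
    eventually_ge_atTop ((admissibleResidues m M W).card * 2 / (ε / 2))] with x h1 hx hxε
  have h3 := le_card_fundamental_modEq (m := m) hM h5 hMW hz hzW hx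
  have h4 := h1 ((negInts x).filter fun Δ => IsFundamentalDiscriminant Δ ∧ Δ ≡ m [ZMOD M] ∧
    3 ∣ classNum Δ) fun Δ hΔ => by
      obtain ⟨k1, k2, k3, k4⟩ := Finset.mem_filter.1 hΔ
      exact ⟨k2, (mem_negInts.1 k1).1, (mem_negInts.1 k1).2, k3, k4⟩
  have h5' : ((negInts x).filter fun Δ => IsFundamentalDiscriminant Δ ∧ Δ ≡ m [ZMOD M]).card ≤
      ((negInts x).filter fun Δ => IsFundamentalDiscriminant Δ ∧ Δ ≡ m [ZMOD M] ∧
        ¬ 3 ∣ classNum Δ).card +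
      ((negInts x).filter fun Δ => IsFundamentalDiscriminant Δ ∧ Δ ≡ m [ZMOD M] ∧
        3 ∣ classNum Δ).card := by
    refine le_trans (Finset.card_le_card fun Δ hΔ => ?_) (Finset.card_union_le _ _)
    obtain ⟨k1, k2, k3⟩ := Finset.mem_filter.1 hΔ
    by_cases hn : 3 ∣ classNum Δ
    · exact Finset.mem_union_right _ (Finset.mem_filter.2 ⟨k1, k2, k3, hn⟩)
    · exact Finset.mem_union_left _ (Finset.mem_filter.2 ⟨k1, k2, k3, hn⟩)
  have h6 : (((negInts x).filter fun Δ =>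
      IsFundamentalDiscriminant Δ ∧ Δ ≡ m [ZMOD M]).card : ℝ) ≤
      ((negInts x).filter fun Δ => IsFundamentalDiscriminant Δ ∧ Δ ≡ m [ZMOD M] ∧
        ¬ 3 ∣ classNum Δ).card +
      ((negInts x).filter fun Δ => IsFundamentalDiscriminant Δ ∧ Δ ≡ m [ZMOD M] ∧
        3 ∣ classNum Δ).card := by
    exact_mod_cast h5'
  rw [div_le_iff₀ (half_pos hε)] at hxε
  have e1 : ((admissibleResidues m M W).card : ℝ) * (x / W) =
    (admissibleResidues m M W).card / W * x := by ring
  have e2 : x / (z : ℝ) = 1 / z * x := by ring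
  rw [e1, e2] at h3
  linarith

open Classical in
theorem eventually_sub_le_ratio {m M : ℕ} (hM : M ≠ 0) (h : ValidPair m M) {κ : ℝ}
    (hκ : κ = 1 / (M.totient : ℝ) * ∏ p ∈ M.primeFactors,
        (if p = 2 then (4 : ℝ) else (p : ℝ)) / ((p : ℝ) + 1)) {δ : ℝ} (hδ : 0 < δ)
    {A N : ℝ → ℝ}
    (hA : ∀ x, A x = ((negInts x).filter fun Δ => IsFundamentalDiscriminant Δ ∧
      Δ ≡ m [ZMOD M] ∧ ¬ 3 ∣ classNum Δ).card)
    (hN : ∀ x, N x = ((negInts x).filter IsFundamentalDiscriminant).card) :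
    ∀ᶠ x : ℝ in atTop, κ / 2 - δ ≤ A x / N x := by
  have hκ0 : 0 ≤ κ := by
    rw [hκ]
    refine mul_nonneg (by positivity) (Finset.prod_nonneg fun p _ => ?_)
    split_ifs <;> positivity
  have hπ : (0 : ℝ) < Real.pi ^ 2 := by positivity
  by_cases hδκ : κ / 2 - δ < 0
  · refine Eventually.of_forall fun x => hδκ.le.trans ?_
    rw [hA, hN]
    positivity
  push Not at hδκ
  set c : ℝ := δ * (3 / Real.pi ^ 2) with hc
  have hc0 : 0 < c := by positivity
  set ε : ℝ := c / (4 * (1 + κ)) with hε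
  have hε0 : 0 < ε := by positivity
  have hεκ : ε * (1 + κ) = c / 4 := by rw [hε]; field_simp
  set η : ℝ := 3 * δ / (Real.pi ^ 2 * (1 + κ)) with hη
  have hη0 : 0 < η := by positivity
  have hηκ : η * Real.pi ^ 2 * (1 + κ) = 3 * δ := by rw [hη]; field_simp
  obtain ⟨z₀, hz₀⟩ := exists_nat_gt (4 / c)
  obtain ⟨z, hz, hP⟩ := exists_prod_one_sub_inv_sq_lt hη0 (max z₀ 2)
  have hz2 : 2 ≤ z := (le_max_right _ _).trans hz
  have hzr : (z₀ : ℝ) ≤ z := by exact_mod_cast (le_max_left _ _).trans hz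
  have hz1 : 1 / (z : ℝ) ≤ c / 4 := by
    rw [div_le_div_iff₀ (by positivity) (by norm_num)]
    rw [div_lt_iff₀ hc0] at hz₀
    nlinarith
  obtain ⟨W, hW, h5, hMW, h2, hzW⟩ := exists_modulus hM hz2
  have : NeZero W := ⟨hW⟩
  obtain ⟨hP1, hP2⟩ := hP W hW hzW
  have hW0 : (W : ℝ) ≠ 0 := by exact_mod_cast hW
  have hR1 := card_admissibleResidues one_ne_zero validPair_one_one h5 (one_dvd W)
  have hR := card_admissibleResidues hM h h5 hMW
  rw [prod_admissibleDensity_one hW h2] at hR1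
  rw [prod_admissibleDensity hM hW hMW, prod_admissibleDensity_one hW h2, ← hκ] at hR
  have hA' := eventually_le_card_not_three_dvd (m := m) hM h5 hMW h2 hz2 hzW hε0
  rw [hR] at hA'
  set P : ℝ := ∏ p ∈ W.primeFactors, (1 - ((p : ℝ) ^ 2)⁻¹) with hPdef
  filter_upwards [hA', eventually_gt_atTop 4, eventually_ge_atTop (P * W / ε)] with x h1 hx4 hxε
  have hx : 0 < x := by linarith
  have h3 := card_fundamental_le h5 hx
  rw [← hA] at h1
  rw [← hN, hR1] at h3
  rw [div_le_iff₀ hε0] at hxε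
  rw [mul_div_cancel_right₀ _ hW0] at h1
  have e1 : P / 2 * W * (x / W) = P / 2 * x := by field_simp
  rw [e1] at h3
  have hN0 : 0 < N x := by
    rw [hN, Nat.cast_pos, Finset.card_pos]
    refine ⟨-4, Finset.mem_filter.2 ⟨mem_negInts.2 ⟨by push_cast; linarith, by norm_num⟩,
      by norm_num, Or.inr ⟨by norm_num, ?_, Or.inr (by norm_num)⟩⟩⟩
    norm_num
  rw [le_div_iff₀ hN0]
  have hNx : N x ≤ (P / 2 + ε) * x := by linarith
  refine (mul_le_mul_of_nonneg_left hNx hδκ).trans (le_trans ?_ h1)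
  rw [← mul_assoc]
  refine mul_le_mul_of_nonneg_right ?_ hx.le
  have hcP : c ≤ δ * (P / 2) := by
    rw [hc]
    refine mul_le_mul_of_nonneg_left ?_ hδ.le
    calc 3 / Real.pi ^ 2 = 6 / Real.pi ^ 2 / 2 := by ring
      _ ≤ P / 2 := by linarith
  have hPπ : P * Real.pi ^ 2 ≤ 6 + η * Real.pi ^ 2 := by
    have := mul_le_mul_of_nonneg_right hP2.le hπ.le
    rwa [add_mul, div_mul_cancel₀ _ hπ.ne'] at this
  have hηκ' : κ * (η * Real.pi ^ 2) ≤ 3 * δ := by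
    rw [← hηκ]
    nlinarith [mul_pos hη0 hπ]
  have hP0 : 0 ≤ P / 2 := by
    have : 0 ≤ 6 / Real.pi ^ 2 := by positivity
    linarith
  have key : κ * (P / 2) * (P * Real.pi ^ 2) ≤ κ * (P / 2) * 6 + 3 * δ * (P / 2) := by
    calc κ * (P / 2) * (P * Real.pi ^ 2) ≤ κ * (P / 2) * (6 + η * Real.pi ^ 2) :=
          mul_le_mul_of_nonneg_left hPπ (mul_nonneg hκ0 hP0)
      _ = κ * (P / 2) * 6 + κ * (η * Real.pi ^ 2) * (P / 2) := by ring
      _ ≤ _ := by gcongr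
  have hκε : 0 ≤ κ * ε := by positivity
  have hδε : 0 < δ * ε := by positivity
  nlinarith

theorem le_liminf_of_eventually_sub_le {f : ℝ → ℝ} {b a : ℝ} (hb : ∀ x, f x ≤ b)
    (ha : ∀ δ > 0, ∀ᶠ x in atTop, a - δ ≤ f x) : a ≤ liminf f atTop :=
  le_of_forall_sub_le fun δ hδ =>
    le_liminf_of_le (IsCoboundedUnder.of_frequently_le (Frequently.of_forall hb)) (ha δ hδ)


/-- for a valid pair `(m, M)`, the lower density, among negative fundamental
discriminants, of those `Δ` with `Δ ≡ m (mod M)` and `3 ∤ h(Δ)` is at least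
`1/(2 Φ(M)) ∏_{p ∣ M} q(p)/(p+1)` where `q(2) = 4` and `q(p) = p` for odd `p`. -/
theorem lower_density_valid_pair
    (m M : ℕ) (hm : 0 < m) (hM : 0 < M) (h : ValidPair m M) :
    (1 / (2 * (Nat.totient M : ℝ))) *
        ∏ p ∈ M.primeFactors, (if p = 2 then (4 : ℝ) else (p : ℝ)) / ((p : ℝ) + 1) ≤
      Filter.liminf (fun x : ℝ =>
        ((Nat.card {Δ : ℤ | IsFundamentalDiscriminant Δ ∧ -x < (Δ : ℝ) ∧ Δ < 0 ∧
            Δ ≡ (m : ℤ) [ZMOD (M : ℤ)] ∧ ¬ (3 ∣ classNum Δ)} : ℕ) : ℝ) /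
        ((Nat.card {Δ : ℤ | IsFundamentalDiscriminant Δ ∧ -x < (Δ : ℝ) ∧ Δ < 0} : ℕ) : ℝ))
        Filter.atTop := by
  classical
  have hA : ∀ x : ℝ, Nat.card {Δ : ℤ | IsFundamentalDiscriminant Δ ∧ -x < (Δ : ℝ) ∧ Δ < 0 ∧
      Δ ≡ (m : ℤ) [ZMOD (M : ℤ)] ∧ ¬ (3 ∣ classNum Δ)} =
      ((negInts x).filter fun Δ => IsFundamentalDiscriminant Δ ∧ Δ ≡ m [ZMOD M] ∧
        ¬ 3 ∣ classNum Δ).card := fun x =>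
    Nat.subtype_card _ fun Δ => by
      simp only [Finset.mem_filter, mem_negInts, Set.mem_ofPred_eq]
      tauto
  have hN : ∀ x : ℝ, Nat.card {Δ : ℤ | IsFundamentalDiscriminant Δ ∧ -x < (Δ : ℝ) ∧ Δ < 0} =
      ((negInts x).filter IsFundamentalDiscriminant).card := fun x =>
    Nat.subtype_card _ fun Δ => by
      simp only [Finset.mem_filter, mem_negInts, Set.mem_ofPred_eq]
      tauto
  simp only [hA, hN]
  refine le_liminf_of_eventually_sub_le (b := 1) (fun x => ?_) fun δ hδ => ?_
  · refine div_le_one_of_le₀ (Nat.cast_le.2 (Finset.card_le_card fun Δ hΔ => ?_))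
      (Nat.cast_nonneg _)
    exact Finset.mem_filter.2 ⟨(Finset.mem_filter.1 hΔ).1, (Finset.mem_filter.1 hΔ).2.1⟩
  · filter_upwards [eventually_sub_le_ratio hM.ne' h rfl hδ (fun _ => rfl) fun _ => rfl] with x hx
    refine le_trans (le_of_eq ?_) hx
    rw [one_div, mul_inv]
    ring
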